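/- The abstract algebra 𝒮 over F = ℂ(q) generated by elements s_ij^{(r)} (1 ≤ i,j ≤ N, r ≥ 0) with defining relations s_ij^{(0)} = 0 for i < j, s_ii^{(0)} = 1, and the affine reflection equation R(u,v) S₁(u) Rᵗ(u⁻¹,v) S₂(v) = S₂(v) Rᵗ(u⁻¹,v) S₁(u) R(u,v) for S(u) = Σ s_ij(u)⊗E_ij, s_ij(u) = Σ_{r≥0} s_ij^{(r)} u^{−r}, is isomorphic to the twisted q-Yangian Y^tw_q(o_N), via the map sending s_ij^{(r)} to the coefficient of u^{−r} in Σ_{a=1}^N t_ia(u) t̄_ja(u⁻¹). -/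

import Mathlib

noncomputable section

open scoped TensorProduct

abbrev FF : Type := RatFunc ℂ

def qq : FF := RatFunc.X

/-! Constant R-matrices acting in `ℂ^N ⊗ ℂ^N`, written as matrices indexed by pairs. -/

def Rc (F : Type) [Field F] (q : F) (N : ℕ) :
    Matrix (Fin N × Fin N) (Fin N × Fin N) F := Matrix.of fun p r =>
  (if p = r then (if p.1 = p.2 then q else 1) else 0)
  + (if p.1 = r.2 ∧ p.2 = r.1 ∧ p.1 < p.2 then q - q⁻¹ else 0)

/-- `R` transposed in the first tensor factor. -/
def Rct (F : Type) [Field F] (q : F) (N : ℕ) :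
    Matrix (Fin N × Fin N) (Fin N × Fin N) F :=
  Matrix.of fun p r => Rc F q N (r.1, p.2) (p.1, r.2)

def Rtil (F : Type) [Field F] (q : F) (N : ℕ) :
    Matrix (Fin N × Fin N) (Fin N × Fin N) F := Matrix.of fun p r =>
  (if p = r then (if p.1 = p.2 then q⁻¹ else 1) else 0)
  + (if p.1 = r.2 ∧ p.2 = r.1 ∧ p.2 < p.1 then q⁻¹ - q else 0)

def Rtilt (F : Type) [Field F] (q : F) (N : ℕ) :
    Matrix (Fin N × Fin N) (Fin N × Fin N) F :=
  Matrix.of fun p r => Rtil F q N (r.1, p.2) (p.1, r.2)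

/-- `S ↦ S ⊗ 1` (action in the first copy of `End ℂ^N`). -/
def amp1 {A : Type} [Ring A] {N : ℕ} (M : Matrix (Fin N) (Fin N) A) :
    Matrix (Fin N × Fin N) (Fin N × Fin N) A :=
  Matrix.of fun p r => if p.2 = r.2 then M p.1 r.1 else 0

/-- `S ↦ 1 ⊗ S` (action in the second copy of `End ℂ^N`). -/
def amp2 {A : Type} [Ring A] {N : ℕ} (M : Matrix (Fin N) (Fin N) A) :
    Matrix (Fin N × Fin N) (Fin N × Fin N) A :=
  Matrix.of fun p r => if p.1 = r.1 then M p.2 r.2 else 0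

/-- A scalar matrix viewed as a matrix over an `F`-algebra `A`. -/
def liftF (F : Type) [Field F] {A : Type} [Ring A] [Algebra F A] {m : Type}
    (M : Matrix m m F) : Matrix m m A := M.map (algebraMap F A)

/-- Left hand side `R S₁ Rᵗ S₂` of the reflection equation. -/
def reflLHS (F : Type) [Field F] (q : F) {N : ℕ} {A : Type} [Ring A] [Algebra F A]
    (S : Matrix (Fin N) (Fin N) A) : Matrix (Fin N × Fin N) (Fin N × Fin N) A :=
  liftF F (Rc F q N) * amp1 S * liftF F (Rct F q N) * amp2 S

/-- Right hand side `S₂ Rᵗ S₁ R` of the reflection equation. -/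
def reflRHS (F : Type) [Field F] (q : F) {N : ℕ} {A : Type} [Ring A] [Algebra F A]
    (S : Matrix (Fin N) (Fin N) A) : Matrix (Fin N × Fin N) (Fin N × Fin N) A :=
  amp2 S * liftF F (Rct F q N) * amp1 S * liftF F (Rc F q N)

/-- The list of index pairs `(i,j)` in lexicographic order. -/
def lexPairs (N : ℕ) : List (Fin N × Fin N) :=
  (List.finRange N).flatMap fun i => (List.finRange N).map fun j => (i, j)

/-! The generic matrix of generators. -/

def Sfree (F : Type) [Field F] (N : ℕ) :
    Matrix (Fin N) (Fin N) (FreeAlgebra F (Fin N × Fin N)) :=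
  Matrix.of fun i j => FreeAlgebra.ι F (i, j)

/-- Defining relations: only the reflection equation. -/
inductive Rel0 (F : Type) [Field F] (q : F) (N : ℕ) :
    FreeAlgebra F (Fin N × Fin N) → FreeAlgebra F (Fin N × Fin N) → Prop
  | refl (p r : Fin N × Fin N) :
      Rel0 F q N (reflLHS F q (Sfree F N) p r) (reflRHS F q (Sfree F N) p r)

/-- The algebra with generators `s_ij` and the reflection equation as defining relations. -/
abbrev Alg0 (F : Type) [Field F] (q : F) (N : ℕ) := RingQuot (Rel0 F q N)

def s0 (F : Type) [Field F] (q : F) (N : ℕ) (i j : Fin N) : Alg0 F q N :=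
  RingQuot.mkAlgHom F (Rel0 F q N) (FreeAlgebra.ι F (i, j))

/-- Defining relations of the presented algebra `𝒮` of the orthogonal case. -/
inductive OSRel (F : Type) [Field F] (q : F) (N : ℕ) :
    FreeAlgebra F (Fin N × Fin N) → FreeAlgebra F (Fin N × Fin N) → Prop
  | tri (i j : Fin N) (h : i < j) : OSRel F q N (FreeAlgebra.ι F (i, j)) 0
  | diag (i : Fin N) : OSRel F q N (FreeAlgebra.ι F (i, i)) 1
  | refl (p r : Fin N × Fin N) :
      OSRel F q N (reflLHS F q (Sfree F N) p r) (reflRHS F q (Sfree F N) p r)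

abbrev AlgOS (F : Type) [Field F] (q : F) (N : ℕ) := RingQuot (OSRel F q N)

def sOS (F : Type) [Field F] (q : F) (N : ℕ) (i j : Fin N) : AlgOS F q N :=
  RingQuot.mkAlgHom F (OSRel F q N) (FreeAlgebra.ι F (i, j))

/-! The quantized enveloping algebra `U_q(gl_N)` by its RTT presentation. -/

abbrev GlGen (N : ℕ) := (Fin N × Fin N) ⊕ (Fin N × Fin N)

def Tfree (F : Type) [Field F] (N : ℕ) :
    Matrix (Fin N) (Fin N) (FreeAlgebra F (GlGen N)) :=
  Matrix.of fun i j => FreeAlgebra.ι F (Sum.inl (i, j))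

def Tbfree (F : Type) [Field F] (N : ℕ) :
    Matrix (Fin N) (Fin N) (FreeAlgebra F (GlGen N)) :=
  Matrix.of fun i j => FreeAlgebra.ι F (Sum.inr (i, j))

/-- `R X₁ Y₂` -/
def rttLHS (F : Type) [Field F] (q : F) {N : ℕ} {A : Type} [Ring A] [Algebra F A]
    (X Y : Matrix (Fin N) (Fin N) A) : Matrix (Fin N × Fin N) (Fin N × Fin N) A :=
  liftF F (Rc F q N) * amp1 X * amp2 Y

/-- `Y₂ X₁ R` -/
def rttRHS (F : Type) [Field F] (q : F) {N : ℕ} {A : Type} [Ring A] [Algebra F A]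
    (X Y : Matrix (Fin N) (Fin N) A) : Matrix (Fin N × Fin N) (Fin N × Fin N) A :=
  amp2 Y * amp1 X * liftF F (Rc F q N)

inductive GlRel (F : Type) [Field F] (q : F) (N : ℕ) :
    FreeAlgebra F (GlGen N) → FreeAlgebra F (GlGen N) → Prop
  | t_zero (i j : Fin N) (h : i < j) : GlRel F q N (Tfree F N i j) 0
  | tb_zero (i j : Fin N) (h : j < i) : GlRel F q N (Tbfree F N i j) 0
  | t_tb (i : Fin N) : GlRel F q N (Tfree F N i i * Tbfree F N i i) 1
  | tb_t (i : Fin N) : GlRel F q N (Tbfree F N i i * Tfree F N i i) 1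
  | rtt (p r : Fin N × Fin N) :
      GlRel F q N (rttLHS F q (Tfree F N) (Tfree F N) p r)
        (rttRHS F q (Tfree F N) (Tfree F N) p r)
  | rtbtb (p r : Fin N × Fin N) :
      GlRel F q N (rttLHS F q (Tbfree F N) (Tbfree F N) p r)
        (rttRHS F q (Tbfree F N) (Tbfree F N) p r)
  | rtbt (p r : Fin N × Fin N) :
      GlRel F q N (rttLHS F q (Tbfree F N) (Tfree F N) p r)
        (rttRHS F q (Tbfree F N) (Tfree F N) p r)

/-- The quantized enveloping algebra `U_q(gl_N)`. -/
abbrev UqGl (F : Type) [Field F] (q : F) (N : ℕ) := RingQuot (GlRel F q N)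

def tE (F : Type) [Field F] (q : F) (N : ℕ) (i j : Fin N) : UqGl F q N :=
  RingQuot.mkAlgHom F (GlRel F q N) (FreeAlgebra.ι F (Sum.inl (i, j)))

def tbE (F : Type) [Field F] (q : F) (N : ℕ) (i j : Fin N) : UqGl F q N :=
  RingQuot.mkAlgHom F (GlRel F q N) (FreeAlgebra.ι F (Sum.inr (i, j)))

/-- The entries `s_ij = Σ_a t_ia t̄_ja` of `S = T T̄ᵗ`. -/
def sE (F : Type) [Field F] (q : F) (N : ℕ) (i j : Fin N) : UqGl F q N :=
  ∑ a : Fin N, tE F q N i a * tbE F q N j a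

/-- The twisted quantized enveloping algebra `U^tw_q(o_N)` as a subalgebra of `U_q(gl_N)`. -/
def UtwO (F : Type) [Field F] (q : F) (N : ℕ) : Subalgebra F (UqGl F q N) :=
  Algebra.adjoin F {x | ∃ i j, x = sE F q N i j}

/-! Symplectic (finite) case. -/

/-- `2k` as an element of `Fin (2n)` (the 0-based version of the odd index `2k-1`). -/
def fe (n : ℕ) (k : Fin n) : Fin (2 * n) := ⟨2 * k.val, by have := k.isLt; omega⟩

/-- `2k+1` as an element of `Fin (2n)` (the 0-based version of the even index `2k`). -/
def fo (n : ℕ) (k : Fin n) : Fin (2 * n) := ⟨2 * k.val + 1, by have := k.isLt; omega⟩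

/-- The entries `s_ij` of `S = T G T̄ᵗ` in `U_q(gl_2n)`. -/
def sSp (F : Type) [Field F] (q : F) (n : ℕ) (i j : Fin (2 * n)) : UqGl F q (2 * n) :=
  algebraMap F _ q * ∑ a : Fin n, tE F q (2 * n) i (fe n a) * tbE F q (2 * n) j (fo n a)
    - ∑ a : Fin n, tE F q (2 * n) i (fo n a) * tbE F q (2 * n) j (fe n a)

abbrev SpGen (n : ℕ) := (Fin (2 * n) × Fin (2 * n)) ⊕ Fin n

def SpFreeS (F : Type) [Field F] (n : ℕ) :
    Matrix (Fin (2 * n)) (Fin (2 * n)) (FreeAlgebra F (SpGen n)) :=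
  Matrix.of fun i j => FreeAlgebra.ι F (Sum.inl (i, j))

/-- Defining relations of the presented algebra `𝒮` of the symplectic case. -/
inductive SpRel (F : Type) [Field F] (q : F) (n : ℕ) :
    FreeAlgebra F (SpGen n) → FreeAlgebra F (SpGen n) → Prop
  | tri (i j : Fin (2 * n)) (h : i < j) (h' : ¬(i.val % 2 = 0 ∧ j.val = i.val + 1)) :
      SpRel F q n (FreeAlgebra.ι F (Sum.inl (i, j))) 0
  | quad (k : Fin n) :
      SpRel F q n
        (FreeAlgebra.ι F (Sum.inl (fo n k, fo n k)) * FreeAlgebra.ι F (Sum.inl (fe n k, fe n k)))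
        (algebraMap F _ (q ^ 2) *
            (FreeAlgebra.ι F (Sum.inl (fo n k, fe n k)) *
              FreeAlgebra.ι F (Sum.inl (fe n k, fo n k)))
          + algebraMap F _ (q ^ 3))
  | invR (k : Fin n) :
      SpRel F q n
        (FreeAlgebra.ι F (Sum.inl (fe n k, fo n k)) * FreeAlgebra.ι F (Sum.inr k)) 1
  | invL (k : Fin n) :
      SpRel F q n
        (FreeAlgebra.ι F (Sum.inr k) * FreeAlgebra.ι F (Sum.inl (fe n k, fo n k))) 1
  | refl (p r : Fin (2 * n) × Fin (2 * n)) :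
      SpRel F q n (reflLHS F q (SpFreeS F n) p r) (reflRHS F q (SpFreeS F n) p r)

abbrev AlgSp (F : Type) [Field F] (q : F) (n : ℕ) := RingQuot (SpRel F q n)

def sSpP (F : Type) [Field F] (q : F) (n : ℕ) (i j : Fin (2 * n)) : AlgSp F q n :=
  RingQuot.mkAlgHom F (SpRel F q n) (FreeAlgebra.ι F (Sum.inl (i, j)))

def sInvP (F : Type) [Field F] (q : F) (n : ℕ) (k : Fin n) : AlgSp F q n :=
  RingQuot.mkAlgHom F (SpRel F q n) (FreeAlgebra.ι F (Sum.inr k))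

/-- row `i = 2k` of the symplectic ordered monomial: positions `(i,0),…,(i,2k)`. -/
def rowA (n : ℕ) (k : Fin n) : List (Fin (2 * n) × Fin (2 * n)) :=
  ((List.finRange (2 * n)).filter fun j => j.val ≤ 2 * k.val).map fun j => (fe n k, j)

/-- row `i' = 2k+1` of the symplectic ordered monomial: positions `(i',0),…,(i',2k-1)`. -/
def rowB (n : ℕ) (k : Fin n) : List (Fin (2 * n) × Fin (2 * n)) :=
  ((List.finRange (2 * n)).filter fun j => j.val + 2 ≤ 2 * k.val + 1).map fun j => (fo n k, j)

/-- The ordered monomials of the symplectic case, with an arbitrary integer exponent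
on each `s_{i i'}` and nonnegative exponents elsewhere. -/
def monomSp {A : Type} [Ring A] (n : ℕ) (s : Fin (2 * n) × Fin (2 * n) → A) (sI : Fin n → A)
    (kN : Fin (2 * n) × Fin (2 * n) → ℕ) (kZ : Fin n → ℤ) : A :=
  ((List.finRange n).map fun k =>
    ((rowA n k).map fun p => s p ^ kN p).prod *
      (if 0 ≤ kZ k then s (fe n k, fo n k) ^ (kZ k).toNat else sI k ^ (-(kZ k)).toNat) *
      s (fo n k, fo n k) ^ kN (fo n k, fo n k) *
      ((rowB n k).map fun p => s p ^ kN p).prod).prod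

/-! Affine (twisted q-Yangian) machinery.  Series are treated coefficientwise. -/

/-- `z1 S r` is the coefficient matrix (in the first copy) of a series indexed by
nonnegative integers, extended by zero to `ℤ`. -/
def z1 {A : Type} [Ring A] {N : ℕ} (S : ℕ → Matrix (Fin N) (Fin N) A) (r : ℤ) :
    Matrix (Fin N × Fin N) (Fin N × Fin N) A :=
  if 0 ≤ r then amp1 (S r.toNat) else 0

def z2 {A : Type} [Ring A] {N : ℕ} (S : ℕ → Matrix (Fin N) (Fin N) A) (r : ℤ) :
    Matrix (Fin N × Fin N) (Fin N × Fin N) A :=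
  if 0 ≤ r then amp2 (S r.toNat) else 0

/-- Coefficient of `u^a v^b` in `R(u,v) S₁(u) Rᵗ(u⁻¹,v) S₂(v)`,
using `R(u,v) = u R̃ - v R` and `Rᵗ(u⁻¹,v) = u⁻¹ R̃ᵗ - v Rᵗ`. -/
def affLHS (F : Type) [Field F] (q : F) {N : ℕ} {A : Type} [Ring A] [Algebra F A]
    (S : ℕ → Matrix (Fin N) (Fin N) A) (a b : ℤ) :
    Matrix (Fin N × Fin N) (Fin N × Fin N) A :=
  liftF F (Rtil F q N) * z1 S (-a) * liftF F (Rtilt F q N) * z2 S (-b)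
    - liftF F (Rtil F q N) * z1 S (1 - a) * liftF F (Rct F q N) * z2 S (1 - b)
    - liftF F (Rc F q N) * z1 S (-1 - a) * liftF F (Rtilt F q N) * z2 S (1 - b)
    + liftF F (Rc F q N) * z1 S (-a) * liftF F (Rct F q N) * z2 S (2 - b)

/-- Coefficient of `u^a v^b` in `S₂(v) Rᵗ(u⁻¹,v) S₁(u) R(u,v)`. -/
def affRHS (F : Type) [Field F] (q : F) {N : ℕ} {A : Type} [Ring A] [Algebra F A]
    (S : ℕ → Matrix (Fin N) (Fin N) A) (a b : ℤ) :
    Matrix (Fin N × Fin N) (Fin N × Fin N) A :=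
  z2 S (-b) * liftF F (Rtilt F q N) * z1 S (-a) * liftF F (Rtil F q N)
    - z2 S (1 - b) * liftF F (Rtilt F q N) * z1 S (-1 - a) * liftF F (Rc F q N)
    - z2 S (1 - b) * liftF F (Rct F q N) * z1 S (1 - a) * liftF F (Rtil F q N)
    + z2 S (2 - b) * liftF F (Rct F q N) * z1 S (-a) * liftF F (Rc F q N)

def SfreeA (F : Type) [Field F] (N : ℕ) (r : ℕ) :
    Matrix (Fin N) (Fin N) (FreeAlgebra F (ℕ × Fin N × Fin N)) :=
  Matrix.of fun i j => FreeAlgebra.ι F (r, i, j)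

/-- Defining relations: only the affine reflection equation (coefficientwise). -/
inductive Rel9 (F : Type) [Field F] (q : F) (N : ℕ) :
    FreeAlgebra F (ℕ × Fin N × Fin N) → FreeAlgebra F (ℕ × Fin N × Fin N) → Prop
  | refl (a b : ℤ) (p r : Fin N × Fin N) :
      Rel9 F q N (affLHS F q (SfreeA F N) a b p r) (affRHS F q (SfreeA F N) a b p r)

abbrev Alg9 (F : Type) [Field F] (q : F) (N : ℕ) := RingQuot (Rel9 F q N)

def s9 (F : Type) [Field F] (q : F) (N : ℕ) (r : ℕ) (i j : Fin N) : Alg9 F q N :=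
  RingQuot.mkAlgHom F (Rel9 F q N) (FreeAlgebra.ι F (r, i, j))

/-- Defining relations of the presented twisted q-Yangian (orthogonal case). -/
inductive AORel (F : Type) [Field F] (q : F) (N : ℕ) :
    FreeAlgebra F (ℕ × Fin N × Fin N) → FreeAlgebra F (ℕ × Fin N × Fin N) → Prop
  | tri (i j : Fin N) (h : i < j) : AORel F q N (FreeAlgebra.ι F (0, i, j)) 0
  | diag (i : Fin N) : AORel F q N (FreeAlgebra.ι F (0, i, i)) 1
  | refl (a b : ℤ) (p r : Fin N × Fin N) :
      AORel F q N (affLHS F q (SfreeA F N) a b p r) (affRHS F q (SfreeA F N) a b p r)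

abbrev AlgAO (F : Type) [Field F] (q : F) (N : ℕ) := RingQuot (AORel F q N)

def sAO (F : Type) [Field F] (q : F) (N : ℕ) (r : ℕ) (i j : Fin N) : AlgAO F q N :=
  RingQuot.mkAlgHom F (AORel F q N) (FreeAlgebra.ι F (r, i, j))

/-- Lexicographic (non-strict) comparison of triples. -/
def tripLe (x y : ℕ × ℕ × ℕ) : Prop :=
  x.1 < y.1 ∨ (x.1 = y.1 ∧ (x.2.1 < y.2.1 ∨ (x.2.1 = y.2.1 ∧ x.2.2 ≤ y.2.2)))

/-- A list of generator indices `(r,i,j)` is ordered if it is weakly increasing with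
respect to the lexicographic order on `(r,i,j)`. -/
def sortedGens {N : ℕ} (l : List (ℕ × Fin N × Fin N)) : Prop :=
  l.Chain' fun x y => tripLe (x.1, x.2.1.val, x.2.2.val) (y.1, y.2.1.val, y.2.2.val)

/-! The quantum affine algebra `U_q(ĝl_N)` by its RTT presentation, coefficientwise. -/

abbrev AffGen (N : ℕ) := (ℕ × Fin N × Fin N) ⊕ (ℕ × Fin N × Fin N)

def TfA (F : Type) [Field F] (N : ℕ) (r : ℕ) :
    Matrix (Fin N) (Fin N) (FreeAlgebra F (AffGen N)) :=
  Matrix.of fun i j => FreeAlgebra.ι F (Sum.inl (r, i, j))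

def TbfA (F : Type) [Field F] (N : ℕ) (r : ℕ) :
    Matrix (Fin N) (Fin N) (FreeAlgebra F (AffGen N)) :=
  Matrix.of fun i j => FreeAlgebra.ι F (Sum.inr (r, i, j))

/-- Coefficient of `u^a v^b` in `R(u,v) X₁ Y₂` with prescribed coefficient extractions. -/
def affRttL (F : Type) [Field F] (q : F) {N : ℕ} {A : Type} [Ring A] [Algebra F A]
    (X Y : ℕ → Matrix (Fin N) (Fin N) A) (a b a' b' : ℤ) :
    Matrix (Fin N × Fin N) (Fin N × Fin N) A :=
  liftF F (Rtil F q N) * z1 X a * z2 Y b - liftF F (Rc F q N) * z1 X a' * z2 Y b'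

def affRttR (F : Type) [Field F] (q : F) {N : ℕ} {A : Type} [Ring A] [Algebra F A]
    (X Y : ℕ → Matrix (Fin N) (Fin N) A) (a b a' b' : ℤ) :
    Matrix (Fin N × Fin N) (Fin N × Fin N) A :=
  z2 Y b * z1 X a * liftF F (Rtil F q N) - z2 Y b' * z1 X a' * liftF F (Rc F q N)

inductive AffGlRel (F : Type) [Field F] (q : F) (N : ℕ) :
    FreeAlgebra F (AffGen N) → FreeAlgebra F (AffGen N) → Prop
  | t0_tri (i j : Fin N) (h : i < j) : AffGlRel F q N (TfA F N 0 i j) 0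
  | tb0_tri (i j : Fin N) (h : j < i) : AffGlRel F q N (TbfA F N 0 i j) 0
  | t_tb (i : Fin N) : AffGlRel F q N (TfA F N 0 i i * TbfA F N 0 i i) 1
  | tb_t (i : Fin N) : AffGlRel F q N (TbfA F N 0 i i * TfA F N 0 i i) 1
  | rtt (a b : ℤ) (p r : Fin N × Fin N) :
      AffGlRel F q N
        (affRttL F q (TfA F N) (TfA F N) (1 - a) (-b) (-a) (1 - b) p r)
        (affRttR F q (TfA F N) (TfA F N) (1 - a) (-b) (-a) (1 - b) p r)
  | rtbtb (a b : ℤ) (p r : Fin N × Fin N) :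
      AffGlRel F q N
        (affRttL F q (TbfA F N) (TbfA F N) (a - 1) b a (b - 1) p r)
        (affRttR F q (TbfA F N) (TbfA F N) (a - 1) b a (b - 1) p r)
  | rtbt (a b : ℤ) (p r : Fin N × Fin N) :
      AffGlRel F q N
        (affRttL F q (TbfA F N) (TfA F N) (a - 1) (-b) a (1 - b) p r)
        (affRttR F q (TbfA F N) (TfA F N) (a - 1) (-b) a (1 - b) p r)

/-- The quantum affine algebra `U_q(ĝl_N)`. -/
abbrev UqAff (F : Type) [Field F] (q : F) (N : ℕ) := RingQuot (AffGlRel F q N)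

def tA (F : Type) [Field F] (q : F) (N : ℕ) (r : ℕ) (i j : Fin N) : UqAff F q N :=
  RingQuot.mkAlgHom F (AffGlRel F q N) (FreeAlgebra.ι F (Sum.inl (r, i, j)))

def tbA (F : Type) [Field F] (q : F) (N : ℕ) (r : ℕ) (i j : Fin N) : UqAff F q N :=
  RingQuot.mkAlgHom F (AffGlRel F q N) (FreeAlgebra.ι F (Sum.inr (r, i, j)))

/-- Coefficient of `u^{-r}` in `s_ij(u) = Σ_a t_ia(u) t̄_ja(u⁻¹)`. -/
def Scoef (F : Type) [Field F] (q : F) (N : ℕ) (r : ℕ) (i j : Fin N) : UqAff F q N :=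
  ∑ a : Fin N, ∑ p ∈ Finset.range (r + 1), tA F q N p i a * tbA F q N (r - p) j a

/-- The twisted q-Yangian `Y^tw_q(o_N)` as a subalgebra of `U_q(ĝl_N)`. -/
def YtwO (F : Type) [Field F] (q : F) (N : ℕ) : Subalgebra F (UqAff F q N) :=
  Algebra.adjoin F {x | ∃ r i j, x = Scoef F q N r i j}

/-- Coefficient of `u^{-r}` in `s_ij(u)`, the `(i,j)` entry of `S(u) = T(u) G T̄(u⁻¹)ᵗ`
in the symplectic case. -/
def ScoefSp (F : Type) [Field F] (q : F) (n : ℕ) (r : ℕ) (i j : Fin (2 * n)) :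
    UqAff F q (2 * n) :=
  ∑ a : Fin n, ∑ p ∈ Finset.range (r + 1),
    (algebraMap F _ q * (tA F q (2 * n) p i (fe n a) * tbA F q (2 * n) (r - p) j (fo n a))
      - tA F q (2 * n) p i (fo n a) * tbA F q (2 * n) (r - p) j (fe n a))

/-- The twisted q-Yangian `Y^tw_q(sp_2n)` as a subalgebra of `U_q(ĝl_2n)`,
with a prescribed family of inverses of `s^{(0)}_{ii'}`. -/
def YtwSp (F : Type) [Field F] (q : F) (n : ℕ) (inv : Fin n → UqAff F q (2 * n)) :
    Subalgebra F (UqAff F q (2 * n)) :=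
  Algebra.adjoin F ({x | ∃ r i j, x = ScoefSp F q n r i j} ∪ Set.range inv)

abbrev ASpGen (n : ℕ) := (ℕ × Fin (2 * n) × Fin (2 * n)) ⊕ Fin n

def SfreeASp (F : Type) [Field F] (n : ℕ) (r : ℕ) :
    Matrix (Fin (2 * n)) (Fin (2 * n)) (FreeAlgebra F (ASpGen n)) :=
  Matrix.of fun i j => FreeAlgebra.ι F (Sum.inl (r, i, j))

/-- Defining relations of the presented twisted q-Yangian (symplectic case). -/
inductive ASpRel (F : Type) [Field F] (q : F) (n : ℕ) :
    FreeAlgebra F (ASpGen n) → FreeAlgebra F (ASpGen n) → Prop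
  | tri (i j : Fin (2 * n)) (h : i < j) (h' : ¬(i.val % 2 = 0 ∧ j.val = i.val + 1)) :
      ASpRel F q n (FreeAlgebra.ι F (Sum.inl (0, i, j))) 0
  | quad (k : Fin n) :
      ASpRel F q n
        (FreeAlgebra.ι F (Sum.inl (0, fo n k, fo n k)) *
          FreeAlgebra.ι F (Sum.inl (0, fe n k, fe n k)))
        (algebraMap F _ (q ^ 2) *
            (FreeAlgebra.ι F (Sum.inl (0, fo n k, fe n k)) *
              FreeAlgebra.ι F (Sum.inl (0, fe n k, fo n k)))
          + algebraMap F _ (q ^ 3))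
  | invR (k : Fin n) :
      ASpRel F q n
        (FreeAlgebra.ι F (Sum.inl (0, fe n k, fo n k)) * FreeAlgebra.ι F (Sum.inr k)) 1
  | invL (k : Fin n) :
      ASpRel F q n
        (FreeAlgebra.ι F (Sum.inr k) * FreeAlgebra.ι F (Sum.inl (0, fe n k, fo n k))) 1
  | refl (a b : ℤ) (p r : Fin (2 * n) × Fin (2 * n)) :
      ASpRel F q n (affLHS F q (SfreeASp F n) a b p r) (affRHS F q (SfreeASp F n) a b p r)

abbrev AlgASp (F : Type) [Field F] (q : F) (n : ℕ) := RingQuot (ASpRel F q n)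

def sASp (F : Type) [Field F] (q : F) (n : ℕ) (r : ℕ) (i j : Fin (2 * n)) : AlgASp F q n :=
  RingQuot.mkAlgHom F (ASpRel F q n) (FreeAlgebra.ι F (Sum.inl (r, i, j)))

def sInvASp (F : Type) [Field F] (q : F) (n : ℕ) (k : Fin n) : AlgASp F q n :=
  RingQuot.mkAlgHom F (ASpRel F q n) (FreeAlgebra.ι F (Sum.inr k))

/-! q-antisymmetrizer and Sklyanin/quantum determinant machinery. -/

/-- The trigonometric R-matrix `R(u,v)`. -/
def Rtrig (F : Type) [Field F] (q : F) (N : ℕ) (u v : F) :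
    Matrix (Fin N × Fin N) (Fin N × Fin N) F := Matrix.of fun p r =>
  (if p = r then (if p.1 = p.2 then q⁻¹ * u - q * v else u - v) else 0)
  + (if p.1 = r.2 ∧ p.2 = r.1 ∧ p.1 ≠ p.2 then
      (q⁻¹ - q) * (if p.2 < p.1 then u else v) else 0)

/-- An operator on `ℂ^N ⊗ ℂ^N` acting in the `i`-th and `j`-th factors of `(ℂ^N)^{⊗ r}`. -/
def big2 (F : Type) [Field F] {N r : ℕ} (i j : Fin r)
    (M : Matrix (Fin N × Fin N) (Fin N × Fin N) F) :
    Matrix (Fin r → Fin N) (Fin r → Fin N) F :=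
  Matrix.of fun f g =>
    if ∀ k, k ≠ i → k ≠ j → f k = g k then M (f i, f j) (g i, g j) else 0

/-- The list of the pairs `(i,j)`, `i < j`, in lexicographic order. -/
def pairsLex (r : ℕ) : List (Fin r × Fin r) :=
  (List.finRange r).flatMap fun i =>
    ((List.finRange r).filter fun j => i < j).map fun j => (i, j)

/-- The number of inversions (the Coxeter length) of a permutation. -/
def invCount {r : ℕ} (σ : Equiv.Perm (Fin r)) : ℕ :=
  (Finset.univ.filter fun p : Fin r × Fin r => p.1 < p.2 ∧ σ p.2 < σ p.1).card

/-- The q-permutation operator `P^q` on `ℂ^N ⊗ ℂ^N`. -/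
def PqSmall (F : Type) [Field F] (q : F) (N : ℕ) :
    Matrix (Fin N × Fin N) (Fin N × Fin N) F := Matrix.of fun p r =>
  if r.1 = p.2 ∧ r.2 = p.1 then (if p.1 = p.2 then 1 else if p.2 < p.1 then q else q⁻¹)
  else 0

/-- The hypothesis that `Pq` is the extension of the q-permutation operators along
reduced decompositions: `P^q_{σ s_i} = P^q_σ P^q_{s_i}` whenever the length grows. -/
def PqExt (F : Type) [Field F] (q : F) (N r : ℕ)
    (Pq : Equiv.Perm (Fin r) → Matrix (Fin r → Fin N) (Fin r → Fin N) F) : Prop :=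
  Pq 1 = 1 ∧
    ∀ (σ : Equiv.Perm (Fin r)) (i : ℕ) (h : i + 1 < r),
      invCount (σ * Equiv.swap ⟨i, Nat.lt_of_succ_lt h⟩ ⟨i + 1, h⟩) = invCount σ + 1 →
        Pq (σ * Equiv.swap ⟨i, Nat.lt_of_succ_lt h⟩ ⟨i + 1, h⟩) =
          Pq σ * big2 F ⟨i, Nat.lt_of_succ_lt h⟩ ⟨i + 1, h⟩ (PqSmall F q N)

/-- The q-antisymmetrizer `A^q_r = Σ_σ sgn(σ) P^q_σ`. -/
def AqM (F : Type) [Field F] {N r : ℕ}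
    (Pq : Equiv.Perm (Fin r) → Matrix (Fin r → Fin N) (Fin r → Fin N) F) :
    Matrix (Fin r → Fin N) (Fin r → Fin N) F :=
  ∑ σ : Equiv.Perm (Fin r), ((Equiv.Perm.sign σ : ℤ) : F) • Pq σ

/-- A matrix acting in the `k`-th factor of `(ℂ^N)^{⊗ N}`, with entries in `A`. -/
def ampAt {A : Type} [Ring A] {N : ℕ} (k : Fin N) (M : Matrix (Fin N) (Fin N) A) :
    Matrix (Fin N → Fin N) (Fin N → Fin N) A :=
  Matrix.of fun f g => if ∀ l, l ≠ k → f l = g l then M (f k) (g k) else 0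

/-- A scalar two-site operator viewed over `A`, acting at sites `i`, `j`. -/
def big2A (F : Type) [Field F] {A : Type} [Ring A] [Algebra F A] {N : ℕ} (i j : Fin N)
    (M : Matrix (Fin N × Fin N) (Fin N × Fin N) F) :
    Matrix (Fin N → Fin N) (Fin N → Fin N) A :=
  (big2 F i j M).map (algebraMap F A)

/-- Coefficient of `u^m` in a product of formal series, each of which is supported in
degrees `≤ 1`; the series are given by their coefficient functions `ℤ → M`. -/
def seriesProdCoeff {M : Type} [Ring M] : List (ℤ → M) → ℤ → M
  | [], m => if m = 0 then 1 else 0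
  | c :: t, m => ∑ k ∈ Finset.Icc (m - t.length) 1, c k * seriesProdCoeff t (m - k)

/-! Series factors entering the Sklyanin determinant. -/

/-- The matrix `S^{(r)}` of the coefficients of `S(u)` (orthogonal case). -/
def SmatA (F : Type) [Field F] (q : F) (N : ℕ) (r : ℕ) :
    Matrix (Fin N) (Fin N) (UqAff F q N) :=
  Matrix.of fun i j => Scoef F q N r i j

/-- The series `S_k(q^{-2k+2} u)` acting at site `k` (0-based `k`), coefficientwise. -/
def SfacO (F : Type) [Field F] (q : F) (N : ℕ) (k : Fin N) (m : ℤ) :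
    Matrix (Fin N → Fin N) (Fin N → Fin N) (UqAff F q N) :=
  if m ≤ 0 then q ^ (2 * (k.val : ℤ) * (-m)) • ampAt k (SmatA F q N (-m).toNat) else 0

/-- The series `R_{ij}ᵗ((q^{-2i+2}u)⁻¹, q^{-2j+2}u)` (0-based `i`, `j`), coefficientwise. -/
def RtfacO (F : Type) [Field F] (q : F) (N : ℕ) (i j : Fin N) (m : ℤ) :
    Matrix (Fin N → Fin N) (Fin N → Fin N) (UqAff F q N) :=
  if m = -1 then q ^ (2 * (i.val : ℤ)) • big2A F i j (Rtilt F q N)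
  else if m = 1 then (-(q ^ (-2 * (j.val : ℤ)))) • big2A F i j (Rct F q N)
  else 0

/-- The ordered list of factors `S₁(u) R₁₂ᵗ ⋯ R₁Nᵗ S₂(q⁻²u) ⋯ S_N(q^{-2N+2}u)`. -/
def sdetFacsO (F : Type) [Field F] (q : F) (N : ℕ) :
    List (ℤ → Matrix (Fin N → Fin N) (Fin N → Fin N) (UqAff F q N)) :=
  (List.finRange N).flatMap fun i =>
    SfacO F q N i :: (((List.finRange N).filter fun j => i < j).map fun j => RtfacO F q N i j)

/-- The matrix `S^{(r)}` of the coefficients of `S(u)` (symplectic case). -/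
def SmatASp (F : Type) [Field F] (q : F) (n : ℕ) (r : ℕ) :
    Matrix (Fin (2 * n)) (Fin (2 * n)) (UqAff F q (2 * n)) :=
  Matrix.of fun i j => ScoefSp F q n r i j

def SfacSp (F : Type) [Field F] (q : F) (n : ℕ) (k : Fin (2 * n)) (m : ℤ) :
    Matrix (Fin (2 * n) → Fin (2 * n)) (Fin (2 * n) → Fin (2 * n)) (UqAff F q (2 * n)) :=
  if m ≤ 0 then q ^ (2 * (k.val : ℤ) * (-m)) • ampAt k (SmatASp F q n (-m).toNat) else 0

def sdetFacsSp (F : Type) [Field F] (q : F) (n : ℕ) :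
    List (ℤ → Matrix (Fin (2 * n) → Fin (2 * n)) (Fin (2 * n) → Fin (2 * n))
      (UqAff F q (2 * n))) :=
  (List.finRange (2 * n)).flatMap fun i =>
    SfacSp F q n i ::
      (((List.finRange (2 * n)).filter fun j => i < j).map fun j => RtfacO F q (2 * n) i j)

/-- Coefficientwise quantum determinant `qdet T(u)`:
the coefficient of `u^m` (nonzero only for `m ≤ 0`). -/
def qdetTc (F : Type) [Field F] (q : F) (N : ℕ) (m : ℤ) : UqAff F q N :=
  if m ≤ 0 then
    ∑ σ : Equiv.Perm (Fin N), ∑ rv ∈ Finset.Nat.antidiagonalTuple N (-m).toNat,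
      (((-q)⁻¹ ^ invCount σ) * ∏ k : Fin N, q ^ (2 * (k.val : ℤ) * (rv k : ℤ))) •
        ((List.finRange N).map fun k => tA F q N (rv k) (σ k) k).prod
  else 0

/-- Coefficientwise quantum determinant `qdet T̄(q^{2N-2} u⁻¹)`:
the coefficient of `u^m` (nonzero only for `m ≤ 0`). -/
def qdetTbc (F : Type) [Field F] (q : F) (N : ℕ) (m : ℤ) : UqAff F q N :=
  if m ≤ 0 then
    ∑ σ : Equiv.Perm (Fin N), ∑ rv ∈ Finset.Nat.antidiagonalTuple N (-m).toNat,
      (((-q)⁻¹ ^ invCount σ) *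
          ∏ k : Fin N, q ^ ((2 * (N : ℤ) - 2 - 2 * (k.val : ℤ)) * (rv k : ℤ))) •
        ((List.finRange N).map fun k => tbA F q N (rv k) (σ k) k).prod
  else 0

/-- The linear factor `q^{2i-2}u⁻¹ - q^{-2j+2}u` of `γ_N(u)` (0-based `i`, `j`),
viewed as an `A`-valued series. -/
def gamFac (F : Type) [Field F] (q : F) (N : ℕ) (p : Fin N × Fin N) (m : ℤ) : UqAff F q N :=
  if m = -1 then algebraMap F _ (q ^ (2 * (p.1.val : ℤ)))
  else if m = 1 then algebraMap F _ (-(q ^ (-2 * (p.2.val : ℤ)))) else 0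

/-- The list of series whose product is `γ_N(u) qdet T(u) qdet T̄(q^{2N-2}u⁻¹)`
in the orthogonal case. -/
def rhsO (F : Type) [Field F] (q : F) (N : ℕ) : List (ℤ → UqAff F q N) :=
  ((pairsLex N).map fun p => gamFac F q N p) ++ [qdetTc F q N, qdetTbc F q N]

section OrderedMonomials

variable {A S I : Type*} [CommRing A] [Ring S] [Algebra A S]

/-- The product of the values of `σ` along a chosen ordering of the multiset `m`. -/
def sortedMonomial (σ : I → S) (m : Multiset I) : S := (m.toList.map σ).prod

/-- The span of the words in the `σ i` of length `< d` and weight `≤ e`. -/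
def wordSpan (A : Type*) [CommRing A] [Algebra A S] (σ : I → S) (w : I → ℕ) (d e : ℕ) :
    Submodule A S :=
  Submodule.span A {x | ∃ l : List I, l.length < d ∧ (l.map w).sum ≤ e ∧ x = (l.map σ).prod}

variable {σ : I → S} {w : I → ℕ}

lemma prod_mem_wordSpan {d e : ℕ} {l : List I} (hd : l.length < d) (he : (l.map w).sum ≤ e) :
    (l.map σ).prod ∈ wordSpan A σ w d e :=
  Submodule.subset_span ⟨l, hd, he, rfl⟩

lemma wordSpan_mono {d d' e e' : ℕ} (hd : d ≤ d') (he : e ≤ e') :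
    wordSpan A σ w d e ≤ wordSpan A σ w d' e' := by
  apply Submodule.span_mono
  rintro x ⟨l, h1, h2, rfl⟩
  exact ⟨l, by omega, by omega, rfl⟩

lemma map_mulLeft_wordSpan_le (l : List I) {d e d' e' : ℕ} (hd : l.length + d ≤ d')
    (he : (l.map w).sum + e ≤ e') :
    (wordSpan A σ w d e).map (LinearMap.mulLeft A (l.map σ).prod) ≤ wordSpan A σ w d' e' := by
  rw [wordSpan, Submodule.map_span, Submodule.span_le]
  rintro _ ⟨_, ⟨l', h1, h2, rfl⟩, rfl⟩
  refine Submodule.subset_span ⟨l ++ l', ?_, ?_, by simp⟩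
  · simp only [List.length_append]; omega
  · simp only [List.map_append, List.sum_append]; omega

lemma map_mulRight_wordSpan_le (l : List I) {d e d' e' : ℕ} (hd : l.length + d ≤ d')
    (he : (l.map w).sum + e ≤ e') :
    (wordSpan A σ w d e).map (LinearMap.mulRight A (l.map σ).prod) ≤ wordSpan A σ w d' e' := by
  rw [wordSpan, Submodule.map_span, Submodule.span_le]
  rintro _ ⟨_, ⟨l', h1, h2, rfl⟩, rfl⟩
  refine Submodule.subset_span ⟨l' ++ l, ?_, ?_, by simp⟩
  · simp only [List.length_append]; omega
  · simp only [List.map_append, List.sum_append]; omega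

lemma wordSpan_fg (hw : ∀ n, {i | w i ≤ n}.Finite) (d e : ℕ) : (wordSpan A σ w d e).FG := by
  apply Submodule.fg_span
  have := (hw e).to_subtype
  refine ((List.finite_length_lt {i | w i ≤ e} d).image
    fun l => ((l.map Subtype.val).map σ).prod).subset ?_
  rintro x ⟨l, h1, h2, rfl⟩
  have hl : ∀ i ∈ l, w i ≤ e := fun i hi =>
    (List.single_le_sum (fun _ _ => Nat.zero_le _) _ (List.mem_map_of_mem hi)).trans h2
  refine ⟨l.attach.map fun i => ⟨i.1, hl _ i.2⟩, by simpa using h1, ?_⟩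
  simp

/-- The sum of the span of shorter words and of `𝔪` times the span of words of length `≤ n`. -/
def lowerSpan (𝔪 : Ideal A) (σ : I → S) (w : I → ℕ) (n e : ℕ) : Submodule A S :=
  wordSpan A σ w n e ⊔ 𝔪 • wordSpan A σ w (n + 1) e

lemma lowerSpan_mono {𝔪 : Ideal A} {n e e' : ℕ} (he : e ≤ e') :
    lowerSpan 𝔪 σ w n e ≤ lowerSpan 𝔪 σ w n e' :=
  sup_le_sup (wordSpan_mono le_rfl he) (Submodule.smul_mono le_rfl (wordSpan_mono le_rfl he))

lemma map_mulLeft_lowerSpan_le {𝔪 : Ideal A} (l : List I) {n e n' e' : ℕ}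
    (hd : l.length + n = n') (he : (l.map w).sum + e = e') {x : S}
    (hx : x ∈ lowerSpan 𝔪 σ w n e) : (l.map σ).prod * x ∈ lowerSpan 𝔪 σ w n' e' := by
  have : (lowerSpan 𝔪 σ w n e).map (LinearMap.mulLeft A (l.map σ).prod) ≤
      lowerSpan 𝔪 σ w n' e' := by
    rw [lowerSpan, Submodule.map_sup, Submodule.map_smul'']
    exact sup_le_sup (map_mulLeft_wordSpan_le l hd.le he.le)
      (Submodule.smul_mono le_rfl (map_mulLeft_wordSpan_le l (by omega) he.le))
  exact this ⟨x, hx, rfl⟩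

lemma map_mulRight_lowerSpan_le {𝔪 : Ideal A} (l : List I) {n e n' e' : ℕ}
    (hd : l.length + n = n') (he : (l.map w).sum + e = e') {x : S}
    (hx : x ∈ lowerSpan 𝔪 σ w n e) : x * (l.map σ).prod ∈ lowerSpan 𝔪 σ w n' e' := by
  have : (lowerSpan 𝔪 σ w n e).map (LinearMap.mulRight A (l.map σ).prod) ≤
      lowerSpan 𝔪 σ w n' e' := by
    rw [lowerSpan, Submodule.map_sup, Submodule.map_smul'']
    exact sup_le_sup (map_mulRight_wordSpan_le l hd.le he.le)
      (Submodule.smul_mono le_rfl (map_mulRight_wordSpan_le l (by omega) he.le))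
  exact this ⟨x, hx, rfl⟩

lemma prod_sub_prod_mem_lowerSpan {𝔪 : Ideal A}
    (hcomm : ∀ i j, σ i * σ j - σ j * σ i ∈ lowerSpan 𝔪 σ w 2 (w i + w j))
    {l l' : List I} (h : l.Perm l') :
    (l.map σ).prod - (l'.map σ).prod ∈ lowerSpan 𝔪 σ w l.length (l.map w).sum := by
  induction h with
  | nil => simp
  | cons x _ ih =>
    have := map_mulLeft_lowerSpan_le (𝔪 := 𝔪) [x] rfl rfl ih
    simpa [mul_sub, add_comm] using this
  | swap x y l =>
    have := map_mulRight_lowerSpan_le (𝔪 := 𝔪) l rfl rfl (hcomm y x)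
    simpa [sub_mul, mul_assoc, add_comm, add_assoc, add_left_comm] using this
  | trans h1 _ ih1 ih2 =>
    rw [← h1.length_eq, ← (h1.map w).sum_eq] at ih2
    simpa using add_mem ih1 ih2

lemma wordSpan_le_span_sortedMonomial [IsLocalRing A] (hw : ∀ n, {i | w i ≤ n}.Finite)
    (hcomm : ∀ i j, σ i * σ j - σ j * σ i ∈
      lowerSpan (IsLocalRing.maximalIdeal A) σ w 2 (w i + w j)) (d e : ℕ) :
    wordSpan A σ w d e ≤ Submodule.span A (Set.range (sortedMonomial σ)) := by
  induction d with
  | zero => exact Submodule.span_le.2 fun x ⟨l, h, _⟩ => absurd h (Nat.not_lt_zero _)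
  | succ d ih =>
    refine Submodule.le_of_le_smul_of_le_jacobson_bot (wordSpan_fg hw _ _)
      (IsLocalRing.maximalIdeal_le_jacobson _) (Submodule.span_le.2 ?_)
    rintro _ ⟨l, h1, h2, rfl⟩
    rcases Nat.lt_succ_iff_lt_or_eq.1 h1 with h1 | rfl
    · exact Submodule.mem_sup_left (ih (prod_mem_wordSpan h1 h2))
    · have hp : l.Perm (l : Multiset I).toList :=
        Multiset.coe_eq_coe.1 (Multiset.coe_toList _).symm
      have h3 := lowerSpan_mono h2 (prod_sub_prod_mem_lowerSpan hcomm hp)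
      have h4 : sortedMonomial σ (l : Multiset I) ∈
          Submodule.span A (Set.range (sortedMonomial σ)) :=
        Submodule.subset_span ⟨_, rfl⟩
      have h5 := sup_le_sup_right ih
        (IsLocalRing.maximalIdeal A • wordSpan A σ w (l.length + 1) e) h3
      rw [← sub_add_cancel (l.map σ).prod (sortedMonomial σ (l : Multiset I))]
      exact add_mem h5 (Submodule.mem_sup_left h4)

/-- In a flat deformation of an enveloping algebra the ordered monomials span. -/
theorem span_sortedMonomial_eq_top {F : Type*} [Field F] [Algebra A F] [Algebra F S]
    [IsScalarTower A F S] [IsLocalRing A] (hw : ∀ n, {i | w i ≤ n}.Finite)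
    (hcomm : ∀ i j, σ i * σ j - σ j * σ i ∈
      lowerSpan (IsLocalRing.maximalIdeal A) σ w 2 (w i + w j))
    (hgen : Algebra.adjoin F (Set.range σ) = ⊤) :
    Submodule.span F (Set.range (sortedMonomial σ)) = ⊤ := by
  rw [eq_top_iff, ← Algebra.top_toSubmodule, ← hgen, Algebra.adjoin_eq_span, Submodule.span_le]
  intro x hx
  obtain ⟨l, hl, rfl⟩ := Submonoid.exists_list_of_mem_closure hx
  obtain ⟨l, rfl⟩ : ∃ l' : List I, l'.map σ = l := by
    have : l ∈ Set.range (List.map σ) := by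
      rw [Set.range_list_map]; exact hl
    exact this
  have := wordSpan_le_span_sortedMonomial hw hcomm _ _
    (prod_mem_wordSpan (A := A) (Nat.lt_succ_self l.length) le_rfl)
  exact Submodule.span_le_restrictScalars A F _ this

end OrderedMonomials

/-- A linear map out of the span of ordered monomials is injective as soon as there are
functionals on the target which are triangular modulo the maximal ideal of a valuation. -/
theorem injective_of_triangular_functionals {F Γ S U I : Type*} [Field F]
    [LinearOrderedCommGroupWithZero Γ] (v : Valuation F Γ) [Ring S] [Algebra F S]
    [AddCommGroup U] [Module F U] (mon : Multiset I → S)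
    (hspan : Submodule.span F (Set.range mon) = ⊤) (g : S →ₗ[F] U)
    (L : Multiset I → U →ₗ[F] F)
    (hbd : ∀ m n, v (L m (g (mon n))) ≤ 1)
    (hlow : ∀ m n, n.card ≤ m.card → n ≠ m → v (L m (g (mon n))) < 1)
    (hself : ∀ m, v (L m (g (mon m))) = 1) : Function.Injective g := by
  classical
  rw [injective_iff_map_eq_zero]
  intro x hx
  have hx' : x ∈ Submodule.span F (Set.range mon) := hspan ▸ Submodule.mem_top
  obtain ⟨c, rfl⟩ := (Finsupp.mem_span_range_iff_exists_finsupp).1 hx'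
  by_contra hne
  have hc : c.support.Nonempty := by
    rw [Finsupp.support_nonempty_iff]; rintro rfl; simp at hne
  obtain ⟨m₁, hm₁, hmax₁⟩ := c.support.exists_max_image (fun m => v (c m)) hc
  obtain ⟨m, hm, hmax⟩ := (c.support.filter fun m => v (c m) = v (c m₁)).exists_max_image
    Multiset.card ⟨m₁, by simpa using hm₁⟩
  rw [Finset.mem_filter] at hm
  have hpos : v (c m) ≠ 0 := by simpa using hm.1
  have hrest : v (∑ n ∈ c.support.erase m, c n * L m (g (mon n))) < v (c m) := by
    refine Valuation.map_sum_lt _ hpos fun n hn => ?_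
    rw [Finset.mem_erase] at hn
    rw [map_mul]
    rcases (hmax₁ n hn.2).lt_or_eq with h | h
    · exact (mul_le_of_le_one_right' (hbd m n)).trans_lt (hm.2 ▸ h)
    · have h1 := hlow m n (hmax n (Finset.mem_filter.2 ⟨hn.2, h⟩)) hn.1
      rw [h.trans hm.2.symm]
      exact mul_lt_of_lt_one_right (zero_lt_iff.2 hpos) h1
  have htot : L m (g (c.sum fun i a => a • mon i)) =
      c m * L m (g (mon m)) + ∑ n ∈ c.support.erase m, c n * L m (g (mon n)) := by
    rw [Finset.add_sum_erase _ (fun n => c n * L m (g (mon n))) hm.1, Finsupp.sum]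
    simp [map_sum]
  have h0 : v (L m (g (c.sum fun i a => a • mon i))) = v (c m) := by
    rw [htot, Valuation.map_add_eq_of_lt_left]
    · rw [map_mul, hself, mul_one]
    · rwa [map_mul, hself, mul_one]
  rw [hx, map_zero, map_zero] at h0
  exact hpos h0.symm

section Amplification

variable {C : Type} [Ring C] {N : ℕ}

lemma amp1_mul (X Y : Matrix (Fin N) (Fin N) C) : amp1 (X * Y) = amp1 X * amp1 Y := by
  ext ⟨i, j⟩ ⟨a, b⟩
  simp only [amp1, Matrix.mul_apply, Matrix.of_apply, Fintype.sum_prod_type]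
  by_cases h : j = b <;> simp [h]

lemma amp2_mul (X Y : Matrix (Fin N) (Fin N) C) : amp2 (X * Y) = amp2 X * amp2 Y := by
  ext ⟨i, j⟩ ⟨a, b⟩
  simp only [amp2, Matrix.mul_apply, Matrix.of_apply, Fintype.sum_prod_type]
  by_cases h : i = a <;> simp [h]

@[simp] lemma amp1_zero : amp1 (0 : Matrix (Fin N) (Fin N) C) = 0 := by
  ext ⟨i, j⟩ ⟨a, b⟩; simp [amp1]

@[simp] lemma amp2_zero : amp2 (0 : Matrix (Fin N) (Fin N) C) = 0 := by
  ext ⟨i, j⟩ ⟨a, b⟩; simp [amp2]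

@[simp] lemma amp1_one : amp1 (1 : Matrix (Fin N) (Fin N) C) = 1 := by
  ext ⟨i, j⟩ ⟨a, b⟩; simp only [amp1, Matrix.of_apply, Matrix.one_apply, Prod.mk.injEq]
  by_cases h : j = b <;> simp [h]

@[simp] lemma amp2_one : amp2 (1 : Matrix (Fin N) (Fin N) C) = 1 := by
  ext ⟨i, j⟩ ⟨a, b⟩; simp only [amp2, Matrix.of_apply, Matrix.one_apply, Prod.mk.injEq]
  by_cases h : i = a <;> simp [h]

lemma amp1_add (X Y : Matrix (Fin N) (Fin N) C) : amp1 (X + Y) = amp1 X + amp1 Y := by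
  ext ⟨i, j⟩ ⟨a, b⟩
  by_cases h : j = b <;> simp [amp1, h]

lemma amp2_add (X Y : Matrix (Fin N) (Fin N) C) : amp2 (X + Y) = amp2 X + amp2 Y := by
  ext ⟨i, j⟩ ⟨a, b⟩
  by_cases h : i = a <;> simp [amp2, h]

lemma amp1_smul {Z : Type} [CommRing Z] [Algebra Z C] (c : Z) (X : Matrix (Fin N) (Fin N) C) :
    amp1 (c • X) = c • amp1 X := by
  ext ⟨i, j⟩ ⟨a, b⟩
  by_cases h : j = b <;> simp [amp1, h]

lemma amp2_smul {Z : Type} [CommRing Z] [Algebra Z C] (c : Z) (X : Matrix (Fin N) (Fin N) C) :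
    amp2 (c • X) = c • amp2 X := by
  ext ⟨i, j⟩ ⟨a, b⟩
  by_cases h : i = a <;> simp [amp2, h]

lemma amp1_mul_amp2_apply (X Y : Matrix (Fin N) (Fin N) C) (p r : Fin N × Fin N) :
    (amp1 X * amp2 Y) p r = X p.1 r.1 * Y p.2 r.2 := by
  simp [amp1, amp2, Matrix.mul_apply, Fintype.sum_prod_type]

lemma amp2_mul_amp1_apply (X Y : Matrix (Fin N) (Fin N) C) (p r : Fin N × Fin N) :
    (amp2 Y * amp1 X) p r = Y p.2 r.2 * X p.1 r.1 := by
  simp [amp1, amp2, Matrix.mul_apply, Fintype.sum_prod_type]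

lemma commute_amp1_amp2 {X Y : Matrix (Fin N) (Fin N) C}
    (h : ∀ i j k l, Commute (X i j) (Y k l)) : Commute (amp1 X) (amp2 Y) := by
  ext p r
  rw [amp1_mul_amp2_apply, amp2_mul_amp1_apply, (h _ _ _ _).eq]

lemma mul_amp1_mul_amp2_apply (M : Matrix (Fin N × Fin N) (Fin N × Fin N) C)
    (X Y : Matrix (Fin N) (Fin N) C) (p r : Fin N × Fin N) :
    (M * amp1 X * amp2 Y) p r = ∑ s : Fin N × Fin N, M p s * (X s.1 r.1 * Y s.2 r.2) := by
  rw [mul_assoc, Matrix.mul_apply]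
  simp only [amp1_mul_amp2_apply]

lemma amp2_mul_amp1_mul_apply (M : Matrix (Fin N × Fin N) (Fin N × Fin N) C)
    (X Y : Matrix (Fin N) (Fin N) C) (p r : Fin N × Fin N) :
    (amp2 Y * amp1 X * M) p r = ∑ s : Fin N × Fin N, Y p.2 s.2 * X p.1 s.1 * M s r := by
  rw [Matrix.mul_apply]
  simp only [amp2_mul_amp1_apply]

lemma amp1_mul_mul_amp2_apply (M : Matrix (Fin N × Fin N) (Fin N × Fin N) C)
    (X Y : Matrix (Fin N) (Fin N) C) (p r : Fin N × Fin N) :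
    (amp1 X * M * amp2 Y) p r =
      ∑ s : Fin N × Fin N, X p.1 s.1 * M (s.1, p.2) (r.1, s.2) * Y s.2 r.2 := by
  simp [amp1, amp2, Matrix.mul_apply, Fintype.sum_prod_type, Finset.sum_mul]
  rw [Finset.sum_comm]

lemma amp2_mul_mul_amp1_apply (M : Matrix (Fin N × Fin N) (Fin N × Fin N) C)
    (X Y : Matrix (Fin N) (Fin N) C) (p r : Fin N × Fin N) :
    (amp2 Y * M * amp1 X) p r =
      ∑ s : Fin N × Fin N, Y p.2 s.2 * M (p.1, s.2) (s.1, r.2) * X s.1 r.1 := by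
  simp [amp1, amp2, Matrix.mul_apply, Fintype.sum_prod_type, Finset.sum_mul]

/-- Partial transposition in the first tensor factor. -/
def partialTranspose (M : Matrix (Fin N × Fin N) (Fin N × Fin N) C) :
    Matrix (Fin N × Fin N) (Fin N × Fin N) C :=
  Matrix.of fun p r => M (r.1, p.2) (p.1, r.2)

/-- Invariance under transposing both factors and swapping them. -/
def IsFlipSymm (M : Matrix (Fin N × Fin N) (Fin N × Fin N) C) : Prop :=
  ∀ p r, M p r = M r.swap p.swap

variable {Z : Type} [CommRing Z] [Algebra Z C]

lemma rtt_mul {M X₁ Y₁ X₂ Y₂ : Matrix (Fin N × Fin N) (Fin N × Fin N) C}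
    (hX : M * X₁ * X₂ = X₂ * X₁ * M) (hY : M * Y₁ * Y₂ = Y₂ * Y₁ * M)
    (h₁ : Commute Y₁ X₂) (h₂ : Commute X₁ Y₂) :
    M * (X₁ * Y₁) * (X₂ * Y₂) = X₂ * Y₂ * (X₁ * Y₁) * M := by
  calc M * (X₁ * Y₁) * (X₂ * Y₂) = M * X₁ * (Y₁ * X₂) * Y₂ := by noncomm_ring
    _ = M * X₁ * X₂ * Y₁ * Y₂ := by rw [h₁.eq]; noncomm_ring
    _ = X₂ * X₁ * (M * Y₁ * Y₂) := by rw [hX]; noncomm_ring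
    _ = X₂ * (X₁ * Y₂) * Y₁ * M := by rw [hY]; noncomm_ring
    _ = X₂ * Y₂ * (X₁ * Y₁) * M := by rw [h₂.eq]; noncomm_ring

lemma rtt_transpose {M : Matrix (Fin N × Fin N) (Fin N × Fin N) Z} (hM : IsFlipSymm M)
    {V U : Matrix (Fin N) (Fin N) C}
    (h : M.map (algebraMap Z C) * amp1 V * amp2 U = amp2 U * amp1 V * M.map (algebraMap Z C)) :
    M.map (algebraMap Z C) * amp1 U.transpose * amp2 V.transpose =
      amp2 V.transpose * amp1 U.transpose * M.map (algebraMap Z C) := by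
  ext p r
  have h1 := congrFun (congrFun h r.swap) p.swap
  rw [mul_amp1_mul_amp2_apply, amp2_mul_amp1_mul_apply] at h1 ⊢
  rw [← (Equiv.prodComm _ _).sum_comp, ← (Equiv.prodComm _ _).sum_comp
    (fun s => _ * _ * M.map (algebraMap Z C) s p.swap)] at h1
  simp only [Matrix.map_apply, Equiv.prodComm_apply, Matrix.transpose_apply, Prod.fst_swap,
    Prod.snd_swap] at h1 ⊢
  simp only [hM p, hM _ r]
  simp only [Algebra.commutes (M _ _) (_ * _)] at h1 ⊢
  exact h1.symm

lemma rtt_partialTranspose {M : Matrix (Fin N × Fin N) (Fin N × Fin N) Z}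
    {U T : Matrix (Fin N) (Fin N) C}
    (h : M.map (algebraMap Z C) * amp1 U * amp2 T = amp2 T * amp1 U * M.map (algebraMap Z C)) :
    amp1 U.transpose * (partialTranspose M).map (algebraMap Z C) * amp2 T =
      amp2 T * (partialTranspose M).map (algebraMap Z C) * amp1 U.transpose := by
  ext p r
  have h1 := congrFun (congrFun h (r.1, p.2)) (p.1, r.2)
  rw [mul_amp1_mul_amp2_apply, amp2_mul_amp1_mul_apply] at h1
  rw [amp1_mul_mul_amp2_apply, amp2_mul_mul_amp1_apply]
  simp only [Matrix.map_apply, Matrix.transpose_apply, partialTranspose, Matrix.of_apply] at h1 ⊢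
  simp only [← Algebra.commutes (M _ _), mul_assoc] at h1 ⊢
  exact h1

lemma rtt_partialTranspose_snd {M : Matrix (Fin N × Fin N) (Fin N × Fin N) Z} (hM : IsFlipSymm M)
    {U T : Matrix (Fin N) (Fin N) C}
    (h : M.map (algebraMap Z C) * amp1 U * amp2 T = amp2 T * amp1 U * M.map (algebraMap Z C)) :
    amp1 T * (partialTranspose M).map (algebraMap Z C) * amp2 U.transpose =
      amp2 U.transpose * (partialTranspose M).map (algebraMap Z C) * amp1 T := by
  ext p r
  have h1 := congrFun (congrFun h (r.2, p.1)) (p.2, r.1)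
  rw [mul_amp1_mul_amp2_apply, amp2_mul_amp1_mul_apply] at h1
  rw [amp1_mul_mul_amp2_apply, amp2_mul_mul_amp1_apply]
  rw [← (Equiv.prodComm _ _).sum_comp, ← (Equiv.prodComm _ _).sum_comp
    (fun s => _ * _ * M.map (algebraMap Z C) s (p.2, r.1))] at h1
  simp only [Matrix.map_apply, Matrix.transpose_apply, partialTranspose, Matrix.of_apply,
    Equiv.prodComm_apply, Prod.fst_swap, Prod.snd_swap] at h1 ⊢
  simp only [hM (r.2, p.1), hM _ (p.2, r.1), Prod.swap_swap, Prod.swap_prod_mk] at h1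
  simp only [← Algebra.commutes (M _ _), mul_assoc] at h1 ⊢
  exact h1.symm

/-- `S = T T̄ᵗ` satisfies the reflection equation if `T`, `T̄` satisfy the `RTT` relations. -/
theorem reflection_of_rtt {M Q : Matrix (Fin N × Fin N) (Fin N × Fin N) Z}
    (hM : IsFlipSymm M) (hQ : IsFlipSymm Q) (hMQ : Commute M (partialTranspose Q))
    {T T' U U' : Matrix (Fin N) (Fin N) C}
    (hT : M.map (algebraMap Z C) * amp1 T * amp2 T' = amp2 T' * amp1 T * M.map (algebraMap Z C))
    (hU : M.map (algebraMap Z C) * amp1 U' * amp2 U = amp2 U * amp1 U' * M.map (algebraMap Z C))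
    (hUT' : Q.map (algebraMap Z C) * amp1 U * amp2 T' =
      amp2 T' * amp1 U * Q.map (algebraMap Z C))
    (hU'T : Q.map (algebraMap Z C) * amp1 U' * amp2 T =
      amp2 T * amp1 U' * Q.map (algebraMap Z C)) :
    M.map (algebraMap Z C) * amp1 (T * U.transpose) * (partialTranspose Q).map (algebraMap Z C) *
        amp2 (T' * U'.transpose) =
      amp2 (T' * U'.transpose) * (partialTranspose Q).map (algebraMap Z C) *
        amp1 (T * U.transpose) * M.map (algebraMap Z C) := by
  have h1 := rtt_transpose hM hU
  have h2 := rtt_partialTranspose hUT'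
  have h3 := rtt_partialTranspose_snd hQ hU'T
  have h4 : M.map (algebraMap Z C) * (partialTranspose Q).map (algebraMap Z C) =
      (partialTranspose Q).map (algebraMap Z C) * M.map (algebraMap Z C) := by
    rw [← Matrix.map_mul, hMQ.eq, Matrix.map_mul]
  rw [amp1_mul, amp2_mul]
  set m := M.map (algebraMap Z C)
  set Qt := (partialTranspose Q).map (algebraMap Z C)
  set t := amp1 T
  set t' := amp2 T'
  set u := amp1 U.transpose
  set u' := amp2 U'.transpose
  calc m * (t * u) * Qt * (t' * u') = m * t * (u * Qt * t') * u' := by noncomm_ring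
    _ = (m * t * t') * Qt * u * u' := by rw [h2]; noncomm_ring
    _ = t' * t * (m * Qt) * u * u' := by rw [hT]; noncomm_ring
    _ = t' * t * Qt * (m * u * u') := by rw [h4]; noncomm_ring
    _ = t' * (t * Qt * u') * u * m := by rw [h1]; noncomm_ring
    _ = t' * u' * Qt * (t * u) * m := by rw [h3]; noncomm_ring

end Amplification

section FirstOrder

variable {N : ℕ}

lemma mul_comm_of_scalar_blocks {A : Type} [CommRing A]
    {M₁ M₂ : Matrix (Fin N × Fin N) (Fin N × Fin N) A} {c d : A}
    (h₁ : ∀ p r, p.1 = p.2 ∨ r.1 = r.2 → M₁ p r = if p = r then c else 0)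
    (h₂ : ∀ p r, p.1 ≠ p.2 ∨ r.1 ≠ r.2 → M₂ p r = if p = r then d else 0) :
    Commute M₁ M₂ := by
  ext p r
  rw [Matrix.mul_apply, Matrix.mul_apply]
  by_cases hp : p.1 = p.2 <;> by_cases hr : r.1 = r.2
  · simp only [h₁ p _ (Or.inl hp), h₁ _ r (Or.inr hr)]
    simp [mul_comm]
  · have hpr : p ≠ r := fun h => hr (h ▸ hp)
    simp only [h₁ p _ (Or.inl hp), h₂ _ r (Or.inr hr)]
    rw [Finset.sum_eq_zero, Finset.sum_eq_zero]
    · intro s _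
      by_cases hs : s.1 = s.2
      · have : s ≠ r := fun h => hr (h ▸ hs)
        rw [h₁ s r (Or.inl hs)]; simp [this]
      · have : p ≠ s := fun h => hs (h ▸ hp)
        rw [h₂ p s (Or.inr hs)]; simp [this]
    · intro s _
      by_cases hs : p = s
      · subst hs; simp [hpr]
      · simp [hs]
  · have hpr : p ≠ r := fun h => hp (h ▸ hr)
    simp only [h₁ _ r (Or.inr hr), h₂ p _ (Or.inl hp)]
    rw [Finset.sum_eq_zero, Finset.sum_eq_zero]
    · intro s _
      by_cases hs : p = s
      · subst hs; simp [hpr]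
      · simp [hs]
    · intro s _
      by_cases hs : s.1 = s.2
      · have : p ≠ s := fun h => hp (h ▸ hs)
        rw [h₁ p s (Or.inr hs)]; simp [this]
      · have : s ≠ r := fun h => hs (h ▸ hr)
        rw [h₂ s r (Or.inl hs)]; simp [this]
  · simp only [h₂ p _ (Or.inl hp), h₂ _ r (Or.inr hr)]
    simp [mul_comm]

/-- The first order part of `Rc` and `Rtil` in `q - q⁻¹`. -/
def firstOrder {A : Type} [CommRing A] (N : ℕ) (κ θ : A) (P : Fin N → Fin N → Prop)
    [∀ i j, Decidable (P i j)] : Matrix (Fin N × Fin N) (Fin N × Fin N) A :=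
  Matrix.of fun p r => (if p = r then (if p.1 = p.2 then κ else 0) else 0)
    + (if p.1 = r.2 ∧ p.2 = r.1 ∧ P p.1 p.2 then θ else 0)

lemma commute_firstOrder_partialTranspose {A : Type} [CommRing A] {κ θ κ' θ' : A}
    {P P' : Fin N → Fin N → Prop} [∀ i j, Decidable (P i j)] [∀ i j, Decidable (P' i j)]
    (hP : ∀ i, ¬ P i i) (hP' : ∀ i, ¬ P' i i) :
    Commute (firstOrder N κ θ P) (partialTranspose (firstOrder N κ' θ' P')) := by
  refine mul_comm_of_scalar_blocks (c := κ) (d := 0) ?_ ?_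
  · rintro ⟨i, j⟩ ⟨a, b⟩ h
    simp only [firstOrder, Matrix.of_apply, Prod.mk.injEq] at h ⊢
    rcases h with rfl | rfl
    · have := hP i; split_ifs <;> grind
    · have := hP a; split_ifs <;> grind
  · rintro ⟨i, j⟩ ⟨a, b⟩ h
    simp only [firstOrder, partialTranspose, Matrix.of_apply, Prod.mk.injEq, ne_eq] at h ⊢
    have h1 := hP' a
    have h2 := hP' j
    split_ifs <;> grind

lemma liftF_partialTranspose {A F S : Type} [CommRing A] [Field F] [Ring S] [Algebra A S]
    [Algebra F S] {m : Matrix (Fin N × Fin N) (Fin N × Fin N) A}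
    {M : Matrix (Fin N × Fin N) (Fin N × Fin N) F} {h : A}
    (hM : liftF F M = (1 + h • m.map (algebraMap A S) : Matrix _ _ S)) :
    liftF F (partialTranspose M) =
      (1 + h • (partialTranspose m).map (algebraMap A S) : Matrix _ _ S) := by
  ext p r
  have := congrFun (congrFun hM (r.1, p.2)) (p.1, r.2)
  simp only [liftF, Matrix.map_apply, Matrix.add_apply, Matrix.smul_apply, partialTranspose,
    Matrix.of_apply, Matrix.one_apply] at this ⊢
  rw [this]
  congr 1
  simp [Prod.ext_iff, eq_comm]

variable {A F S : Type} [CommRing A] [Field F] [Ring S] [Algebra A F] [Algebra A S] [Algebra F S]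
  [IsScalarTower A F S]

lemma liftF_Rc_eq {q : F} {h κ : A} (hκ : algebraMap A F (h * κ) = q - 1)
    (hh : algebraMap A F h = q - q⁻¹) :
    liftF F (Rc F q N) =
      (1 + h • (firstOrder N κ 1 (· < ·)).map (algebraMap A S) : Matrix _ _ S) := by
  ext p r
  simp only [liftF, Matrix.map_apply, Matrix.add_apply, Matrix.smul_apply, Rc, firstOrder,
    Matrix.of_apply, Matrix.one_apply]
  rw [← map_one (algebraMap A S), Algebra.smul_def, ← map_mul, ← map_zero (algebraMap A S),
    ← apply_ite, ← map_add, IsScalarTower.algebraMap_apply A F S]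
  congr 1
  rw [mul_add, map_add, map_add]
  simp only [mul_ite, mul_zero, mul_one, apply_ite (algebraMap A F), map_zero, map_one, hκ, hh]
  split_ifs <;> ring

lemma liftF_Rtil_eq {q : F} {h κ : A} (hκ : algebraMap A F (h * κ) = q⁻¹ - 1)
    (hh : algebraMap A F h = q - q⁻¹) :
    liftF F (Rtil F q N) =
      (1 + h • (firstOrder N κ (-1) (fun i j => j < i)).map (algebraMap A S) : Matrix _ _ S) := by
  ext p r
  simp only [liftF, Matrix.map_apply, Matrix.add_apply, Matrix.smul_apply, Rtil, firstOrder,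
    Matrix.of_apply, Matrix.one_apply]
  rw [← map_one (algebraMap A S), Algebra.smul_def, ← map_mul, ← map_zero (algebraMap A S),
    ← apply_ite, ← map_add, IsScalarTower.algebraMap_apply A F S]
  congr 1
  rw [mul_add, map_add, map_add]
  simp only [mul_ite, mul_zero, mul_neg, mul_one, apply_ite (algebraMap A F), map_zero, map_one,
    map_neg, hκ, hh]
  split_ifs <;> ring

lemma reflection_expand {A C : Type} [CommRing A] [Ring C] [Algebra A C] {h ε ε' : A}
    {m₁ m₂ x y : C}
    (hm : Commute m₁ m₂) :
    (1 + h • m₁) * (ε • 1 + h • x) * (1 + h • m₂) * (ε' • 1 + h • y) -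
      (ε' • 1 + h • y) * (1 + h • m₂) * (ε • 1 + h • x) * (1 + h • m₁) =
    (h * h) • ((x * y - y * x) +
      (ε' • (m₁ * x + x * m₂ - m₂ * x - x * m₁) + ε • ((m₁ + m₂) * y - y * (m₁ + m₂))) +
      h • (ε' • (m₁ * x * m₂ - m₂ * x * m₁) + ε • (m₁ * m₂ * y - y * (m₁ * m₂)) +
        (m₁ * x * y + x * m₂ * y - y * m₂ * x - y * x * m₁)) +
      (h * h) • (m₁ * x * m₂ * y - y * m₂ * x * m₁)) := by
  have hm' : m₂ * m₁ = m₁ * m₂ := hm.eq.symm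
  have h1 : y * m₂ * m₁ = y * m₁ * m₂ := by rw [mul_assoc, hm', mul_assoc]
  simp only [mul_add, add_mul, smul_mul_assoc, mul_smul_comm, mul_one, one_mul, smul_add,
    ← mul_assoc, hm', h1, sub_eq_add_neg, neg_add]
  module


/-- Matrices with all entries in a given submodule. -/
def matrixIn {m : Type} (L : Submodule A S) : Submodule A (Matrix m m S) where
  carrier := {M | ∀ p r, M p r ∈ L}
  add_mem' h h' p r := L.add_mem (h p r) (h' p r)
  zero_mem' _ _ := L.zero_mem
  smul_mem' c _ h p r := L.smul_mem c (h p r)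

lemma map_mul_mem_matrixIn {m : Type} [Fintype m] {L : Submodule A S} (M : Matrix m m A)
    {X : Matrix m m S} (hX : X ∈ matrixIn L) : M.map (algebraMap A S) * X ∈ matrixIn L := by
  intro p r
  rw [Matrix.mul_apply]
  refine Submodule.sum_mem _ fun s _ => ?_
  rw [Matrix.map_apply, ← Algebra.smul_def]
  exact L.smul_mem _ (hX _ _)

lemma mul_map_mem_matrixIn {m : Type} [Fintype m] {L : Submodule A S} (M : Matrix m m A)
    {X : Matrix m m S} (hX : X ∈ matrixIn L) : X * M.map (algebraMap A S) ∈ matrixIn L := by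
  intro p r
  rw [Matrix.mul_apply]
  refine Submodule.sum_mem _ fun s _ => ?_
  rw [Matrix.map_apply, ← Algebra.commutes, ← Algebra.smul_def]
  exact L.smul_mem _ (hX _ _)

lemma mul_mem_matrixIn {m : Type} [Fintype m] {L L' L'' : Submodule A S}
    (h : ∀ x ∈ L, ∀ y ∈ L', x * y ∈ L'') {X Y : Matrix m m S} (hX : X ∈ matrixIn L)
    (hY : Y ∈ matrixIn L') : X * Y ∈ matrixIn L'' := by
  intro p r
  rw [Matrix.mul_apply]
  exact Submodule.sum_mem _ fun s _ => h _ (hX _ _) _ (hY _ _)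

lemma amp1_mem_matrixIn {L : Submodule A S} {X : Matrix (Fin N) (Fin N) S}
    (hX : X ∈ matrixIn L) : amp1 X ∈ matrixIn L := by
  intro p r
  rw [amp1, Matrix.of_apply]
  split_ifs
  exacts [hX _ _, L.zero_mem]

lemma amp2_mem_matrixIn {L : Submodule A S} {X : Matrix (Fin N) (Fin N) S}
    (hX : X ∈ matrixIn L) : amp2 X ∈ matrixIn L := by
  intro p r
  rw [amp2, Matrix.of_apply]
  split_ifs
  exacts [hX _ _, L.zero_mem]

lemma wordSpan_mul_mem {I : Type*} {σ : I → S} {w : I → ℕ} {d d' e e' : ℕ} {x y : S}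
    (hx : x ∈ wordSpan A σ w (d + 1) e) (hy : y ∈ wordSpan A σ w (d' + 1) e') :
    x * y ∈ wordSpan A σ w (d + d' + 1) (e + e') := by
  have := Submodule.mul_mem_mul hx hy
  rw [wordSpan, wordSpan, Submodule.span_mul_span] at this
  refine Submodule.span_mono ?_ this
  rintro _ ⟨_, ⟨l, h1, h2, rfl⟩, _, ⟨l', h1', h2', rfl⟩, rfl⟩
  refine ⟨l ++ l', ?_, ?_, by simp⟩
  · simp only [List.length_append]; omega
  · simp only [List.map_append, List.sum_append]; omega

end FirstOrder

section Reflection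

variable {N : ℕ}

/-- The deviation of the reflection equation from commutativity, see `reflection_expand`. -/
def reflDev {A C : Type} [CommRing A] [Ring C] [Algebra A C] (h ε ε' : A) (m₁ m₂ x y : C) : C :=
  (ε' • (m₁ * x + x * m₂ - m₂ * x - x * m₁) + ε • ((m₁ + m₂) * y - y * (m₁ + m₂))) +
    h • (ε' • (m₁ * x * m₂ - m₂ * x * m₁) + ε • (m₁ * m₂ * y - y * (m₁ * m₂)) +
      (m₁ * x * y + x * m₂ * y - y * m₂ * x - y * x * m₁)) +
    (h * h) • (m₁ * x * m₂ * y - y * m₂ * x * m₁)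

lemma reflection_eq_smul_add_reflDev {A C : Type} [CommRing A] [Ring C] [Algebra A C]
    {h ε ε' : A} {m₁ m₂ x y M₁ M₂ X Y : C} (hm : Commute m₁ m₂)
    (hM₁ : M₁ = 1 + h • m₁) (hM₂ : M₂ = 1 + h • m₂)
    (hX : X = ε • 1 + h • x) (hY : Y = ε' • 1 + h • y) :
    M₁ * X * M₂ * Y - Y * M₂ * X * M₁ =
      (h * h) • ((x * y - y * x) + reflDev h ε ε' m₁ m₂ x y) := by
  rw [hM₁, hM₂, hX, hY, reflection_expand hm, reflDev]
  congr 1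
  abel

variable {A S : Type} [CommRing A] [Ring S] [Algebra A S]

lemma reflDev_mem_matrixIn {m I : Type} [Fintype m] [DecidableEq m] {σ : I → S} {w : I → ℕ}
    {𝔪 : Ideal A} {h : A} (hh : h ∈ 𝔪) (ε ε' : A) (m₁ m₂ : Matrix m m A) {x y : Matrix m m S}
    {e e' : ℕ} (hx : x ∈ matrixIn (wordSpan A σ w 2 e)) (hy : y ∈ matrixIn (wordSpan A σ w 2 e')) :
    reflDev h ε ε' (m₁.map (algebraMap A S)) (m₂.map (algebraMap A S)) x y ∈
      matrixIn (lowerSpan 𝔪 σ w 2 (e + e')) := by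
  have hlin : matrixIn (m := m) (wordSpan A σ w 2 (e + e')) ≤
      matrixIn (lowerSpan 𝔪 σ w 2 (e + e')) := fun M hM p r => Submodule.mem_sup_left (hM p r)
  have hquad : ∀ M ∈ matrixIn (m := m) (wordSpan A σ w 3 (e + e')),
      h • M ∈ matrixIn (lowerSpan 𝔪 σ w 2 (e + e')) := fun M hM p r =>
    Submodule.mem_sup_right (Submodule.smul_mem_smul hh (hM p r))
  have h23 : matrixIn (m := m) (wordSpan A σ w 2 (e + e')) ≤
      matrixIn (wordSpan A σ w 3 (e + e')) := fun M hM p r =>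
    wordSpan_mono (by omega) le_rfl (hM p r)
  have hx' : x ∈ matrixIn (wordSpan A σ w 2 (e + e')) := fun p r =>
    wordSpan_mono le_rfl (by omega) (hx p r)
  have hy' : y ∈ matrixIn (wordSpan A σ w 2 (e + e')) := fun p r =>
    wordSpan_mono le_rfl (by omega) (hy p r)
  have mulxy : ∀ {X Y : Matrix m m S}, X ∈ matrixIn (wordSpan A σ w 2 e) →
      Y ∈ matrixIn (wordSpan A σ w 2 e') → X * Y ∈ matrixIn (wordSpan A σ w 3 (e + e')) :=
    fun h h' => mul_mem_matrixIn (fun _ ha _ hb => wordSpan_mul_mem (d := 1) (d' := 1) ha hb) h h'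
  have mulyx : ∀ {X Y : Matrix m m S}, X ∈ matrixIn (wordSpan A σ w 2 e) →
      Y ∈ matrixIn (wordSpan A σ w 2 e') → Y * X ∈ matrixIn (wordSpan A σ w 3 (e + e')) :=
    fun h h' => mul_mem_matrixIn
      (fun _ ha _ hb => by rw [add_comm e]; exact wordSpan_mul_mem (d := 1) (d' := 1) ha hb) h' h
  have hl := fun (M : Matrix m m A) {L : Submodule A S} {X : Matrix m m S}
    (hX : X ∈ matrixIn L) => map_mul_mem_matrixIn M hX
  have hr := fun (M : Matrix m m A) {L : Submodule A S} {X : Matrix m m S}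
    (hX : X ∈ matrixIn L) => mul_map_mem_matrixIn M hX
  unfold reflDev
  refine add_mem (add_mem (hlin (add_mem ?_ ?_)) (hquad _ ?_)) ?_
  · exact Submodule.smul_mem _ _
      (sub_mem (sub_mem (add_mem (hl _ hx') (hr _ hx')) (hl _ hx')) (hr _ hx'))
  · refine Submodule.smul_mem _ _ ?_
    rw [add_mul, mul_add]
    exact sub_mem (add_mem (hl _ hy') (hl _ hy')) (add_mem (hr _ hy') (hr _ hy'))
  · refine add_mem (add_mem (Submodule.smul_mem _ _ (h23 ?_)) (Submodule.smul_mem _ _ (h23 ?_))) ?_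
    · exact sub_mem (hr _ (hl _ hx')) (hr _ (hl _ hx'))
    · rw [← Matrix.map_mul]
      exact sub_mem (hl _ hy') (hr _ hy')
    · rw [mul_assoc y]
      exact sub_mem (sub_mem (add_mem (mulxy (hl _ hx) hy) (mulxy (hr _ hx) hy))
        (mulyx (hl _ hx) hy)) (hr _ (mulyx hx hy))
  · rw [mul_smul]
    refine Submodule.smul_mem _ _ (hquad _ (sub_mem (mulxy (hr _ (hl _ hx)) hy) ?_))
    rw [mul_assoc y]
    exact hr _ (mulyx (hl _ hx) hy)

lemma z1_eq_smul_one_add {h : A} {s x : ℕ → Matrix (Fin N) (Fin N) S}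
    (hs : ∀ r, s r = (if r = 0 then 1 else 0 : A) • 1 + h • x r) (r : ℤ) :
    z1 s r = (if r = 0 then 1 else 0 : A) • 1 + h • z1 x r := by
  unfold z1
  split_ifs with h1 h2 h2
  · rw [hs, amp1_add, amp1_smul, amp1_smul, amp1_one, if_pos (by omega)]
  · rw [hs, amp1_add, amp1_smul, amp1_smul, amp1_one, if_neg (by omega)]
  · omega
  · simp

lemma z2_eq_smul_one_add {h : A} {s x : ℕ → Matrix (Fin N) (Fin N) S}
    (hs : ∀ r, s r = (if r = 0 then 1 else 0 : A) • 1 + h • x r) (r : ℤ) :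
    z2 s r = (if r = 0 then 1 else 0 : A) • 1 + h • z2 x r := by
  unfold z2
  split_ifs with h1 h2 h2
  · rw [hs, amp2_add, amp2_smul, amp2_smul, amp2_one, if_pos (by omega)]
  · rw [hs, amp2_add, amp2_smul, amp2_smul, amp2_one, if_neg (by omega)]
  · omega
  · simp

/-- If `S(u) = 1 + h x(u)` satisfies the reflection equation, the entries of `x(u)` commute
up to shorter words and multiples of `h`. -/
theorem comm_mem_lowerSpan_of_reflection {F I : Type} [Field F] [Algebra A F] [Algebra F S]
    [IsScalarTower A F S] {σ : I → S} {w : I → ℕ} {𝔪 : Ideal A} {q : F} {h κ κ' : A}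
    (hκ : algebraMap A F (h * κ) = q - 1) (hκ' : algebraMap A F (h * κ') = q⁻¹ - 1)
    (hh : algebraMap A F h = q - q⁻¹) (hne : q - q⁻¹ ≠ 0) (h𝔪 : h ∈ 𝔪)
    {s x : ℕ → Matrix (Fin N) (Fin N) S}
    (hs : ∀ r, s r = (if r = 0 then 1 else 0 : A) • 1 + h • x r)
    (hx : ∀ r, x r ∈ matrixIn (wordSpan A σ w 2 r))
    (hrefl : ∀ a b, affLHS F q s a b = affRHS F q s a b) (r t : ℕ) (i j k l : Fin N) :
    x r i j * x t k l - x t k l * x r i j ∈ lowerSpan 𝔪 σ w 2 (r + t) := by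
  have hcancel : ∀ X : Matrix (Fin N × Fin N) (Fin N × Fin N) S, (h * h) • X = 0 → X = 0 := by
    intro X hX
    have : (algebraMap A F h * algebraMap A F h) • X = 0 := by
      rw [← map_mul, algebraMap_smul, hX]
    rwa [smul_eq_zero_iff_right (by rw [hh]; exact mul_ne_zero hne hne)] at this
  set ε : ℤ → A := fun r => if r = 0 then 1 else 0
  set c : ℤ → ℤ → Matrix (Fin N × Fin N) (Fin N × Fin N) S :=
    fun r t => z1 x r * z2 x t - z2 x t * z1 x r with hc
  let D (m₁ m₂ : Matrix (Fin N × Fin N) (Fin N × Fin N) A) (r t : ℤ) :=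
    reflDev h (ε r) (ε t) (m₁.map (algebraMap A S)) (m₂.map (algebraMap A S)) (z1 x r) (z2 x t)
  have hD : ∀ m₁ m₂ (r t : ℤ),
      D m₁ m₂ r t ∈ matrixIn (lowerSpan 𝔪 σ w 2 (r + t).toNat) := by
    intro m₁ m₂ r t
    by_cases hr : 0 ≤ r
    · by_cases ht : 0 ≤ t
      · rw [Int.toNat_add hr ht]
        refine reflDev_mem_matrixIn h𝔪 _ _ _ _ ?_ ?_
        · rw [z1, if_pos hr]; exact amp1_mem_matrixIn (hx _)
        · rw [z2, if_pos ht]; exact amp2_mem_matrixIn (hx _)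
      · have h1 : z2 x t = 0 := if_neg ht
        have h2 : ε t = 0 := if_neg (by omega)
        have : D m₁ m₂ r t = 0 := by simp [D, reflDev, h1, h2]
        rw [this]; exact zero_mem _
    · have h1 : z1 x r = 0 := if_neg hr
      have h2 : ε r = 0 := if_neg (by omega)
      have : D m₁ m₂ r t = 0 := by simp [D, reflDev, h1, h2]
      rw [this]; exact zero_mem _
  have hΦ : ∀ {M₁ M₂ : Matrix (Fin N × Fin N) (Fin N × Fin N) F}
      {m₁ m₂ : Matrix (Fin N × Fin N) (Fin N × Fin N) A}, Commute m₁ m₂ →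
      liftF F M₁ = (1 + h • m₁.map (algebraMap A S) : Matrix _ _ S) →
      liftF F M₂ = (1 + h • m₂.map (algebraMap A S) : Matrix _ _ S) → ∀ r t : ℤ,
      liftF F M₁ * z1 s r * liftF F M₂ * z2 s t - z2 s t * liftF F M₂ * z1 s r * liftF F M₁ =
        (h * h) • (c r t + D m₁ m₂ r t) := by
    intro M₁ M₂ m₁ m₂ hm h1 h2 r t
    refine reflection_eq_smul_add_reflDev ?_ h1 h2 (z1_eq_smul_one_add hs r)
      (z2_eq_smul_one_add hs t)
    exact hm.map ((algebraMap A S).mapMatrix)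
  let ρ := firstOrder N κ 1 (· < ·)
  let ρ' := firstOrder N κ' (-1) (fun i j : Fin N => j < i)
  have hR := liftF_Rc_eq (N := N) (S := S) hκ hh
  have hR' := liftF_Rtil_eq (N := N) (S := S) hκ' hh
  have hRt : liftF F (Rct F q N) = _ := liftF_partialTranspose hR
  have hRt' : liftF F (Rtilt F q N) = _ := liftF_partialTranspose hR'
  have hrec : ∀ r t : ℤ, c r (t + 2) = c (r + 1) (t + 1) + c (r - 1) (t + 1) - c r t +
      (D ρ' (partialTranspose ρ) (r + 1) (t + 1) + D ρ (partialTranspose ρ') (r - 1) (t + 1) -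
        D ρ' (partialTranspose ρ') r t - D ρ (partialTranspose ρ) r (t + 2)) := by
    intro r t
    have e := hrefl (-r) (-t)
    simp only [affLHS, affRHS] at e
    rw [show - -r = r by ring, show - -t = t by ring, show 1 - -r = r + 1 by ring,
      show 1 - -t = t + 1 by ring, show -1 - -r = r - 1 by ring, show 2 - -t = t + 2 by ring] at e
    have e1 := hΦ (commute_firstOrder_partialTranspose (by simp) (by simp)) hR' hRt' r t
    have e2 := hΦ (commute_firstOrder_partialTranspose (by simp) (by simp)) hR' hRt (r + 1) (t + 1)
    have e3 := hΦ (commute_firstOrder_partialTranspose (by simp) (by simp)) hR hRt' (r - 1) (t + 1)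
    have e4 := hΦ (commute_firstOrder_partialTranspose (by simp) (by simp)) hR hRt r (t + 2)
    rw [← sub_eq_zero] at e ⊢
    apply hcancel
    rw [← e]
    have : ∀ a b c d a' b' c' d' : Matrix (Fin N × Fin N) (Fin N × Fin N) S,
        a - b - c + d - (a' - c' - b' + d') = (a - a') - (b - b') - (c - c') + (d - d') := by
      intros; abel
    rw [this, e1, e2, e3, e4]
    module
  have main : ∀ n : ℕ, ∀ t : ℤ, t < n → ∀ r : ℤ,
      c r t ∈ matrixIn (lowerSpan 𝔪 σ w 2 (r + t).toNat) := by
    intro n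
    induction n with
    | zero =>
      intro t ht r
      have h1 : z2 x t = 0 := if_neg (by simpa using ht)
      have : c r t = 0 := by simp [hc, h1]
      rw [this]; exact zero_mem _
    | succ n ih =>
      intro t ht r
      by_cases hr : 0 ≤ r
      · by_cases ht0 : 0 ≤ t
        · obtain ⟨t, rfl⟩ : ∃ t', t = t' + 2 := ⟨t - 2, by ring⟩
          have mono : ∀ {a b : ℤ} {M : Matrix (Fin N × Fin N) (Fin N × Fin N) S},
              a ≤ b → M ∈ matrixIn (lowerSpan 𝔪 σ w 2 a.toNat) →
              M ∈ matrixIn (lowerSpan 𝔪 σ w 2 b.toNat) := fun hab hM p r =>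
            lowerSpan_mono (Int.toNat_le_toNat hab) (hM p r)
          rw [hrec]
          push_cast at ht
          refine add_mem (sub_mem (add_mem ?_ ?_) ?_) (sub_mem (sub_mem (add_mem ?_ ?_) ?_) ?_)
          · exact mono (by omega) (ih _ (by omega) _)
          · exact mono (by omega) (ih _ (by omega) _)
          · exact mono (by omega) (ih _ (by omega) _)
          · exact mono (by omega) (hD _ _ _ _)
          · exact mono (by omega) (hD _ _ _ _)
          · exact mono (by omega) (hD _ _ _ _)
          · exact mono (by omega) (hD _ _ _ _)
        · have h1 : z2 x t = 0 := if_neg ht0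
          have : c r t = 0 := by simp [hc, h1]
          rw [this]; exact zero_mem _
      · have h1 : z1 x r = 0 := if_neg hr
        have : c r t = 0 := by simp [hc, h1]
        rw [this]; exact zero_mem _
  have := main (t + 1) t (by omega) r (i, k) (j, l)
  have hz1 : z1 x (r : ℤ) = amp1 (x r) := if_pos (Int.natCast_nonneg r)
  have hz2 : z2 x (t : ℤ) = amp2 (x t) := if_pos (Int.natCast_nonneg t)
  rw [hc] at this
  simp only [hz1, hz2, Matrix.sub_apply, amp1_mul_amp2_apply, amp2_mul_amp1_apply] at this
  rwa [← Nat.cast_add, Int.toNat_natCast] at this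

end Reflection

section PowerSeriesCoefficients

variable {F B C : Type} [Field F] [Ring B] [Algebra F B] [Ring C] [Algebra F C] {N : ℕ}

lemma map_mul_amp1_mul_mul_amp2 (f : C →ₗ[F] B) {X Y : Matrix (Fin N) (Fin N) C}
    {X' Y' : Matrix (Fin N) (Fin N) B} (h : ∀ i j k l, f (X i j * Y k l) = X' i j * Y' k l)
    (M₁ M₂ : Matrix (Fin N × Fin N) (Fin N × Fin N) F) :
    (liftF F M₁ * amp1 X * liftF F M₂ * amp2 Y).map f =
      liftF F M₁ * amp1 X' * liftF F M₂ * amp2 Y' := by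
  ext p r
  simp only [mul_assoc (liftF F M₁), Matrix.map_apply]
  rw [Matrix.mul_apply, Matrix.mul_apply]
  simp only [amp1_mul_mul_amp2_apply, map_sum, liftF, Matrix.map_apply, Finset.mul_sum,
    ← Algebra.commutes (M₂ _ _), ← Algebra.smul_def, smul_mul_assoc, map_smul, h]

lemma map_amp2_mul_mul_amp1_mul (f : C →ₗ[F] B) {X Y : Matrix (Fin N) (Fin N) C}
    {X' Y' : Matrix (Fin N) (Fin N) B} (h : ∀ i j k l, f (Y k l * X i j) = Y' k l * X' i j)
    (M₁ M₂ : Matrix (Fin N × Fin N) (Fin N × Fin N) F) :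
    (amp2 Y * liftF F M₂ * amp1 X * liftF F M₁).map f =
      amp2 Y' * liftF F M₂ * amp1 X' * liftF F M₁ := by
  ext p r
  simp only [Matrix.map_apply]
  rw [Matrix.mul_apply, Matrix.mul_apply]
  simp only [amp2_mul_mul_amp1_apply, map_sum, liftF, Matrix.map_apply,
    ← Algebra.commutes (M₂ _ _), ← Algebra.commutes (M₁ _ _), ← Algebra.smul_def,
    map_smul, h, Finset.mul_sum, smul_mul_assoc]

variable (F B) in
/-- The coefficient of `x ^ m * y ^ n`, where `x` is the outer variable. -/
def biCoeff (m n : ℤ) : PowerSeries (PowerSeries B) →ₗ[F] B where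
  toFun c := if 0 ≤ m ∧ 0 ≤ n then (c.coeff m.toNat).coeff n.toNat else 0
  map_add' c d := by split_ifs <;> simp
  map_smul' k c := by
    split_ifs
    · rfl
    · simp

variable (F B) in
/-- The outer variable as a central element. -/
def outerVar : Subalgebra.center F (PowerSeries (PowerSeries B)) :=
  ⟨PowerSeries.X, Subalgebra.mem_center_iff.2 fun _ => (PowerSeries.commute_X _).eq⟩

variable (F B) in
/-- The inner variable as a central element. -/
def innerVar : Subalgebra.center F (PowerSeries (PowerSeries B)) :=
  ⟨PowerSeries.C PowerSeries.X, Subalgebra.mem_center_iff.2 fun c => by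
    ext n : 1
    rw [PowerSeries.coeff_mul_C, PowerSeries.coeff_C_mul, (PowerSeries.commute_X _).eq]⟩

lemma biCoeff_outerVar_smul (m n : ℤ) (c : PowerSeries (PowerSeries B)) :
    biCoeff F B m n (outerVar F B • c) = biCoeff F B (m - 1) n c := by
  have : outerVar F B • c = PowerSeries.X * c := rfl
  simp only [biCoeff, LinearMap.coe_mk, AddHom.coe_mk, this]
  by_cases hm : 1 ≤ m
  · obtain ⟨k, rfl⟩ : ∃ k : ℕ, m = k + 1 := ⟨(m - 1).toNat, by omega⟩
    rw [show ((k : ℤ) + 1).toNat = k + 1 by omega, PowerSeries.coeff_succ_X_mul,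
      add_sub_cancel_right, Int.toNat_natCast]
    exact if_congr (by omega) rfl rfl
  · rw [if_neg (show ¬(0 ≤ m - 1 ∧ 0 ≤ n) by omega)]
    by_cases h0 : m = 0
    · subst h0; simp [PowerSeries.coeff_zero_X_mul]
    · exact if_neg (by omega)

lemma biCoeff_innerVar_smul (m n : ℤ) (c : PowerSeries (PowerSeries B)) :
    biCoeff F B m n (innerVar F B • c) = biCoeff F B m (n - 1) c := by
  have : innerVar F B • c = PowerSeries.C PowerSeries.X * c := rfl
  simp only [biCoeff, LinearMap.coe_mk, AddHom.coe_mk, this, PowerSeries.coeff_C_mul]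
  by_cases hm : 1 ≤ n
  · obtain ⟨k, rfl⟩ : ∃ k : ℕ, n = k + 1 := ⟨(n - 1).toNat, by omega⟩
    rw [show ((k : ℤ) + 1).toNat = k + 1 by omega, PowerSeries.coeff_succ_X_mul,
      add_sub_cancel_right, Int.toNat_natCast]
    exact if_congr (by omega) rfl rfl
  · rw [if_neg (show ¬(0 ≤ m ∧ 0 ≤ n - 1) by omega)]
    by_cases h0 : n = 0
    · subst h0; simp [PowerSeries.coeff_zero_X_mul]
    · exact if_neg (by omega)

variable (F) in
lemma biCoeff_ext {c d : PowerSeries (PowerSeries B)}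
    (h : ∀ m n : ℕ, biCoeff F B m n c = biCoeff F B m n d) : c = d := by
  ext m n
  simpa [biCoeff] using h m n

/-- The generating matrix of a sequence of matrices in the outer variable. -/
def outerSeries (f : ℕ → Matrix (Fin N) (Fin N) B) :
    Matrix (Fin N) (Fin N) (PowerSeries (PowerSeries B)) :=
  Matrix.of fun i j => PowerSeries.mk fun r => PowerSeries.C (f r i j)

/-- The generating matrix of a sequence of matrices in the inner variable. -/
def innerSeries (f : ℕ → Matrix (Fin N) (Fin N) B) :
    Matrix (Fin N) (Fin N) (PowerSeries (PowerSeries B)) :=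
  Matrix.of fun i j => PowerSeries.C (PowerSeries.mk fun r => f r i j)

/-- Extension of a sequence by zero to negative indices. -/
def extZero (f : ℕ → Matrix (Fin N) (Fin N) B) (r : ℤ) : Matrix (Fin N) (Fin N) B :=
  if 0 ≤ r then f r.toNat else 0

lemma z1_eq (f : ℕ → Matrix (Fin N) (Fin N) B) (r : ℤ) : z1 f r = amp1 (extZero f r) := by
  unfold z1 extZero; split_ifs <;> simp

lemma z2_eq (f : ℕ → Matrix (Fin N) (Fin N) B) (r : ℤ) : z2 f r = amp2 (extZero f r) := by
  unfold z2 extZero; split_ifs <;> simp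

lemma biCoeff_outer_mul_inner (f g : ℕ → Matrix (Fin N) (Fin N) B) (m n : ℤ) (i j k l : Fin N) :
    biCoeff F B m n (outerSeries f i j * innerSeries g k l) =
      extZero f m i j * extZero g n k l := by
  by_cases hm : 0 ≤ m <;> by_cases hn : 0 ≤ n <;>
    simp [biCoeff, outerSeries, innerSeries, extZero, hm, hn, PowerSeries.coeff_mul_C,
      PowerSeries.coeff_C_mul]

lemma biCoeff_inner_mul_outer (f g : ℕ → Matrix (Fin N) (Fin N) B) (m n : ℤ) (i j k l : Fin N) :
    biCoeff F B m n (innerSeries f i j * outerSeries g k l) =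
      extZero f n i j * extZero g m k l := by
  by_cases hm : 0 ≤ m <;> by_cases hn : 0 ≤ n <;>
    simp [biCoeff, outerSeries, innerSeries, extZero, hm, hn, PowerSeries.coeff_mul_C,
      PowerSeries.coeff_C_mul]

/-- The product `T(x) T̄(x)ᵗ` coefficientwise. -/
def twistedProduct (t u : ℕ → Matrix (Fin N) (Fin N) B) (r : ℕ) : Matrix (Fin N) (Fin N) B :=
  Matrix.of fun i j => ∑ a : Fin N, ∑ p ∈ Finset.range (r + 1), t p i a * u (r - p) j a

lemma outerSeries_twistedProduct (t u : ℕ → Matrix (Fin N) (Fin N) B) :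
    outerSeries (twistedProduct t u) = outerSeries t * (outerSeries u).transpose := by
  ext i j r : 3
  simp only [outerSeries, twistedProduct, Matrix.of_apply, Matrix.mul_apply, PowerSeries.coeff_mk,
    map_sum, map_mul, Matrix.transpose_apply, PowerSeries.coeff_mul,
    Finset.Nat.sum_antidiagonal_eq_sum_range_succ_mk]

lemma innerSeries_twistedProduct (t u : ℕ → Matrix (Fin N) (Fin N) B) :
    innerSeries (twistedProduct t u) = innerSeries t * (innerSeries u).transpose := by
  refine Matrix.ext fun i j => ?_
  simp only [innerSeries, twistedProduct, Matrix.of_apply, Matrix.mul_apply,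
    Matrix.transpose_apply, ← map_mul, ← map_sum]
  congr 1
  ext r
  simp only [PowerSeries.coeff_mk, map_sum, PowerSeries.coeff_mul,
    Finset.Nat.sum_antidiagonal_eq_sum_range_succ_mk]

end PowerSeriesCoefficients

section ReflectionCoefficients

variable {F B : Type} [Field F] [Ring B] [Algebra F B] {N : ℕ}

instance centerAlgebra {C : Type} [Ring C] [Algebra F C] : Algebra (Subalgebra.center F C) C where
  algebraMap := (Subalgebra.center F C).val.toRingHom
  commutes' c x := (Subalgebra.mem_center_iff.1 c.2 x).symm
  smul_def' _ _ := rfl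

instance isScalarTower_center {C : Type} [Ring C] [Algebra F C] :
    IsScalarTower F (Subalgebra.center F C) C :=
  IsScalarTower.of_algebraMap_eq fun _ => rfl

lemma liftF_one {A m : Type} [Ring A] [Algebra F A] [DecidableEq m] :
    (liftF F (1 : Matrix m m F) : Matrix m m A) = 1 := by
  rw [liftF, Matrix.map_one _ (map_zero _) (map_one _)]

variable (F B) in
/-- `biCoeff` applied entrywise. -/
def matCoeff (m n : ℤ) {k : Type} :
    Matrix k k (PowerSeries (PowerSeries B)) →ₗ[F] Matrix k k B :=
  (biCoeff F B m n).mapMatrix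

variable (F) in
lemma matCoeff_ext_iff {k : Type} {X Y : Matrix k k (PowerSeries (PowerSeries B))} :
    X = Y ↔ ∀ m n, matCoeff F B m n X = matCoeff F B m n Y :=
  ⟨fun h _ _ => h ▸ rfl, fun h => Matrix.ext fun p r =>
    biCoeff_ext F fun m n => congrFun (congrFun (h m n) p) r⟩

lemma matCoeff_outerVar_smul (m n : ℤ) {k : Type}
    (X : Matrix k k (PowerSeries (PowerSeries B))) :
    matCoeff F B m n (outerVar F B • X) = matCoeff F B (m - 1) n X := by
  ext p r
  exact biCoeff_outerVar_smul m n (X p r)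

lemma matCoeff_innerVar_smul (m n : ℤ) {k : Type}
    (X : Matrix k k (PowerSeries (PowerSeries B))) :
    matCoeff F B m n (innerVar F B • X) = matCoeff F B m (n - 1) X := by
  ext p r
  exact biCoeff_innerVar_smul m n (X p r)

variable (f g : ℕ → Matrix (Fin N) (Fin N) B) (m n : ℤ)
  (M₁ M₂ : Matrix (Fin N × Fin N) (Fin N × Fin N) F)

lemma matCoeff_reflLHS :
    matCoeff F B m n
      (liftF F M₁ * amp1 (outerSeries f) * liftF F M₂ * amp2 (innerSeries g)) =
    liftF F M₁ * z1 f m * liftF F M₂ * z2 g n := by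
  rw [z1_eq, z2_eq]
  exact map_mul_amp1_mul_mul_amp2 _ (fun _ _ _ _ => biCoeff_outer_mul_inner ..) _ _

lemma matCoeff_reflRHS :
    matCoeff F B m n
      (amp2 (innerSeries g) * liftF F M₂ * amp1 (outerSeries f) * liftF F M₁) =
    z2 g n * liftF F M₂ * z1 f m * liftF F M₁ := by
  rw [z1_eq, z2_eq]
  exact map_amp2_mul_mul_amp1_mul _ (fun _ _ _ _ => biCoeff_inner_mul_outer ..) _ _

lemma matCoeff_rttLHS :
    matCoeff F B m n (liftF F M₁ * amp1 (outerSeries f) * amp2 (innerSeries g)) =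
    liftF F M₁ * z1 f m * z2 g n := by
  simpa only [liftF_one, mul_one] using matCoeff_reflLHS f g m n M₁ 1

lemma matCoeff_rttRHS :
    matCoeff F B m n (amp2 (innerSeries g) * amp1 (outerSeries f) * liftF F M₁) =
    z2 g n * z1 f m * liftF F M₁ := by
  simpa only [liftF_one, mul_one] using matCoeff_reflRHS f g m n M₁ 1

lemma matCoeff_rttLHS_swap :
    matCoeff F B m n (liftF F M₁ * amp1 (innerSeries f) * amp2 (outerSeries g)) =
    liftF F M₁ * z1 f n * z2 g m := by
  rw [z1_eq, z2_eq]
  have := map_mul_amp1_mul_mul_amp2 (biCoeff F B m n) (X := innerSeries f)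
    (Y := outerSeries g) (X' := extZero f n) (Y' := extZero g m)
    (fun _ _ _ _ => biCoeff_inner_mul_outer ..) M₁ 1
  simp only [liftF_one, mul_one] at this
  exact this

lemma matCoeff_rttRHS_swap :
    matCoeff F B m n (amp2 (outerSeries g) * amp1 (innerSeries f) * liftF F M₁) =
    z2 g m * z1 f n * liftF F M₁ := by
  rw [z1_eq, z2_eq]
  have := map_amp2_mul_mul_amp1_mul (biCoeff F B m n) (X := innerSeries f)
    (Y := outerSeries g) (X' := extZero f n) (Y' := extZero g m)
    (fun _ _ _ _ => biCoeff_outer_mul_inner ..) M₁ 1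
  simp only [liftF_one, mul_one] at this
  exact this

/-- The linear combination `α M₁ - β M₂` of scalar matrices. -/
def pencil {Z : Type} [CommRing Z] [Algebra F Z] (α β : Z)
    (M₁ M₂ : Matrix (Fin N × Fin N) (Fin N × Fin N) F) :
    Matrix (Fin N × Fin N) (Fin N × Fin N) Z :=
  α • M₁.map (algebraMap F Z) - β • M₂.map (algebraMap F Z)

lemma map_pencil {Z C : Type} [CommRing Z] [Ring C] [Algebra F Z] [Algebra F C] [Algebra Z C]
    [IsScalarTower F Z C] (α β : Z) :
    (pencil α β M₁ M₂).map (algebraMap Z C) = α • liftF F M₁ - β • liftF F M₂ := by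
  ext p r
  simp only [pencil, liftF, Matrix.map_apply, Matrix.sub_apply, Matrix.smul_apply, map_sub,
    smul_eq_mul, map_mul, ← IsScalarTower.algebraMap_apply, ← Algebra.smul_def]

lemma partialTranspose_pencil {Z : Type} [CommRing Z] [Algebra F Z] (α β : Z) :
    partialTranspose (pencil α β M₁ M₂) =
      pencil α β (partialTranspose M₁) (partialTranspose M₂) := by
  ext p r
  simp [partialTranspose, pencil]

lemma Rc_isFlipSymm (q : F) : IsFlipSymm (Rc F q N) := by
  rintro ⟨i, j⟩ ⟨a, b⟩
  simp only [Rc, Matrix.of_apply, Prod.swap_prod_mk, Prod.mk.injEq]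
  congr 1 <;> split_ifs <;> grind

lemma Rtil_isFlipSymm (q : F) : IsFlipSymm (Rtil F q N) := by
  rintro ⟨i, j⟩ ⟨a, b⟩
  simp only [Rtil, Matrix.of_apply, Prod.swap_prod_mk, Prod.mk.injEq]
  congr 1 <;> split_ifs <;> grind

lemma isFlipSymm_pencil {Z : Type} [CommRing Z] [Algebra F Z] (α β : Z) (q : F) :
    IsFlipSymm (pencil α β (Rtil F q N) (Rc F q N)) := by
  intro p r
  simp only [pencil, Matrix.sub_apply, Matrix.smul_apply, Matrix.map_apply]
  rw [Rc_isFlipSymm q p r, Rtil_isFlipSymm q p r]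

lemma commute_pencil {Z : Type} [CommRing Z] [Algebra F Z] (α β α' β' : Z) (q : F) :
    Commute (pencil α β (Rtil F q N) (Rc F q N))
      (partialTranspose (pencil α' β' (Rtil F q N) (Rc F q N))) := by
  refine mul_comm_of_scalar_blocks (c := α * algebraMap F Z q⁻¹ - β * algebraMap F Z q)
    (d := α' - β') ?_ ?_
  · rintro ⟨i, j⟩ ⟨a, b⟩ h
    have h1 : Rc F q N (i, j) (a, b) = if (i, j) = (a, b) then q else 0 := by
      simp only [Rc, Matrix.of_apply, Prod.mk.injEq] at h ⊢
      split_ifs <;> grind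
    have h2 : Rtil F q N (i, j) (a, b) = if (i, j) = (a, b) then q⁻¹ else 0 := by
      simp only [Rtil, Matrix.of_apply, Prod.mk.injEq] at h ⊢
      split_ifs <;> grind
    simp only [pencil, Matrix.sub_apply, Matrix.smul_apply, Matrix.map_apply, h1, h2, smul_eq_mul]
    split_ifs <;> simp
  · rintro ⟨i, j⟩ ⟨a, b⟩ h
    have h1 : Rc F q N (a, j) (i, b) = if (i, j) = (a, b) then 1 else 0 := by
      simp only [Rc, Matrix.of_apply, Prod.mk.injEq, ne_eq] at h ⊢
      split_ifs <;> grind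
    have h2 : Rtil F q N (a, j) (i, b) = if (i, j) = (a, b) then 1 else 0 := by
      simp only [Rtil, Matrix.of_apply, Prod.mk.injEq, ne_eq] at h ⊢
      split_ifs <;> grind
    simp only [pencil, partialTranspose, Matrix.of_apply, Matrix.sub_apply, Matrix.smul_apply,
      Matrix.map_apply, h1, h2, smul_eq_mul]
    split_ifs <;> simp

/-- The relation `M X₁ Y₂ = Y₂ X₁ M`. -/
def Intertwines {Z C : Type} [CommRing Z] [Ring C] [Algebra Z C]
    (M : Matrix (Fin N × Fin N) (Fin N × Fin N) Z) (X Y : Matrix (Fin N) (Fin N) C) : Prop :=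
  M.map (algebraMap Z C) * amp1 X * amp2 Y = amp2 Y * amp1 X * M.map (algebraMap Z C)

lemma Intertwines.mul {Z C : Type} [CommRing Z] [Ring C] [Algebra Z C]
    {M : Matrix (Fin N × Fin N) (Fin N × Fin N) Z} {X Y X' Y' : Matrix (Fin N) (Fin N) C}
    (h : Intertwines M X Y) (h' : Intertwines M X' Y')
    (hYX : ∀ i j k l, Commute (X' i j) (Y k l)) (hXY : ∀ i j k l, Commute (X i j) (Y' k l)) :
    Intertwines M (X * X') (Y * Y') := by
  rw [Intertwines, amp1_mul, amp2_mul]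
  exact rtt_mul h h' (commute_amp1_amp2 hYX) (commute_amp1_amp2 hXY)

/-- The coefficientwise RTT relations of the quantum affine algebra. -/
structure IsRtt (q : F) (t u : ℕ → Matrix (Fin N) (Fin N) B) : Prop where
  tt : ∀ a b : ℤ, affRttL F q t t (1 - a) (-b) (-a) (1 - b) =
    affRttR F q t t (1 - a) (-b) (-a) (1 - b)
  uu : ∀ a b : ℤ, affRttL F q u u (a - 1) b a (b - 1) = affRttR F q u u (a - 1) b a (b - 1)
  ut : ∀ a b : ℤ, affRttL F q u t (a - 1) (-b) a (1 - b) =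
    affRttR F q u t (a - 1) (-b) a (1 - b)

variable (q : F) (t u : ℕ → Matrix (Fin N) (Fin N) B)

lemma intertwines_outer_inner_iff : Intertwines
    (pencil (innerVar F B) (outerVar F B) (Rtil F q N) (Rc F q N)) (outerSeries t)
      (innerSeries u) ↔
    ∀ m n : ℤ, affRttL F q t u m (n - 1) (m - 1) n = affRttR F q t u m (n - 1) (m - 1) n := by
  rw [Intertwines, matCoeff_ext_iff F]
  simp only [map_pencil, sub_mul, mul_sub, smul_mul_assoc, mul_smul_comm, map_sub, matCoeff_rttLHS,
    matCoeff_rttRHS, matCoeff_outerVar_smul, matCoeff_innerVar_smul, affRttL, affRttR]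

lemma intertwines_inner_outer_iff : Intertwines
    (pencil (innerVar F B) (outerVar F B) (Rtil F q N) (Rc F q N)) (innerSeries t)
      (outerSeries u) ↔
    ∀ m n : ℤ, affRttL F q t u (m - 1) n m (n - 1) = affRttR F q t u (m - 1) n m (n - 1) := by
  rw [Intertwines, matCoeff_ext_iff F, forall_comm]
  simp only [map_pencil, sub_mul, mul_sub, smul_mul_assoc, mul_smul_comm, map_sub,
    matCoeff_rttLHS_swap,
    matCoeff_rttRHS_swap, matCoeff_outerVar_smul, matCoeff_innerVar_smul, affRttL, affRttR]

lemma intertwines_one_outer_inner_iff : Intertwines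
    (pencil (outerVar F B * innerVar F B) 1 (Rtil F q N) (Rc F q N)) (outerSeries t)
      (innerSeries u) ↔
    ∀ m n : ℤ, affRttL F q t u (m - 1) (n - 1) m n = affRttR F q t u (m - 1) (n - 1) m n := by
  rw [Intertwines, matCoeff_ext_iff F]
  simp only [map_pencil, sub_mul, mul_sub, smul_mul_assoc, mul_smul_comm, map_sub, mul_smul,
    one_smul, matCoeff_rttLHS,
    matCoeff_rttRHS, matCoeff_outerVar_smul, matCoeff_innerVar_smul, affRttL, affRttR]

lemma intertwines_one_inner_outer_iff : Intertwines
    (pencil (outerVar F B * innerVar F B) 1 (Rtil F q N) (Rc F q N)) (innerSeries t)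
      (outerSeries u) ↔
    ∀ m n : ℤ, affRttL F q t u (m - 1) (n - 1) m n = affRttR F q t u (m - 1) (n - 1) m n := by
  rw [Intertwines, matCoeff_ext_iff F, forall_comm]
  simp only [map_pencil, sub_mul, mul_sub, smul_mul_assoc, mul_smul_comm, map_sub, mul_smul,
    one_smul, matCoeff_rttLHS_swap,
    matCoeff_rttRHS_swap, matCoeff_outerVar_smul, matCoeff_innerVar_smul, affRttL, affRttR]

variable {q t u}

lemma isRtt_iff : IsRtt q t u ↔
    Intertwines (pencil (innerVar F B) (outerVar F B) (Rtil F q N) (Rc F q N)) (outerSeries t)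
      (innerSeries t) ∧
    Intertwines (pencil (innerVar F B) (outerVar F B) (Rtil F q N) (Rc F q N)) (innerSeries u)
      (outerSeries u) ∧
    Intertwines (pencil (outerVar F B * innerVar F B) 1 (Rtil F q N) (Rc F q N)) (outerSeries u)
      (innerSeries t) := by
  rw [intertwines_outer_inner_iff, intertwines_inner_outer_iff, intertwines_one_outer_inner_iff]
  refine ⟨fun ⟨h₁, h₂, h₃⟩ => ⟨fun m n => ?_, h₂, fun m n => ?_⟩,
    fun ⟨h₁, h₂, h₃⟩ => ⟨fun m n => ?_, h₂, fun m n => ?_⟩⟩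
  · have := h₁ (1 - m) (1 - n)
    rwa [sub_sub_cancel, sub_sub_cancel, neg_sub, neg_sub] at this
  · have := h₃ m (1 - n)
    rwa [sub_sub_cancel, neg_sub] at this
  · have := h₁ (1 - m) (1 - n)
    rwa [sub_sub_cancel_left, sub_sub_cancel_left] at this
  · have := h₃ m (1 - n)
    rwa [sub_sub_cancel_left] at this

/-- The coefficientwise affine reflection equation for `T(x) T̄(x)ᵗ`. -/
theorem IsRtt.affLHS_eq_affRHS (h : IsRtt q t u) (a b : ℤ) :
    affLHS F q (twistedProduct t u) a b = affRHS F q (twistedProduct t u) a b := by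
  obtain ⟨htt, huu, hut⟩ := isRtt_iff.1 h
  have hut' := (intertwines_one_inner_outer_iff q u t).2
    ((intertwines_one_outer_inner_iff q u t).1 hut)
  have key := reflection_of_rtt (isFlipSymm_pencil _ _ q) (isFlipSymm_pencil _ _ q)
    (commute_pencil (N := N) _ _ _ _ q) htt huu hut hut'
  rw [← outerSeries_twistedProduct, ← innerSeries_twistedProduct, partialTranspose_pencil,
    map_pencil, map_pencil] at key
  have := congrArg (matCoeff F B (1 - a) (2 - b)) key
  simp only [sub_mul, mul_sub, smul_mul_assoc, mul_smul_comm, map_sub, mul_smul, one_smul,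
    matCoeff_reflLHS, matCoeff_reflRHS, matCoeff_outerVar_smul, matCoeff_innerVar_smul] at this
  rw [show 2 - b - 1 - 1 = -b by ring, show 2 - b - 1 = 1 - b by ring,
    show 1 - a - 1 - 1 = -1 - a by ring, show 1 - a - 1 = -a by ring] at this
  have hRt : Rtilt F q N = partialTranspose (Rtil F q N) := rfl
  have hR : Rct F q N = partialTranspose (Rc F q N) := rfl
  rw [affLHS, affRHS, hRt, hR]
  convert this using 1 <;> abel

/-- The coefficients of the product of two matrix series. -/
def seriesMul (t t' : ℕ → Matrix (Fin N) (Fin N) B) : ℕ → Matrix (Fin N) (Fin N) B :=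
  twistedProduct t fun r => (t' r).transpose

lemma outerSeries_seriesMul (t t' : ℕ → Matrix (Fin N) (Fin N) B) :
    outerSeries (seriesMul t t') = outerSeries t * outerSeries t' :=
  outerSeries_twistedProduct ..

lemma innerSeries_seriesMul (t t' : ℕ → Matrix (Fin N) (Fin N) B) :
    innerSeries (seriesMul t t') = innerSeries t * innerSeries t' :=
  innerSeries_twistedProduct ..

lemma commute_outerSeries_innerSeries {t t' : ℕ → Matrix (Fin N) (Fin N) B}
    (h : ∀ r r' i j k l, Commute (t r i j) (t' r' k l)) (i j k l : Fin N) :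
    Commute (outerSeries t i j) (innerSeries t' k l) := by
  ext m n
  simp only [outerSeries, innerSeries, Matrix.of_apply, PowerSeries.coeff_mul_C,
    PowerSeries.coeff_C_mul, PowerSeries.coeff_mk]
  exact (h ..).eq

lemma IsRtt.mul {t' u' : ℕ → Matrix (Fin N) (Fin N) B} (h : IsRtt q t u) (h' : IsRtt q t' u')
    (htt : ∀ r r' i j k l, Commute (t r i j) (t' r' k l))
    (htu : ∀ r r' i j k l, Commute (t r i j) (u' r' k l))
    (hut : ∀ r r' i j k l, Commute (u r i j) (t' r' k l))
    (huu : ∀ r r' i j k l, Commute (u r i j) (u' r' k l)) :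
    IsRtt q (seriesMul t t') (seriesMul u u') := by
  rw [isRtt_iff] at h h' ⊢
  simp only [outerSeries_seriesMul, innerSeries_seriesMul]
  exact ⟨h.1.mul h'.1
      (commute_outerSeries_innerSeries fun _ _ _ _ _ _ => (htt ..).symm)
      (commute_outerSeries_innerSeries htt),
    h.2.1.mul h'.2.1
      (fun i j k l => (commute_outerSeries_innerSeries huu k l i j).symm)
      (fun i j k l => (commute_outerSeries_innerSeries (fun _ _ _ _ _ _ => (huu ..).symm)
        k l i j).symm),
    h.2.2.mul h'.2.2
      (commute_outerSeries_innerSeries fun _ _ _ _ _ _ => (htu ..).symm)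
      (commute_outerSeries_innerSeries hut)⟩

end ReflectionCoefficients

section Representations

variable {F B C : Type} [Field F] [Ring B] [Algebra F B] [Ring C] [Algebra F C] {N : ℕ}

lemma map_liftF (f : B →ₐ[F] C) {m : Type} (M : Matrix m m F) :
    (liftF F M : Matrix m m B).map f = liftF F M := by
  ext p r
  simp [liftF]

lemma map_z1 (f : B →ₐ[F] C) (t : ℕ → Matrix (Fin N) (Fin N) B) (r : ℤ) :
    (z1 t r).map f = z1 (fun r => (t r).map f) r := by
  ext p s
  by_cases h : 0 ≤ r <;> simp [z1, amp1, h, apply_ite f]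

lemma map_z2 (f : B →ₐ[F] C) (t : ℕ → Matrix (Fin N) (Fin N) B) (r : ℤ) :
    (z2 t r).map f = z2 (fun r => (t r).map f) r := by
  ext p s
  by_cases h : 0 ≤ r <;> simp [z2, amp2, h, apply_ite f]

variable (q : F)

lemma map_affRttL (f : B →ₐ[F] C) (t u : ℕ → Matrix (Fin N) (Fin N) B) (a b a' b' : ℤ) :
    (affRttL F q t u a b a' b').map f =
      affRttL F q (fun r => (t r).map f) (fun r => (u r).map f) a b a' b' := by
  simp only [affRttL, Matrix.map_sub f (map_sub f), Matrix.map_mul, map_liftF, map_z1, map_z2]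

lemma map_affRttR (f : B →ₐ[F] C) (t u : ℕ → Matrix (Fin N) (Fin N) B) (a b a' b' : ℤ) :
    (affRttR F q t u a b a' b').map f =
      affRttR F q (fun r => (t r).map f) (fun r => (u r).map f) a b a' b' := by
  simp only [affRttR, Matrix.map_sub f (map_sub f), Matrix.map_mul, map_liftF, map_z1, map_z2]

lemma map_affLHS (f : B →ₐ[F] C) (t : ℕ → Matrix (Fin N) (Fin N) B) (a b : ℤ) :
    (affLHS F q t a b).map f = affLHS F q (fun r => (t r).map f) a b := by
  simp only [affLHS, Matrix.map_sub f (map_sub f), Matrix.map_add f (map_add f), Matrix.map_mul,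
    map_liftF, map_z1, map_z2]

lemma map_affRHS (f : B →ₐ[F] C) (t : ℕ → Matrix (Fin N) (Fin N) B) (a b : ℤ) :
    (affRHS F q t a b).map f = affRHS F q (fun r => (t r).map f) a b := by
  simp only [affRHS, Matrix.map_sub f (map_sub f), Matrix.map_add f (map_add f), Matrix.map_mul,
    map_liftF, map_z1, map_z2]

/-- The defining relations of the quantum affine algebra, for given matrices `t r` and `u r`
in place of the generators. -/
structure IsAffRep (t u : ℕ → Matrix (Fin N) (Fin N) B) : Prop extends IsRtt q t u where
  t_tri : ∀ i j, i < j → t 0 i j = 0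
  u_tri : ∀ i j, j < i → u 0 i j = 0
  t_u : ∀ i, t 0 i i * u 0 i i = 1
  u_t : ∀ i, u 0 i i * t 0 i i = 1

variable {q}

lemma IsAffRep.map {t u : ℕ → Matrix (Fin N) (Fin N) B} (h : IsAffRep q t u) (f : B →ₐ[F] C) :
    IsAffRep q (fun r => (t r).map f) (fun r => (u r).map f) where
  tt a b := by rw [← map_affRttL, ← map_affRttR, h.tt]
  uu a b := by rw [← map_affRttL, ← map_affRttR, h.uu]
  ut a b := by rw [← map_affRttL, ← map_affRttR, h.ut]
  t_tri i j hij := by simp [h.t_tri i j hij]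
  u_tri i j hij := by simp [h.u_tri i j hij]
  t_u i := by simp [← map_mul, h.t_u]
  u_t i := by simp [← map_mul, h.u_t]

variable (F q N) in
lemma uqAff_isAffRep : IsAffRep q (fun r => Matrix.of (tA F q N r))
    (fun r => Matrix.of (tbA F q N r)) where
  tt a b := by
    have h := map_affRttL q (RingQuot.mkAlgHom F (AffGlRel F q N)) (TfA F N) (TfA F N)
      (1 - a) (-b) (-a) (1 - b)
    have h' := map_affRttR q (RingQuot.mkAlgHom F (AffGlRel F q N)) (TfA F N) (TfA F N)
      (1 - a) (-b) (-a) (1 - b)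
    refine h.symm.trans (Eq.trans ?_ h')
    ext p r
    exact RingQuot.mkAlgHom_rel F (AffGlRel.rtt a b p r)
  uu a b := by
    have h := map_affRttL q (RingQuot.mkAlgHom F (AffGlRel F q N)) (TbfA F N) (TbfA F N)
      (a - 1) b a (b - 1)
    have h' := map_affRttR q (RingQuot.mkAlgHom F (AffGlRel F q N)) (TbfA F N) (TbfA F N)
      (a - 1) b a (b - 1)
    refine h.symm.trans (Eq.trans ?_ h')
    ext p r
    exact RingQuot.mkAlgHom_rel F (AffGlRel.rtbtb a b p r)
  ut a b := by
    have h := map_affRttL q (RingQuot.mkAlgHom F (AffGlRel F q N)) (TbfA F N) (TfA F N)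
      (a - 1) (-b) a (1 - b)
    have h' := map_affRttR q (RingQuot.mkAlgHom F (AffGlRel F q N)) (TbfA F N) (TfA F N)
      (a - 1) (-b) a (1 - b)
    refine h.symm.trans (Eq.trans ?_ h')
    ext p r
    exact RingQuot.mkAlgHom_rel F (AffGlRel.rtbt a b p r)
  t_tri i j hij :=
    (RingQuot.mkAlgHom_rel F (AffGlRel.t0_tri (q := q) i j hij)).trans (map_zero _)
  u_tri i j hij :=
    (RingQuot.mkAlgHom_rel F (AffGlRel.tb0_tri (q := q) i j hij)).trans (map_zero _)
  t_u i := by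
    have := RingQuot.mkAlgHom_rel F (AffGlRel.t_tb (F := F) (q := q) i)
    rwa [map_mul, map_one] at this
  u_t i := by
    have := RingQuot.mkAlgHom_rel F (AffGlRel.tb_t (F := F) (q := q) i)
    rwa [map_mul, map_one] at this

/-- The homomorphism on free algebras sending the generators to the entries of `t r`, `u r`. -/
def affGenHom (t u : ℕ → Matrix (Fin N) (Fin N) B) : FreeAlgebra F (AffGen N) →ₐ[F] B :=
  FreeAlgebra.lift F (Sum.elim (fun x : ℕ × Fin N × Fin N => t x.1 x.2.1 x.2.2)
    fun x : ℕ × Fin N × Fin N => u x.1 x.2.1 x.2.2)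

lemma affGenHom_TfA (t u : ℕ → Matrix (Fin N) (Fin N) B) (r : ℕ) (i j : Fin N) :
    affGenHom (F := F) t u (TfA F N r i j) = t r i j := by
  simp [affGenHom, TfA]

lemma affGenHom_TbfA (t u : ℕ → Matrix (Fin N) (Fin N) B) (r : ℕ) (i j : Fin N) :
    affGenHom (F := F) t u (TbfA F N r i j) = u r i j := by
  simp [affGenHom, TbfA]

lemma IsAffRep.affGenHom_eq {t u : ℕ → Matrix (Fin N) (Fin N) B} (h : IsAffRep q t u)
    {x y : FreeAlgebra F (AffGen N)} (hxy : AffGlRel F q N x y) :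
    affGenHom t u x = affGenHom t u y := by
  have ht : (fun r => (TfA F N r).map (affGenHom (F := F) t u)) = t := by
    ext r i j; exact affGenHom_TfA t u r i j
  have hu : (fun r => (TbfA F N r).map (affGenHom (F := F) t u)) = u := by
    ext r i j; exact affGenHom_TbfA t u r i j
  rcases hxy with ⟨i, j, hij⟩ | ⟨i, j, hij⟩ | i | i | ⟨a, b, p, r⟩ | ⟨a, b, p, r⟩ | ⟨a, b, p, r⟩
  · rw [affGenHom_TfA, map_zero, h.t_tri i j hij]
  · rw [affGenHom_TbfA, map_zero, h.u_tri i j hij]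
  · rw [map_mul, affGenHom_TfA, affGenHom_TbfA, map_one, h.t_u]
  · rw [map_mul, affGenHom_TfA, affGenHom_TbfA, map_one, h.u_t]
  · have := h.tt a b
    rw [← ht, ← map_affRttL, ← map_affRttR] at this
    exact congrFun₂ this p r
  · have := h.uu a b
    rw [← hu, ← map_affRttL, ← map_affRttR] at this
    exact congrFun₂ this p r
  · have hL := map_affRttL q (affGenHom t u) (TbfA F N) (TfA F N) (a - 1) (-b) a (1 - b)
    have hR := map_affRttR q (affGenHom t u) (TbfA F N) (TfA F N) (a - 1) (-b) a (1 - b)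
    rw [ht, hu] at hL hR
    exact congrFun₂ (hL.trans ((h.ut a b).trans hR.symm)) p r

/-- The homomorphism out of the quantum affine algebra given by a solution of its relations. -/
def IsAffRep.lift {t u : ℕ → Matrix (Fin N) (Fin N) B} (h : IsAffRep q t u) :
    UqAff F q N →ₐ[F] B :=
  RingQuot.liftAlgHom F ⟨affGenHom t u, fun _ _ hxy => h.affGenHom_eq hxy⟩

lemma IsAffRep.lift_tA {t u : ℕ → Matrix (Fin N) (Fin N) B} (h : IsAffRep q t u) (r : ℕ)
    (i j : Fin N) : h.lift (tA F q N r i j) = t r i j := by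
  simp [lift, tA, affGenHom]

lemma IsAffRep.lift_tbA {t u : ℕ → Matrix (Fin N) (Fin N) B} (h : IsAffRep q t u) (r : ℕ)
    (i j : Fin N) : h.lift (tbA F q N r i j) = u r i j := by
  simp [lift, tbA, affGenHom]

lemma IsAffRep.lift_Scoef {t u : ℕ → Matrix (Fin N) (Fin N) B} (h : IsAffRep q t u) (r : ℕ)
    (i j : Fin N) : h.lift (Scoef F q N r i j) = twistedProduct t u r i j := by
  simp [Scoef, twistedProduct, h.lift_tA, h.lift_tbA]

lemma IsAffRep.twistedProduct_zero_of_lt {t u : ℕ → Matrix (Fin N) (Fin N) B}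
    (h : IsAffRep q t u) {i j : Fin N} (hij : i < j) : twistedProduct t u 0 i j = 0 := by
  rw [twistedProduct, Matrix.of_apply]
  refine Finset.sum_eq_zero fun a _ => ?_
  rw [zero_add, Finset.sum_range_one]
  rcases lt_or_ge i a with ha | ha
  · rw [h.t_tri _ _ ha, zero_mul]
  · rw [h.u_tri _ _ (ha.trans_lt hij), mul_zero]

lemma IsAffRep.twistedProduct_zero_self {t u : ℕ → Matrix (Fin N) (Fin N) B}
    (h : IsAffRep q t u) (i : Fin N) : twistedProduct t u 0 i i = 1 := by
  rw [twistedProduct, Matrix.of_apply, Finset.sum_eq_single i]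
  · rw [zero_add, Finset.sum_range_one, h.t_u]
  · intro a _ hai
    rw [zero_add, Finset.sum_range_one]
    rcases lt_or_gt_of_ne hai with ha | ha
    · rw [h.u_tri _ _ ha, mul_zero]
    · rw [h.t_tri _ _ ha, zero_mul]
  · simp

/-- The homomorphism from the presented twisted `q`-Yangian given by `T(x) T̄(x)ᵗ`. -/
def IsAffRep.liftAO {t u : ℕ → Matrix (Fin N) (Fin N) B} (h : IsAffRep q t u) :
    AlgAO F q N →ₐ[F] B :=
  RingQuot.liftAlgHom F ⟨FreeAlgebra.lift F fun x => twistedProduct t u x.1 x.2.1 x.2.2, by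
    set f := FreeAlgebra.lift F fun x : ℕ × Fin N × Fin N => twistedProduct t u x.1 x.2.1 x.2.2
    have hf (r i j) : f (FreeAlgebra.ι F (r, i, j)) = twistedProduct t u r i j := by simp [f]
    have hf' : (fun r => (SfreeA F N r).map f) = twistedProduct t u := by
      ext r i j; exact hf r i j
    rintro x y (⟨i, j, hij⟩ | i | ⟨a, b, p, r⟩)
    · rw [hf, map_zero, h.twistedProduct_zero_of_lt hij]
    · rw [hf, map_one, h.twistedProduct_zero_self]
    · rw [← Matrix.map_apply (f := f), ← Matrix.map_apply (f := f), map_affLHS, map_affRHS,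
        hf', h.affLHS_eq_affRHS]⟩

lemma IsAffRep.liftAO_sAO {t u : ℕ → Matrix (Fin N) (Fin N) B} (h : IsAffRep q t u) (r : ℕ)
    (i j : Fin N) : h.liftAO (sAO F q N r i j) = twistedProduct t u r i j := by
  simp [liftAO, sAO]

variable (F q N) in
lemma sAO_affLHS_eq_affRHS (a b : ℤ) :
    affLHS F q (fun r => Matrix.of (sAO F q N r)) a b =
      affRHS F q (fun r => Matrix.of (sAO F q N r)) a b := by
  have h := map_affLHS q (RingQuot.mkAlgHom F (AORel F q N)) (SfreeA F N) a b
  have h' := map_affRHS q (RingQuot.mkAlgHom F (AORel F q N)) (SfreeA F N) a b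
  refine h.symm.trans (Eq.trans ?_ h')
  ext p r
  exact RingQuot.mkAlgHom_rel F (AORel.refl a b p r)

variable (F q) in
lemma sAO_zero_of_lt {i j : Fin N} (h : i < j) : sAO F q N 0 i j = 0 :=
  (RingQuot.mkAlgHom_rel F (AORel.tri (q := q) i j h)).trans (map_zero _)

variable (F q) in
lemma sAO_zero_self (i : Fin N) : sAO F q N 0 i i = 1 :=
  (RingQuot.mkAlgHom_rel F (AORel.diag (q := q) i)).trans (map_one _)

lemma seriesMul_zero_apply (t t' : ℕ → Matrix (Fin N) (Fin N) B) (i j : Fin N) :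
    seriesMul t t' 0 i j = ∑ a, t 0 i a * t' 0 a j := by
  simp [seriesMul, twistedProduct]

lemma IsAffRep.mul {t u t' u' : ℕ → Matrix (Fin N) (Fin N) B} (h : IsAffRep q t u)
    (h' : IsAffRep q t' u')
    (htt : ∀ r r' i j k l, Commute (t r i j) (t' r' k l))
    (htu : ∀ r r' i j k l, Commute (t r i j) (u' r' k l))
    (hut : ∀ r r' i j k l, Commute (u r i j) (t' r' k l))
    (huu : ∀ r r' i j k l, Commute (u r i j) (u' r' k l)) :
    IsAffRep q (seriesMul t t') (seriesMul u u') := by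
  have hd (i) : seriesMul t t' 0 i i = t 0 i i * t' 0 i i := by
    rw [seriesMul_zero_apply, Finset.sum_eq_single i]
    · intro a _ hai
      rcases lt_or_gt_of_ne hai with ha | ha
      · rw [h'.t_tri _ _ ha, mul_zero]
      · rw [h.t_tri _ _ ha, zero_mul]
    · simp
  have hd' (i) : seriesMul u u' 0 i i = u 0 i i * u' 0 i i := by
    rw [seriesMul_zero_apply, Finset.sum_eq_single i]
    · intro a _ hai
      rcases lt_or_gt_of_ne hai with ha | ha
      · rw [h.u_tri _ _ ha, zero_mul]
      · rw [h'.u_tri _ _ ha, mul_zero]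
    · simp
  refine ⟨h.toIsRtt.mul h'.toIsRtt htt htu hut huu, fun i j hij => ?_, fun i j hij => ?_,
    fun i => ?_, fun i => ?_⟩
  · rw [seriesMul_zero_apply]
    refine Finset.sum_eq_zero fun a _ => ?_
    rcases lt_or_ge i a with ha | ha
    · rw [h.t_tri _ _ ha, zero_mul]
    · rw [h'.t_tri _ _ (ha.trans_lt hij), mul_zero]
  · rw [seriesMul_zero_apply]
    refine Finset.sum_eq_zero fun a _ => ?_
    rcases lt_or_ge a i with ha | ha
    · rw [h.u_tri _ _ ha, zero_mul]
    · rw [h'.u_tri _ _ (hij.trans_le ha), mul_zero]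
  · rw [hd, hd', mul_assoc, ← mul_assoc (t' 0 i i), ← (hut 0 0 i i i i).eq, mul_assoc (u 0 i i),
      h'.t_u, mul_one, h.t_u]
  · rw [hd, hd', mul_assoc, ← mul_assoc (u' 0 i i), ← (htu 0 0 i i i i).eq, mul_assoc (t 0 i i),
      h'.u_t, mul_one, h.u_t]

end Representations

section YangBaxter

variable {F : Type} [Field F] {N : ℕ}

/-- A matrix on `V ⊗ V` acting in the first two factors of `V ⊗ V ⊗ V`. -/
def act12 (M : Matrix (Fin N × Fin N) (Fin N × Fin N) F) (f : Fin N → Fin N → Fin N → F) :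
    Fin N → Fin N → Fin N → F :=
  fun i j k => ∑ s, M (i, j) s * f s.1 s.2 k

/-- A matrix on `V ⊗ V` acting in the outer factors of `V ⊗ V ⊗ V`. -/
def act13 (M : Matrix (Fin N × Fin N) (Fin N × Fin N) F) (f : Fin N → Fin N → Fin N → F) :
    Fin N → Fin N → Fin N → F :=
  fun i j k => ∑ s, M (i, k) s * f s.1 j s.2

/-- A matrix on `V ⊗ V` acting in the last two factors of `V ⊗ V ⊗ V`. -/
def act23 (M : Matrix (Fin N × Fin N) (Fin N × Fin N) F) (f : Fin N → Fin N → Fin N → F) :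
    Fin N → Fin N → Fin N → F :=
  fun i j k => ∑ s, M (j, k) s * f i s.1 s.2

/-- A matrix on `V ⊗ V` viewed as a matrix on the first factor with coefficients in the
endomorphisms of the second one. -/
def blocks (M : Matrix (Fin N × Fin N) (Fin N × Fin N) F) :
    Matrix (Fin N) (Fin N) (Matrix (Fin N) (Fin N) F) :=
  Matrix.of fun i a => Matrix.of fun k l => M (i, k) (a, l)

lemma liftF_mul_amp1_mul_amp2_blocks (M X Y : Matrix (Fin N × Fin N) (Fin N × Fin N) F)
    (p r : Fin N × Fin N) (k m : Fin N) :
    ((liftF F M * amp1 (blocks X) * amp2 (blocks Y) :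
      Matrix _ _ (Matrix (Fin N) (Fin N) F)) p r) k m =
      act12 M (act13 X (act23 Y fun i j k => if i = r.1 ∧ (j, k) = (r.2, m) then 1 else 0))
        p.1 p.2 k := by
  rw [mul_amp1_mul_amp2_apply, Matrix.sum_apply]
  simp only [act12, act13, act23]
  refine Finset.sum_congr rfl fun s _ => ?_
  rw [liftF, Matrix.map_apply, ← Algebra.smul_def, Matrix.smul_apply, smul_eq_mul]
  congr 1
  symm
  rw [Fintype.sum_prod_type, Fintype.sum_eq_single r.1, Matrix.mul_apply]
  · simp [blocks]
  · intro a ha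
    simp [ha]

lemma amp2_mul_amp1_mul_liftF_blocks (M X Y : Matrix (Fin N × Fin N) (Fin N × Fin N) F)
    (p r : Fin N × Fin N) (k m : Fin N) :
    ((amp2 (blocks Y) * amp1 (blocks X) * liftF F M :
      Matrix _ _ (Matrix (Fin N) (Fin N) F)) p r) k m =
      act23 Y (act13 X (act12 M fun i j k => if (i, j) = r ∧ k = m then 1 else 0))
        p.1 p.2 k := by
  rw [amp2_mul_amp1_mul_apply, Matrix.sum_apply]
  simp only [act12, act13, act23]
  simp only [liftF, Matrix.map_apply, Prod.mk.eta, ite_and, mul_ite, mul_one, mul_zero,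
    Finset.sum_ite_eq', Finset.mem_univ, if_true]
  have h (s : Fin N × Fin N) : (blocks Y p.2 s.2 * blocks X p.1 s.1 *
      algebraMap F (Matrix (Fin N) (Fin N) F) (M s r)) k m =
        ∑ n, Y (p.2, k) (s.2, n) * (X (p.1, n) (s.1, m) * M s r) := by
    rw [← Algebra.commutes, ← Algebra.smul_def, Matrix.smul_apply, smul_eq_mul, Matrix.mul_apply,
      Finset.mul_sum]
    refine Finset.sum_congr rfl fun n _ => ?_
    simp only [blocks, Matrix.of_apply]
    ring
  simp only [h, Fintype.sum_prod_type, Finset.mul_sum, Finset.sum_ite_eq',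
    Finset.mem_univ, if_true]
  rw [Finset.sum_comm]
  exact Finset.sum_congr rfl fun _ _ => Finset.sum_comm

/-- The Yang-Baxter relation `M₁₂ X₁₃ Y₂₃ = Y₂₃ X₁₃ M₁₂`. -/
def YangBaxter (M X Y : Matrix (Fin N × Fin N) (Fin N × Fin N) F) : Prop :=
  ∀ f i j k, act12 M (act13 X (act23 Y f)) i j k = act23 Y (act13 X (act12 M f)) i j k

lemma YangBaxter.eq {M X Y : Matrix (Fin N × Fin N) (Fin N × Fin N) F} (h : YangBaxter M X Y) :
    (liftF F M * amp1 (blocks X) * amp2 (blocks Y) :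
      Matrix _ _ (Matrix (Fin N) (Fin N) F)) =
      amp2 (blocks Y) * amp1 (blocks X) * liftF F M := by
  ext p r k m
  rw [liftF_mul_amp1_mul_amp2_blocks, amp2_mul_amp1_mul_liftF_blocks, h]
  simp only [Prod.ext_iff, and_assoc]

variable {q : F}

lemma sum_Rc_mul (q : F) (i j : Fin N) (f : Fin N × Fin N → F) :
    ∑ s, Rc F q N (i, j) s * f s =
      (if i = j then q else 1) * f (i, j) + (if i < j then q - q⁻¹ else 0) * f (j, i) := by
  simp only [Rc, Matrix.of_apply, add_mul, Finset.sum_add_distrib, ite_mul, zero_mul,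
    Finset.sum_ite_eq, Finset.mem_univ, if_true]
  congr 1
  rw [Fintype.sum_eq_single (j, i)]
  · simp
  · rintro ⟨a, b⟩ h
    exact if_neg fun h' => h (Prod.ext h'.2.1.symm h'.1.symm)

lemma sum_Rtil_mul (q : F) (i j : Fin N) (f : Fin N × Fin N → F) :
    ∑ s, Rtil F q N (i, j) s * f s =
      (if i = j then q⁻¹ else 1) * f (i, j) + (if j < i then q⁻¹ - q else 0) * f (j, i) := by
  simp only [Rtil, Matrix.of_apply, add_mul, Finset.sum_add_distrib, ite_mul, zero_mul,
    Finset.sum_ite_eq, Finset.mem_univ, if_true]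
  congr 1
  rw [Fintype.sum_eq_single (j, i)]
  · simp
  · rintro ⟨a, b⟩ h
    exact if_neg fun h' => h (Prod.ext h'.2.1.symm h'.1.symm)

set_option maxHeartbeats 1000000 in
lemma yangBaxter_Rc_Rtil (hq : q ≠ 0) :
    YangBaxter (Rtil F q N) (Rtil F q N) (Rtil F q N) ∧
    YangBaxter (Rtil F q N) (Rtil F q N) (Rc F q N) ∧
    YangBaxter (Rtil F q N) (Rc F q N) (Rc F q N) ∧
    YangBaxter (Rc F q N) (Rtil F q N) (Rtil F q N) ∧
    YangBaxter (Rc F q N) (Rc F q N) (Rtil F q N) ∧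
    YangBaxter (Rc F q N) (Rc F q N) (Rc F q N) := by
  refine ⟨?_, ?_, ?_, ?_, ?_, ?_⟩ <;> intro f i j k <;>
    simp only [act12, act13, act23, sum_Rtil_mul, sum_Rc_mul] <;>
    rcases lt_trichotomy i j with h | h | h <;> rcases lt_trichotomy j k with h' | h' | h' <;>
    rcases lt_trichotomy i k with h'' | h'' | h'' <;>
    first
    | (exfalso; omega)
    | (subst_vars; simp [*, ne_of_lt, ne_of_gt, not_lt_of_gt]; try (field_simp <;> ring))

lemma act_Rtil_Rc_Rtil_sub_swap (hq : q ≠ 0) (f : Fin N → Fin N → Fin N → F) (i j k : Fin N) :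
    act12 (Rtil F q N) (act13 (Rc F q N) (act23 (Rtil F q N) f)) i j k -
      act23 (Rtil F q N) (act13 (Rc F q N) (act12 (Rtil F q N) f)) i j k =
    act12 (Rc F q N) (act13 (Rtil F q N) (act23 (Rc F q N) f)) i j k -
      act23 (Rc F q N) (act13 (Rtil F q N) (act12 (Rc F q N) f)) i j k := by
  simp only [act12, act13, act23, sum_Rtil_mul, sum_Rc_mul]
  rcases lt_trichotomy i j with h | h | h <;> rcases lt_trichotomy j k with h' | h' | h' <;>
    rcases lt_trichotomy i k with h'' | h'' | h'' <;>
    first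
    | (exfalso; omega)
    | (subst_vars; simp [*, ne_of_lt, ne_of_gt, not_lt_of_gt]; try (field_simp <;> ring))

end YangBaxter

section VectorRepresentation

variable {F : Type} [Field F] {N : ℕ}

section Defect

variable {B C : Type} [Ring B] [Algebra F B] [Ring C] [Algebra F C]

lemma amp1_sub (X X' : Matrix (Fin N) (Fin N) B) : amp1 (X - X') = amp1 X - amp1 X' := by
  ext p r
  by_cases h : p.2 = r.2 <;> simp [amp1, h]

lemma amp2_sub (Y Y' : Matrix (Fin N) (Fin N) B) : amp2 (Y - Y') = amp2 Y - amp2 Y' := by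
  ext p r
  by_cases h : p.1 = r.1 <;> simp [amp2, h]

/-- The failure of `M X₁ Y₂ = Y₂ X₁ M`. -/
def rttDefect (M : Matrix (Fin N × Fin N) (Fin N × Fin N) F) (X Y : Matrix (Fin N) (Fin N) B) :
    Matrix (Fin N × Fin N) (Fin N × Fin N) B :=
  liftF F M * amp1 X * amp2 Y - amp2 Y * amp1 X * liftF F M

variable (M : Matrix (Fin N × Fin N) (Fin N × Fin N) F) (X X' Y Y' : Matrix (Fin N) (Fin N) B)

lemma rttDefect_zero_left : rttDefect M 0 Y = 0 := by simp [rttDefect]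

lemma rttDefect_zero_right : rttDefect M X 0 = 0 := by simp [rttDefect]

lemma rttDefect_sub_left : rttDefect M (X - X') Y = rttDefect M X Y - rttDefect M X' Y := by
  simp only [rttDefect, amp1_sub, mul_sub, sub_mul]
  abel

lemma rttDefect_sub_right : rttDefect M X (Y - Y') = rttDefect M X Y - rttDefect M X Y' := by
  simp only [rttDefect, amp2_sub, mul_sub, sub_mul]
  abel

lemma map_rttDefect (f : C →ₗ[F] B) {X Y : Matrix (Fin N) (Fin N) C}
    {X' Y' : Matrix (Fin N) (Fin N) B} (h : ∀ i j k l, f (X i j * Y k l) = X' i j * Y' k l)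
    (h' : ∀ i j k l, f (Y k l * X i j) = Y' k l * X' i j) :
    (rttDefect M X Y).map f = rttDefect M X' Y' := by
  have h₁ := map_mul_amp1_mul_mul_amp2 f h M 1
  have h₂ := map_amp2_mul_mul_amp1_mul f h' M 1
  rw [liftF_one, liftF_one, mul_one, mul_one] at h₁ h₂
  rw [rttDefect, Matrix.map_sub f (map_sub f), h₁, h₂, rttDefect]

lemma affRttL_eq_affRttR_iff (q : F) (t u : ℕ → Matrix (Fin N) (Fin N) B) (a b a' b' : ℤ) :
    affRttL F q t u a b a' b' = affRttR F q t u a b a' b' ↔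
      rttDefect (Rtil F q N) (extZero t a) (extZero u b) =
        rttDefect (Rc F q N) (extZero t a') (extZero u b') := by
  simp only [affRttL, affRttR, rttDefect, z1_eq, z2_eq]
  rw [sub_eq_sub_iff_sub_eq_sub]

end Defect

lemma YangBaxter.rttDefect_eq_zero {M X Y : Matrix (Fin N × Fin N) (Fin N × Fin N) F}
    (h : YangBaxter M X Y) : rttDefect M (blocks X) (blocks Y) = 0 :=
  sub_eq_zero.2 h.eq

lemma rttDefect_Rtil_Rc_Rtil {q : F} (hq : q ≠ 0) :
    rttDefect (Rtil F q N) (blocks (Rc F q N)) (blocks (Rtil F q N)) =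
      rttDefect (Rc F q N) (blocks (Rtil F q N)) (blocks (Rc F q N)) := by
  ext p r k m
  simp only [rttDefect, Matrix.sub_apply]
  simp only [liftF_mul_amp1_mul_amp2_blocks, amp2_mul_amp1_mul_liftF_blocks]
  have h := act_Rtil_Rc_Rtil_sub_swap (N := N) hq
    (fun i j k => if i = r.1 ∧ (j, k) = (r.2, m) then 1 else 0) p.1 p.2 k
  simpa only [Prod.ext_iff, and_assoc] using h

/-- The sequence `x, y, y, y, …`. -/
def constTail {V : Type} (x y : V) (r : ℕ) : V := if r = 0 then x else y

lemma extZero_constTail_cases {B : Type} [Ring B] (x y : Matrix (Fin N) (Fin N) B) (m : ℤ) :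
    (extZero (constTail x y) m = 0 ∧ extZero (constTail x y) (m - 1) = 0) ∨
    (extZero (constTail x y) m = x ∧ extZero (constTail x y) (m - 1) = 0) ∨
    (extZero (constTail x y) m = y ∧ extZero (constTail x y) (m - 1) = x) ∨
    (extZero (constTail x y) m = y ∧ extZero (constTail x y) (m - 1) = y) := by
  simp only [extZero, constTail, Int.toNat_eq_zero]
  rcases lt_or_ge m 0 with h | h
  · left
    rw [if_neg (by omega), if_neg (by omega)]
    simp
  rcases eq_or_lt_of_le h with rfl | h
  · simp
  rcases eq_or_ne m 1 with rfl | h'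
  · simp
  · right; right; right
    simp [show 0 ≤ m by omega, show ¬m ≤ 0 by omega, show 1 ≤ m by omega, show ¬m ≤ 1 by omega]

variable (q : F) (N)

/-- The coefficients of `T(x)` in the vector representation. -/
def vecT : ℕ → Matrix (Fin N) (Fin N) (Matrix (Fin N) (Fin N) F) :=
  constTail (blocks (Rtil F q N)) (blocks (Rtil F q N) - blocks (Rc F q N))

/-- The coefficients of `T̄(x)` in the vector representation. -/
def vecU : ℕ → Matrix (Fin N) (Fin N) (Matrix (Fin N) (Fin N) F) :=
  constTail (blocks (Rc F q N)) (blocks (Rc F q N) - blocks (Rtil F q N))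

variable {q} {N}

lemma rttDefect_vecT_vecT (hq : q ≠ 0) (m n : ℤ) :
    rttDefect (Rtil F q N) (extZero (vecT N q) m) (extZero (vecT N q) (n - 1)) =
      rttDefect (Rc F q N) (extZero (vecT N q) (m - 1)) (extZero (vecT N q) n) := by
  obtain ⟨h₁, h₂, h₃, h₄, h₅, h₆⟩ := yangBaxter_Rc_Rtil (N := N) hq
  rcases extZero_constTail_cases (blocks (Rtil F q N)) (blocks (Rtil F q N) - blocks (Rc F q N)) m
    with ⟨e, e'⟩ | ⟨e, e'⟩ | ⟨e, e'⟩ | ⟨e, e'⟩ <;>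
  rcases extZero_constTail_cases (blocks (Rtil F q N)) (blocks (Rtil F q N) - blocks (Rc F q N)) n
    with ⟨f, f'⟩ | ⟨f, f'⟩ | ⟨f, f'⟩ | ⟨f, f'⟩ <;>
  simp [vecT, e, e', f, f', rttDefect_zero_left, rttDefect_zero_right, rttDefect_sub_left,
    rttDefect_sub_right, h₁.rttDefect_eq_zero, h₂.rttDefect_eq_zero, h₃.rttDefect_eq_zero,
    h₄.rttDefect_eq_zero, h₅.rttDefect_eq_zero, h₆.rttDefect_eq_zero, rttDefect_Rtil_Rc_Rtil hq]

lemma rttDefect_vecU_vecU (hq : q ≠ 0) (m n : ℤ) :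
    rttDefect (Rtil F q N) (extZero (vecU N q) (m - 1)) (extZero (vecU N q) n) =
      rttDefect (Rc F q N) (extZero (vecU N q) m) (extZero (vecU N q) (n - 1)) := by
  obtain ⟨h₁, h₂, h₃, h₄, h₅, h₆⟩ := yangBaxter_Rc_Rtil (N := N) hq
  rcases extZero_constTail_cases (blocks (Rc F q N)) (blocks (Rc F q N) - blocks (Rtil F q N)) m
    with ⟨e, e'⟩ | ⟨e, e'⟩ | ⟨e, e'⟩ | ⟨e, e'⟩ <;>
  rcases extZero_constTail_cases (blocks (Rc F q N)) (blocks (Rc F q N) - blocks (Rtil F q N)) n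
    with ⟨f, f'⟩ | ⟨f, f'⟩ | ⟨f, f'⟩ | ⟨f, f'⟩ <;>
  simp [vecU, e, e', f, f', rttDefect_zero_left, rttDefect_zero_right, rttDefect_sub_left,
    rttDefect_sub_right, h₁.rttDefect_eq_zero, h₂.rttDefect_eq_zero, h₃.rttDefect_eq_zero,
    h₄.rttDefect_eq_zero, h₅.rttDefect_eq_zero, h₆.rttDefect_eq_zero, rttDefect_Rtil_Rc_Rtil hq]

lemma rttDefect_vecU_vecT (hq : q ≠ 0) (m n : ℤ) :
    rttDefect (Rtil F q N) (extZero (vecU N q) (m - 1)) (extZero (vecT N q) (n - 1)) =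
      rttDefect (Rc F q N) (extZero (vecU N q) m) (extZero (vecT N q) n) := by
  obtain ⟨h₁, h₂, h₃, h₄, h₅, h₆⟩ := yangBaxter_Rc_Rtil (N := N) hq
  rcases extZero_constTail_cases (blocks (Rc F q N)) (blocks (Rc F q N) - blocks (Rtil F q N)) m
    with ⟨e, e'⟩ | ⟨e, e'⟩ | ⟨e, e'⟩ | ⟨e, e'⟩ <;>
  rcases extZero_constTail_cases (blocks (Rtil F q N)) (blocks (Rtil F q N) - blocks (Rc F q N)) n
    with ⟨f, f'⟩ | ⟨f, f'⟩ | ⟨f, f'⟩ | ⟨f, f'⟩ <;>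
  simp [vecT, vecU, e, e', f, f', rttDefect_zero_left, rttDefect_zero_right, rttDefect_sub_left,
    rttDefect_sub_right, h₁.rttDefect_eq_zero, h₂.rttDefect_eq_zero, h₃.rttDefect_eq_zero,
    h₄.rttDefect_eq_zero, h₅.rttDefect_eq_zero, h₆.rttDefect_eq_zero, rttDefect_Rtil_Rc_Rtil hq]

variable (F N) in
/-- Laurent polynomials with matrix coefficients. -/
abbrev LoopMat : Type := AddMonoidAlgebra (Matrix (Fin N) (Fin N) F) ℤ

lemma rttDefect_map_single (M : Matrix (Fin N × Fin N) (Fin N × Fin N) F)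
    (X Y : Matrix (Fin N) (Fin N) (Matrix (Fin N) (Fin N) F)) (m n : ℤ) :
    rttDefect M (X.map fun x => (AddMonoidAlgebra.single m x : LoopMat F N))
        (Y.map fun x => (AddMonoidAlgebra.single n x : LoopMat F N)) =
      (rttDefect M X Y).map fun x => (AddMonoidAlgebra.single (m + n) x : LoopMat F N) := by
  refine (map_rttDefect (C := Matrix (Fin N) (Fin N) F) (B := LoopMat F N) M
    (AddMonoidAlgebra.lsingle (R := F) (m + n)) ?_ ?_).symm <;>
  · intro i j k l
    simp only [Matrix.map_apply, AddMonoidAlgebra.lsingle_apply,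
      AddMonoidAlgebra.single_mul_single, add_comm n m]

variable (N q)

/-- The coefficients of `T(x)` in the evaluation representation with a formal parameter. -/
def loopT (r : ℕ) : Matrix (Fin N) (Fin N) (LoopMat F N) :=
  (vecT N q r).map fun x => AddMonoidAlgebra.single (r : ℤ) x

/-- The coefficients of `T̄(x)` in the evaluation representation with a formal parameter. -/
def loopU (r : ℕ) : Matrix (Fin N) (Fin N) (LoopMat F N) :=
  (vecU N q r).map fun x => AddMonoidAlgebra.single (-r : ℤ) x

lemma extZero_loopT (m : ℤ) : extZero (loopT N q) m =
    (extZero (vecT N q) m).map fun x => AddMonoidAlgebra.single m x := by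
  rcases lt_or_ge m 0 with h | h
  · rw [extZero, extZero, if_neg (by omega), if_neg (by omega)]
    ext; simp
  · rw [extZero, extZero, if_pos h, if_pos h, loopT, Int.toNat_of_nonneg h]

lemma extZero_loopU (m : ℤ) : extZero (loopU N q) m =
    (extZero (vecU N q) m).map fun x => AddMonoidAlgebra.single (-m) x := by
  rcases lt_or_ge m 0 with h | h
  · rw [extZero, extZero, if_neg (by omega), if_neg (by omega)]
    ext; simp
  · rw [extZero, extZero, if_pos h, if_pos h, loopU, Int.toNat_of_nonneg h]

lemma isRtt_loopT_loopU (hq : q ≠ 0) : IsRtt q (loopT N q) (loopU N q) where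
  tt a b := by
    have h := rttDefect_vecT_vecT (N := N) hq (1 - a) (1 - b)
    rw [show 1 - a - 1 = -a by ring, show 1 - b - 1 = -b by ring] at h
    rw [affRttL_eq_affRttR_iff, extZero_loopT, extZero_loopT, extZero_loopT, extZero_loopT,
      rttDefect_map_single, rttDefect_map_single, h, show 1 - a + -b = -a + (1 - b) by ring]
  uu a b := by
    rw [affRttL_eq_affRttR_iff, extZero_loopU, extZero_loopU, extZero_loopU, extZero_loopU,
      rttDefect_map_single, rttDefect_map_single, rttDefect_vecU_vecU hq,
      show -(a - 1) + -b = -a + -(b - 1) by ring]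
  ut a b := by
    have h := rttDefect_vecU_vecT (N := N) hq a (1 - b)
    rw [show 1 - b - 1 = -b by ring] at h
    rw [affRttL_eq_affRttR_iff, extZero_loopU, extZero_loopU, extZero_loopT, extZero_loopT,
      rttDefect_map_single, rttDefect_map_single, h, show -(a - 1) + -b = -a + (1 - b) by ring]

end VectorRepresentation

section FirstOrder

variable {A R : Type} [CommRing A] [Ring R] [Algebra A R]

/-- `x` is congruent to `1 + h y` modulo `h ^ 2` over the subalgebra `L`. -/
def FirstOrder (L : Subalgebra A R) (h : A) (x y : R) : Prop :=
  y ∈ L ∧ ∃ z ∈ L, x = 1 + h • (y + h • z)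

variable {L : Subalgebra A R} {h : A}

lemma FirstOrder.one : FirstOrder L h 1 0 := ⟨zero_mem _, 0, zero_mem _, by simp⟩

lemma FirstOrder.mul {x y x' y' : R} (H : FirstOrder L h x y) (H' : FirstOrder L h x' y') :
    FirstOrder L h (x * x') (y + y') := by
  obtain ⟨hy, z, hz, rfl⟩ := H
  obtain ⟨hy', z', hz', rfl⟩ := H'
  refine ⟨add_mem hy hy', z + z' + (y + h • z) * (y' + h • z'),
    add_mem (add_mem hz hz') (mul_mem (add_mem hy (L.smul_mem hz h))
      (add_mem hy' (L.smul_mem hz' h))), ?_⟩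
  rw [add_mul, one_mul, mul_add, mul_one, smul_mul_smul_comm]
  generalize (y + h • z) * (y' + h • z') = w
  module

lemma exists_list_prod_eq_add_smul {I : Type} {x y : I → R} (hy : ∀ i, y i ∈ L)
    (hx : ∀ i, ∃ z ∈ L, x i = y i + h • z) (l : List I) :
    ∃ z ∈ L, (l.map x).prod = (l.map y).prod + h • z := by
  induction l with
  | nil => exact ⟨0, zero_mem _, by simp⟩
  | cons i l ih =>
    obtain ⟨z, hz, e⟩ := ih
    obtain ⟨w, hw, e'⟩ := hx i
    have hl : (l.map y).prod ∈ L := list_prod_mem fun _ hj => by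
      obtain ⟨j, -, rfl⟩ := List.mem_map.1 hj
      exact hy j
    refine ⟨y i * z + w * ((l.map y).prod + h • z), add_mem (mul_mem (hy i) hz)
      (mul_mem hw (add_mem hl (L.smul_mem hz h))), ?_⟩
    rw [List.map_cons, List.prod_cons, List.map_cons, List.prod_cons, e, e', add_mul, mul_add,
      smul_mul_assoc, mul_smul_comm, smul_add, add_assoc]

end FirstOrder

section Series

variable {A B C : Type} [CommRing A] [Ring B] [Algebra A B] [Ring C] [Algebra A C] {N : ℕ}

lemma mk_seriesMul (t t' : ℕ → Matrix (Fin N) (Fin N) B) :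
    PowerSeries.mk (seriesMul t t') = PowerSeries.mk t * PowerSeries.mk t' := by
  ext r i j
  rw [PowerSeries.coeff_mul, PowerSeries.coeff_mk,
    Finset.Nat.sum_antidiagonal_eq_sum_range_succ_mk, Matrix.sum_apply]
  simp only [seriesMul, twistedProduct, Matrix.of_apply, Matrix.transpose_apply,
    PowerSeries.coeff_mk, Matrix.mul_apply]
  exact Finset.sum_comm

/-- Matrix power series with coefficients in a subalgebra. -/
def seriesSubalgebra (N : ℕ) (L : Subalgebra A B) :
    Subalgebra A (PowerSeries (Matrix (Fin N) (Fin N) B)) where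
  carrier := {f | ∀ r i j, PowerSeries.coeff r f i j ∈ L}
  mul_mem' := by
    intro f g hf hg r i j
    rw [PowerSeries.coeff_mul, Matrix.sum_apply]
    refine sum_mem fun p _ => ?_
    rw [Matrix.mul_apply]
    exact sum_mem fun a _ => mul_mem (hf _ _ _) (hg _ _ _)
  add_mem' := by
    intro f g hf hg r i j
    rw [map_add, Matrix.add_apply]
    exact add_mem (hf _ _ _) (hg _ _ _)
  algebraMap_mem' := by
    intro a r i j
    rw [Algebra.algebraMap_eq_smul_one, PowerSeries.coeff_smul, PowerSeries.coeff_one]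
    split_ifs
    · rw [Matrix.smul_apply, Matrix.one_apply]
      split_ifs
      · exact L.smul_mem (one_mem _) a
      · simp
    · simp

/-- Entrywise form of `FirstOrder` for matrix series. -/
lemma firstOrder_mk_iff {L : Subalgebra A B} {h : A} {t τ : ℕ → Matrix (Fin N) (Fin N) B} :
    FirstOrder (seriesSubalgebra N L) h (PowerSeries.mk t) (PowerSeries.mk τ) ↔
      ∀ r i j, τ r i j ∈ L ∧ ∃ z ∈ L,
        t r i j = (if r = 0 then 1 else 0 : Matrix (Fin N) (Fin N) B) i j +
          h • (τ r i j + h • z) := by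
  constructor
  · rintro ⟨hτ, z, hz, e⟩ r i j
    refine ⟨by simpa using hτ r i j, _, hz r i j, ?_⟩
    have e' := congrArg (PowerSeries.coeff r) e
    rw [map_add, PowerSeries.coeff_smul, map_add, PowerSeries.coeff_smul,
      PowerSeries.coeff_mk, PowerSeries.coeff_mk, PowerSeries.coeff_one] at e'
    exact congrFun₂ e' i j
  · intro H
    choose hτ z hz e using H
    refine ⟨fun r i j => by simpa using hτ r i j, PowerSeries.mk fun r => Matrix.of (z r),
      fun r i j => by simpa using hz r i j, ?_⟩
    ext r i j
    rw [map_add, PowerSeries.coeff_smul, map_add, PowerSeries.coeff_smul,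
      PowerSeries.coeff_mk, PowerSeries.coeff_mk, PowerSeries.coeff_one, PowerSeries.coeff_mk]
    exact e r i j

lemma FirstOrder.map_series {L : Subalgebra A B} {L' : Subalgebra A C} {h : A}
    {t τ : ℕ → Matrix (Fin N) (Fin N) B}
    (H : FirstOrder (seriesSubalgebra N L) h (PowerSeries.mk t) (PowerSeries.mk τ))
    (f : B →ₐ[A] C) (hf : ∀ x ∈ L, f x ∈ L') :
    FirstOrder (seriesSubalgebra N L') h (PowerSeries.mk fun r => (t r).map f)
      (PowerSeries.mk fun r => (τ r).map f) := by
  rw [firstOrder_mk_iff] at H ⊢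
  intro r i j
  obtain ⟨hτ, z, hz, e⟩ := H r i j
  refine ⟨hf _ hτ, f z, hf _ hz, ?_⟩
  rw [Matrix.map_apply, Matrix.map_apply, e, map_add, map_smul, map_add, map_smul]
  congr 1
  split_ifs
  · rw [Matrix.one_apply, Matrix.one_apply]
    split_ifs <;> simp
  · simp

lemma FirstOrder.transpose_series {L : Subalgebra A B} {h : A}
    {t τ : ℕ → Matrix (Fin N) (Fin N) B}
    (H : FirstOrder (seriesSubalgebra N L) h (PowerSeries.mk t) (PowerSeries.mk τ)) :
    FirstOrder (seriesSubalgebra N L) h (PowerSeries.mk fun r => (t r).transpose)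
      (PowerSeries.mk fun r => (τ r).transpose) := by
  rw [firstOrder_mk_iff] at H ⊢
  intro r i j
  obtain ⟨hτ, z, hz, e⟩ := H r j i
  refine ⟨hτ, z, hz, ?_⟩
  rw [Matrix.transpose_apply, Matrix.transpose_apply, e]
  congr 1
  split_ifs
  · simp [Matrix.one_apply, eq_comm]
  · simp

lemma FirstOrder.twistedProduct {L : Subalgebra A B} {h : A}
    {t u τ υ : ℕ → Matrix (Fin N) (Fin N) B}
    (H : FirstOrder (seriesSubalgebra N L) h (PowerSeries.mk t) (PowerSeries.mk τ))
    (H' : FirstOrder (seriesSubalgebra N L) h (PowerSeries.mk u) (PowerSeries.mk υ)) :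
    FirstOrder (seriesSubalgebra N L) h (PowerSeries.mk (twistedProduct t u))
      (PowerSeries.mk fun r => τ r + (υ r).transpose) := by
  have e : _root_.twistedProduct t u = seriesMul t fun r => (u r).transpose := by
    simp [seriesMul]
  rw [e, mk_seriesMul]
  exact H.mul H'.transpose_series

end Series

section LoopRepresentation

variable {F : Type} [Field F] {N : ℕ} {q : F}

lemma blocks_Rtil_of_lt {i j : Fin N} (h : i < j) : blocks (Rtil F q N) i j = 0 := by
  ext k l
  simp only [blocks, Rtil, Matrix.of_apply, Prod.mk.injEq, Matrix.zero_apply]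
  rw [if_neg (fun h' => h.ne h'.1), if_neg (fun h' => absurd h'.2.2 (by omega)), add_zero]

lemma blocks_Rtil_self (i : Fin N) :
    blocks (Rtil F q N) i i = 1 + (q⁻¹ - 1) • Matrix.single i i 1 := by
  ext k l
  simp only [blocks, Rtil, Matrix.of_apply, Prod.mk.injEq, Matrix.add_apply, Matrix.smul_apply,
    Matrix.single_apply, Matrix.one_apply]
  by_cases h : k = l <;> by_cases h' : i = k <;> by_cases h'' : i = l <;> simp_all

lemma blocks_Rtil_of_gt {i j : Fin N} (h : j < i) :
    blocks (Rtil F q N) i j = (q⁻¹ - q) • Matrix.single j i 1 := by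
  ext k l
  simp only [blocks, Rtil, Matrix.of_apply, Prod.mk.injEq, Matrix.smul_apply, Matrix.single_apply]
  rw [if_neg (fun h' => h.ne' h'.1)]
  by_cases h' : i = l <;> by_cases h'' : k = j <;> simp_all [eq_comm]

lemma blocks_Rc_of_gt {i j : Fin N} (h : j < i) : blocks (Rc F q N) i j = 0 := by
  ext k l
  simp only [blocks, Rc, Matrix.of_apply, Prod.mk.injEq, Matrix.zero_apply]
  rw [if_neg (fun h' => h.ne' h'.1), if_neg (fun h' => absurd h'.2.2 (by omega)), add_zero]

lemma blocks_Rc_self (i : Fin N) :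
    blocks (Rc F q N) i i = 1 + (q - 1) • Matrix.single i i 1 := by
  ext k l
  simp only [blocks, Rc, Matrix.of_apply, Prod.mk.injEq, Matrix.add_apply, Matrix.smul_apply,
    Matrix.single_apply, Matrix.one_apply]
  by_cases h : k = l <;> by_cases h' : i = k <;> by_cases h'' : i = l <;> simp_all

lemma blocks_Rc_of_lt {i j : Fin N} (h : i < j) :
    blocks (Rc F q N) i j = (q - q⁻¹) • Matrix.single j i 1 := by
  ext k l
  simp only [blocks, Rc, Matrix.of_apply, Prod.mk.injEq, Matrix.smul_apply, Matrix.single_apply]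
  rw [if_neg (fun h' => h.ne h'.1)]
  by_cases h' : i = l <;> by_cases h'' : k = j <;> simp_all [eq_comm]

lemma blocks_Rtil_sub_blocks_Rc (i j : Fin N) :
    (blocks (Rtil F q N) - blocks (Rc F q N)) i j = (q⁻¹ - q) • Matrix.single j i 1 := by
  rw [Matrix.sub_apply]
  rcases lt_trichotomy i j with h | rfl | h
  · rw [blocks_Rtil_of_lt h, blocks_Rc_of_lt h, zero_sub, ← neg_smul, neg_sub]
  · rw [blocks_Rtil_self, blocks_Rc_self]
    module
  · rw [blocks_Rtil_of_gt h, blocks_Rc_of_gt h, sub_zero]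

lemma isAffRep_loopT_loopU (hq : q ≠ 0) : IsAffRep q (loopT N q) (loopU N q) where
  toIsRtt := isRtt_loopT_loopU N q hq
  t_tri i j h := by simp [loopT, vecT, constTail, blocks_Rtil_of_lt h]
  u_tri i j h := by simp [loopU, vecU, constTail, blocks_Rc_of_gt h]
  t_u i := by
    have h : blocks (Rtil F q N) i i * blocks (Rc F q N) i i = 1 := by
      rw [blocks_Rtil_self, blocks_Rc_self, add_mul, one_mul, mul_add, mul_one,
        smul_mul_smul_comm, Matrix.single_mul_single_same, mul_one, add_assoc, ← add_smul,
        ← add_smul, add_eq_left]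
      convert zero_smul F _
      field_simp
      ring
    simp only [loopT, loopU, vecT, vecU, constTail, if_true, Matrix.map_apply,
      AddMonoidAlgebra.single_mul_single, h]
    rfl
  u_t i := by
    have h : blocks (Rc F q N) i i * blocks (Rtil F q N) i i = 1 := by
      rw [blocks_Rtil_self, blocks_Rc_self, add_mul, one_mul, mul_add, mul_one,
        smul_mul_smul_comm, Matrix.single_mul_single_same, mul_one, add_assoc, ← add_smul,
        ← add_smul, add_eq_left]
      convert zero_smul F _
      field_simp
      ring
    simp only [loopT, loopU, vecT, vecU, constTail, if_true, Matrix.map_apply,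
      AddMonoidAlgebra.single_mul_single, h]
    rfl

variable (F N) in
/-- Zero, one and the products of a matrix unit and a power of the formal parameter. -/
def loopUnits : Submonoid (LoopMat F N) where
  carrier := {x | x = 0 ∨ x = 1 ∨
    ∃ n i j, x = AddMonoidAlgebra.single n (Matrix.single i j 1)}
  one_mem' := Or.inr (Or.inl rfl)
  mul_mem' := by
    rintro x y (rfl | rfl | ⟨n, i, j, rfl⟩) hy
    · exact Or.inl (zero_mul y)
    · rwa [one_mul]
    · obtain (rfl | rfl | ⟨m, k, l, rfl⟩) := hy
      · exact Or.inl (mul_zero _)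
      · exact Or.inr (Or.inr ⟨n, i, j, mul_one _⟩)
      · rw [AddMonoidAlgebra.single_mul_single]
        by_cases h : j = k
        · subst h
          exact Or.inr (Or.inr ⟨n + m, i, l, by rw [Matrix.single_mul_single_same, one_mul]⟩)
        · exact Or.inl (by
            rw [Matrix.single_mul_single_of_ne _ _ _ _ h, AddMonoidAlgebra.single_zero])

variable (F) in
/-- `E_ij z ^ n`. -/
def loopUnit (n : ℤ) (i j : Fin N) : LoopMat F N :=
  AddMonoidAlgebra.single n (Matrix.single i j 1)

lemma loopUnit_mem (n : ℤ) (i j : Fin N) : loopUnit F n i j ∈ loopUnits F N :=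
  Or.inr (Or.inr ⟨n, i, j, rfl⟩)

lemma single_smul_single_eq_smul_loopUnit (c : F) (n : ℤ) (i j : Fin N) :
    (AddMonoidAlgebra.single n (c • Matrix.single i j (1 : F)) : LoopMat F N) =
      c • loopUnit F n i j :=
  (AddMonoidAlgebra.smul_single _ _ _).symm

variable (F) in
/-- The coefficient of `E_ij z ^ n`. -/
def loopCoeff (n : ℤ) (i j : Fin N) : LoopMat F N →ₗ[F] F where
  toFun x := x.coeff n i j
  map_add' _ _ := rfl
  map_smul' _ _ := rfl

lemma loopCoeff_loopUnit (n m : ℤ) (i j k l : Fin N) :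
    loopCoeff F n i j (loopUnit F m k l) = if m = n ∧ k = i ∧ l = j then 1 else 0 := by
  change (AddMonoidAlgebra.single m (Matrix.single k l (1 : F))).coeff n i j = _
  rw [AddMonoidAlgebra.coeff_single, Finsupp.single_apply]
  by_cases h : m = n
  · rw [if_pos h, Matrix.single_apply]
    simp only [h, true_and]
  · rw [if_neg h, if_neg (fun h' => h h'.1), Matrix.zero_apply]

lemma loopCoeff_one (n : ℤ) (i j : Fin N) :
    loopCoeff F n i j 1 = if n = 0 ∧ i = j then 1 else 0 := by
  change (AddMonoidAlgebra.single 0 (1 : Matrix (Fin N) (Fin N) F)).coeff n i j = _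
  rw [AddMonoidAlgebra.coeff_single, Finsupp.single_apply]
  by_cases h : n = 0
  · rw [if_pos h.symm, Matrix.one_apply]
    simp only [h, true_and]
  · rw [if_neg (fun h' => h h'.symm), if_neg (fun h' => h h'.1), Matrix.zero_apply]

lemma loopCoeff_of_mem (n : ℤ) (i j : Fin N) {x : LoopMat F N} (hx : x ∈ loopUnits F N) :
    loopCoeff F n i j x = 0 ∨ loopCoeff F n i j x = 1 := by
  obtain rfl | rfl | ⟨m, k, l, rfl⟩ := hx
  · exact Or.inl (map_zero _)
  · rw [loopCoeff_one]
    split_ifs <;> simp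
  · change loopCoeff F n i j (loopUnit F m k l) = 0 ∨ loopCoeff F n i j (loopUnit F m k l) = 1
    rw [loopCoeff_loopUnit]
    split_ifs <;> simp

variable (A : Type) [CommRing A] [Algebra A F]

/-- The linear term of `T(x)` in the evaluation representation. -/
def loopTau (κ : A) (r : ℕ) : Matrix (Fin N) (Fin N) (LoopMat F N) :=
  Matrix.of fun i j => if r = 0 ∧ i = j then κ • loopUnit F 0 i i else
    if r = 0 ∧ i < j then 0 else -loopUnit F r j i

/-- The linear term of `T̄(x)` in the evaluation representation. -/
def loopUpsilon (κ : A) (r : ℕ) : Matrix (Fin N) (Fin N) (LoopMat F N) :=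
  Matrix.of fun i j => if r = 0 ∧ i = j then κ • loopUnit F 0 i i else
    if r = 0 ∧ j < i then 0 else loopUnit F (-r) j i

lemma loopTau_mem (κ : A) (r : ℕ) (i j : Fin N) :
    loopTau (F := F) A κ r i j ∈ Algebra.adjoin A (loopUnits F N : Set (LoopMat F N)) := by
  have hu (n i j) : loopUnit F n i j ∈ Algebra.adjoin A (loopUnits F N : Set (LoopMat F N)) :=
    Algebra.subset_adjoin (loopUnit_mem n i j)
  rw [loopTau, Matrix.of_apply]
  split_ifs
  · exact Subalgebra.smul_mem _ (hu _ _ _) _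
  · exact zero_mem _
  · exact neg_mem (hu _ _ _)

lemma loopUpsilon_mem (κ : A) (r : ℕ) (i j : Fin N) :
    loopUpsilon (F := F) A κ r i j ∈ Algebra.adjoin A (loopUnits F N : Set (LoopMat F N)) := by
  have hu (n i j) : loopUnit F n i j ∈ Algebra.adjoin A (loopUnits F N : Set (LoopMat F N)) :=
    Algebra.subset_adjoin (loopUnit_mem n i j)
  rw [loopUpsilon, Matrix.of_apply]
  split_ifs
  · exact Subalgebra.smul_mem _ (hu _ _ _) _
  · exact zero_mem _
  · exact hu _ _ _

lemma loopTau_add_loopUpsilon (κ κ' : A) {r : ℕ} {i j : Fin N} (hb : r ≠ 0 ∨ j < i) :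
    loopTau (F := F) A κ r i j + loopUpsilon A κ' r j i =
      loopUnit F (-r) i j - loopUnit F r j i := by
  rw [loopTau, loopUpsilon, Matrix.of_apply, Matrix.of_apply, if_neg, if_neg, if_neg, if_neg]
  · abel
  all_goals
    rintro ⟨h, h'⟩
    rcases hb with hb | hb <;> omega

lemma loopCoeff_loopTau_add_loopUpsilon (κ κ' : A) {r s : ℕ} {i j k l : Fin N}
    (ha : r ≠ 0 ∨ j < i) (hb : s ≠ 0 ∨ l < k) :
    loopCoeff F (-r) i j (loopTau A κ s k l + loopUpsilon A κ' s l k) =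
      if (r, i, j) = (s, k, l) then 1 else 0 := by
  rw [loopTau_add_loopUpsilon A κ κ' hb, map_sub, loopCoeff_loopUnit, loopCoeff_loopUnit,
    if_neg (c := (s : ℤ) = -r ∧ _), sub_zero]
  · simp only [Prod.mk.injEq]
    congr 1
    exact propext ⟨fun h => ⟨by omega, h.2.1.symm, h.2.2.symm⟩,
      fun h => ⟨by omega, h.2.1.symm, h.2.2.symm⟩⟩
  · rintro ⟨h, rfl, rfl⟩
    rcases ha with ha | ha <;> rcases hb with hb | hb <;> omega

lemma loopCoeff_neg_one {r : ℕ} {i j : Fin N} (ha : r ≠ 0 ∨ j < i) :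
    loopCoeff F (-r) i j 1 = 0 := by
  rw [loopCoeff_one, if_neg]
  rintro ⟨h, rfl⟩
  rcases ha with ha | ha
  · omega
  · exact lt_irrefl _ ha

variable {A} {h κ κ' : A}

lemma firstOrder_loopT (hh : algebraMap A F h = q - q⁻¹)
    (hκ' : algebraMap A F (h * κ') = q⁻¹ - 1) :
    FirstOrder (seriesSubalgebra N (Algebra.adjoin A (loopUnits F N : Set (LoopMat F N)))) h
      (PowerSeries.mk (loopT N q)) (PowerSeries.mk (loopTau A κ')) := by
  rw [firstOrder_mk_iff]
  intro r i j
  refine ⟨loopTau_mem A κ' r i j, 0, zero_mem _, ?_⟩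
  rw [smul_zero, add_zero, loopTau, Matrix.of_apply, loopT, Matrix.map_apply, vecT, constTail]
  by_cases hr : r = 0
  · subst hr
    rw [if_pos rfl, if_pos rfl]
    rcases lt_trichotomy i j with hij | rfl | hij
    · rw [blocks_Rtil_of_lt hij, if_neg (fun h' => hij.ne h'.2), if_pos ⟨rfl, hij⟩,
        Matrix.one_apply_ne hij.ne, smul_zero, add_zero, AddMonoidAlgebra.single_zero]
    · rw [blocks_Rtil_self, if_pos ⟨rfl, rfl⟩, Matrix.one_apply_eq, smul_smul,
        ← algebraMap_smul F (h * κ'), hκ', Nat.cast_zero,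
        AddMonoidAlgebra.single_add, single_smul_single_eq_smul_loopUnit]
      rfl
    · rw [blocks_Rtil_of_gt hij, if_neg (fun h' => hij.ne' h'.2),
        if_neg (fun h' => absurd h'.2 (by omega)),
        Matrix.one_apply_ne hij.ne', zero_add, smul_neg, ← algebraMap_smul F h, hh,
        ← neg_smul, neg_sub, single_smul_single_eq_smul_loopUnit]
  · rw [if_neg hr, if_neg hr, if_neg (fun h' => hr h'.1), if_neg (fun h' => hr h'.1),
      blocks_Rtil_sub_blocks_Rc, Matrix.zero_apply, zero_add, smul_neg, ← algebraMap_smul F h, hh,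
      ← neg_smul, neg_sub, single_smul_single_eq_smul_loopUnit]

lemma firstOrder_loopU (hh : algebraMap A F h = q - q⁻¹)
    (hκ : algebraMap A F (h * κ) = q - 1) :
    FirstOrder (seriesSubalgebra N (Algebra.adjoin A (loopUnits F N : Set (LoopMat F N)))) h
      (PowerSeries.mk (loopU N q)) (PowerSeries.mk (loopUpsilon A κ)) := by
  rw [firstOrder_mk_iff]
  intro r i j
  refine ⟨loopUpsilon_mem A κ r i j, 0, zero_mem _, ?_⟩
  rw [smul_zero, add_zero, loopUpsilon, Matrix.of_apply, loopU, Matrix.map_apply, vecU, constTail]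
  by_cases hr : r = 0
  · subst hr
    rw [if_pos rfl, if_pos rfl]
    rcases lt_trichotomy i j with hij | rfl | hij
    · rw [blocks_Rc_of_lt hij, if_neg (fun h' => hij.ne h'.2),
        if_neg (fun h' => absurd h'.2 (by omega)),
        Matrix.one_apply_ne hij.ne, zero_add, ← algebraMap_smul F h, hh,
        single_smul_single_eq_smul_loopUnit]
    · rw [blocks_Rc_self, if_pos ⟨rfl, rfl⟩, Matrix.one_apply_eq, smul_smul,
        ← algebraMap_smul F (h * κ), hκ, Nat.cast_zero, neg_zero,
        AddMonoidAlgebra.single_add, single_smul_single_eq_smul_loopUnit]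
      rfl
    · rw [blocks_Rc_of_gt hij, if_neg (fun h' => hij.ne' h'.2), if_pos ⟨rfl, hij⟩,
        Matrix.one_apply_ne hij.ne', smul_zero, add_zero, AddMonoidAlgebra.single_zero]
  · rw [if_neg hr, if_neg hr, if_neg (fun h' => hr h'.1), if_neg (fun h' => hr h'.1),
      ← neg_sub, Matrix.neg_apply, blocks_Rtil_sub_blocks_Rc, ← neg_smul, neg_sub,
      Matrix.zero_apply, zero_add, ← algebraMap_smul F h, hh,
        single_smul_single_eq_smul_loopUnit]

end LoopRepresentation

lemma List.prod_map_ite_eq_of_nodup {I M : Type} [DecidableEq I] [Monoid M] {l : List I}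
    (hl : l.Nodup) {d : I} (hd : d ∈ l) (x : M) :
    (l.map fun e => if e = d then x else 1).prod = x := by
  obtain ⟨s, t, rfl⟩ := List.append_of_mem hd
  rw [List.nodup_middle, List.nodup_cons, List.mem_append, not_or] at hl
  rw [List.map_append, List.map_cons, List.prod_append, List.prod_cons, if_pos rfl,
    List.prod_eq_one, List.prod_eq_one, one_mul, mul_one]
  · intro y hy
    obtain ⟨e, he, rfl⟩ := List.mem_map.1 hy
    exact if_neg (by rintro rfl; exact hl.1.2 he)
  · intro y hy
    obtain ⟨e, he, rfl⟩ := List.mem_map.1 hy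
    exact if_neg (by rintro rfl; exact hl.1.1 he)

section TensorPower

variable {F R : Type} [Field F] [Ring R] [Algebra F R] {k l : ℕ}

/-- The product of functionals on the factors of a tensor power. -/
def prodFunctional (ξ : Fin k → R →ₗ[F] F) : (⨂[F] _ : Fin k, R) →ₗ[F] F :=
  PiTensorProduct.lift ((MultilinearMap.mkPiAlgebra F (Fin k) F).compLinearMap ξ)

lemma prodFunctional_tprod (ξ : Fin k → R →ₗ[F] F) (x : Fin k → R) :
    prodFunctional ξ (PiTensorProduct.tprod F x) = ∏ c, ξ c (x c) := by
  simp [prodFunctional]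

variable (F) in
/-- The inclusion of a factor of a tensor power. -/
def factorHom (c : Fin k) : R →ₐ[F] ⨂[F] _ : Fin k, R :=
  PiTensorProduct.singleAlgHom (A := fun _ => R) c

lemma factorHom_commute {c c' : Fin k} (h : c ≠ c') (x y : R) :
    Commute (factorHom F c x) (factorHom F c' y) :=
  Commute.tprod (Pi.mulSingle_commute (f := fun _ : Fin k => R) h x y)

lemma list_prod_factorHom (f : Fin l → Fin k) (X : Fin l → R) :
    (List.ofFn fun d => factorHom F (f d) (X d)).prod =
      PiTensorProduct.tprod F fun c => (List.ofFn fun d => if f d = c then X d else 1).prod := by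
  have h : (List.ofFn fun d => factorHom F (f d) (X d)) =
      (List.ofFn fun d => Pi.mulSingle (M := fun _ : Fin k => R) (f d) (X d)).map
        (PiTensorProduct.tprodMonoidHom F) := by
    rw [List.map_ofFn]
    rfl
  rw [h, ← map_list_prod]
  refine congrArg (PiTensorProduct.tprod F) ?_
  ext c
  refine (map_list_prod (Pi.evalMonoidHom (fun _ : Fin k => R) c) _).trans ?_
  rw [List.map_ofFn]
  congr 2
  ext d
  simp [Pi.mulSingle_apply, eq_comm]

lemma prodFunctional_list_prod_sum (ξ : Fin k → R →ₗ[F] F) (X : Fin l → R) :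
    prodFunctional ξ (List.ofFn fun d => ∑ c, factorHom F c (X d)).prod =
      ∑ f : Fin l → Fin k, ∏ c, ξ c (List.ofFn fun d => if f d = c then X d else 1).prod := by
  have h := (MultilinearMap.mkPiAlgebraFin F l (⨂[F] _ : Fin k, R)).map_sum
    (fun d c => factorHom F c (X d))
  simp only [MultilinearMap.mkPiAlgebraFin_apply] at h
  rw [h, map_sum]
  refine Finset.sum_congr rfl fun f _ => ?_
  rw [list_prod_factorHom, prodFunctional_tprod]

lemma prod_functional_eq_zero {ξ : Fin k → R →ₗ[F] F} (hξ : ∀ c, ξ c 1 = 0) (X : Fin l → R)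
    {f : Fin l → Fin k} (hf : ¬ Function.Surjective f) :
    ∏ c, ξ c (List.ofFn fun d => if f d = c then X d else 1).prod = 0 := by
  rw [Function.Surjective] at hf
  push Not at hf
  obtain ⟨c, hc⟩ := hf
  refine Finset.prod_eq_zero (Finset.mem_univ c) ?_
  have : (List.ofFn fun d => if f d = c then X d else 1).prod = 1 := by
    refine List.prod_eq_one fun y hy => ?_
    obtain ⟨d, rfl⟩ := List.mem_ofFn.1 hy
    exact if_neg (hc d)
  rw [this, hξ]

lemma prod_functional_of_bijective (ξ : Fin k → R →ₗ[F] F) (X : Fin l → R)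
    {f : Fin l → Fin k} (hf : Function.Bijective f) :
    ∏ c, ξ c (List.ofFn fun d => if f d = c then X d else 1).prod = ∏ d, ξ (f d) (X d) := by
  rw [← hf.prod_comp]
  refine Finset.prod_congr rfl fun d _ => ?_
  congr 1
  rw [List.ofFn_eq_map]
  have : (fun e => if f e = f d then X e else 1) = fun e => if e = d then X d else 1 := by
    ext e
    by_cases h : e = d
    · subst h; simp
    · rw [if_neg h, if_neg fun h' => h (hf.1 h')]
  rw [this, List.prod_map_ite_eq_of_nodup (List.nodup_finRange l) (List.mem_finRange d)]

end TensorPower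

section Pairing

variable {F R I : Type} [Field F] [Ring R] [Algebra F R] [DecidableEq I]
  {ξ : I → R →ₗ[F] F} {X : I → R}

lemma prodFunctional_eq_zero_of_ne (hξ : ∀ i, ξ i 1 = 0)
    (hX : ∀ i j, ξ i (X j) = if i = j then 1 else 0) {a b : List I}
    (hlen : b.length ≤ a.length) (hne : (b : Multiset I) ≠ a) :
    prodFunctional (fun c => ξ (a.get c))
      (b.map fun i => ∑ c : Fin a.length, factorHom F c (X i)).prod = 0 := by
  rw [← List.ofFn_get b, List.map_ofFn]
  refine (prodFunctional_list_prod_sum _ _).trans (Finset.sum_eq_zero fun f _ => ?_)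
  by_cases hf : Function.Surjective f
  · have hb : Function.Bijective f :=
      (Fintype.bijective_iff_surjective_and_card f).2 ⟨hf, le_antisymm (by simpa) 
        (Fintype.card_le_of_surjective f hf)⟩
    rw [prod_functional_of_bijective _ _ hb, Finset.prod_eq_zero_iff]
    by_contra! H
    refine hne ?_
    have e : a.get ∘ f = b.get := by
      ext d
      have := H d (Finset.mem_univ d)
      rw [hX] at this
      by_contra h
      exact this (if_neg h)
    have ha := Fin.univ_val_map a.get
    have hb' := Fin.univ_val_map b.get
    rw [List.ofFn_get] at ha hb'
    rw [← ha, ← hb', ← e, ← Multiset.map_map]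
    congr 1
    exact Multiset.map_univ_val_equiv (Equiv.ofBijective f hb)
  · exact prod_functional_eq_zero (fun c => hξ _) _ hf

lemma exists_prodFunctional_self_eq (hξ : ∀ i, ξ i 1 = 0)
    (hX : ∀ i j, ξ i (X j) = if i = j then 1 else 0) (a : List I) :
    ∃ n : ℕ, n ≠ 0 ∧ prodFunctional (fun c => ξ (a.get c))
      (a.map fun i => ∑ c : Fin a.length, factorHom F c (X i)).prod = n := by
  have key (f : Fin a.length → Fin a.length) : ∃ n : ℕ, (f = id → n = 1) ∧
      ∏ c, ξ (a.get c) (List.ofFn fun d => if f d = c then X (a.get d) else 1).prod = n := by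
    by_cases hf : Function.Surjective f
    · rw [prod_functional_of_bijective (fun c => ξ (a.get c)) (fun d => X (a.get d))
        ⟨Finite.injective_iff_surjective.2 hf, hf⟩]
      simp only [hX]
      refine ⟨∏ d, if a.get (f d) = a.get d then 1 else 0, ?_, by push_cast; rfl⟩
      rintro rfl
      simp
    · refine ⟨0, ?_, ?_⟩
      · rintro rfl
        exact absurd Function.surjective_id hf
      · rw [Nat.cast_zero]
        exact prod_functional_eq_zero (ξ := fun c => ξ (a.get c)) (fun c => hξ _) _ hf
  choose n hn e using key
  refine ⟨∑ f, n f, ?_, ?_⟩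
  · intro h
    have := (Finset.sum_eq_zero_iff.1 h) id (Finset.mem_univ _)
    rw [hn id rfl] at this
    exact one_ne_zero this
  · have h : (a.map fun i => ∑ c : Fin a.length, factorHom F c (X i)) =
        List.ofFn fun d => ∑ c : Fin a.length, factorHom F c (X (a.get d)) :=
      (congrArg (List.map _) (List.ofFn_get a).symm).trans List.map_ofFn
    rw [h, prodFunctional_list_prod_sum, Nat.cast_sum]
    exact Finset.sum_congr rfl fun f _ => e f

end Pairing

section UnitSeries

variable {F : Type} [Field F] {N : ℕ} {B : Type} [Ring B] [Algebra F B] {q : F}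

variable (B N) in
/-- The identity matrix as a constant series. -/
def unitSeries (r : ℕ) : Matrix (Fin N) (Fin N) B := if r = 0 then 1 else 0

lemma extZero_unitSeries (r : ℤ) : extZero (unitSeries N B) r = if r = 0 then 1 else 0 := by
  unfold extZero unitSeries
  split_ifs <;> first | rfl | omega

lemma affRttL_unitSeries (a b a' b' : ℤ) :
    affRttL F q (unitSeries N B) (unitSeries N B) a b a' b' =
      affRttR F q (unitSeries N B) (unitSeries N B) a b a' b' := by
  have h (M : Matrix (Fin N × Fin N) (Fin N × Fin N) F) (a b : ℤ) :
      rttDefect M (extZero (unitSeries N B) a) (extZero (unitSeries N B) b) = 0 := by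
    rw [rttDefect, extZero_unitSeries, extZero_unitSeries]
    split_ifs <;> simp
  rw [affRttL_eq_affRttR_iff, h, h]

lemma isAffRep_unitSeries : IsAffRep q (unitSeries N B) (unitSeries N B) where
  tt _ _ := affRttL_unitSeries _ _ _ _
  uu _ _ := affRttL_unitSeries _ _ _ _
  ut _ _ := affRttL_unitSeries _ _ _ _
  t_tri _ _ h := Matrix.one_apply_ne h.ne
  u_tri _ _ h := Matrix.one_apply_ne h.ne'
  t_u i := by simp [unitSeries]
  u_t i := by simp [unitSeries]

lemma commute_unitSeries_apply (x : B) (r : ℕ) (i j : Fin N) :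
    Commute x (unitSeries N B r i j) := by
  rw [unitSeries]
  split_ifs
  · rw [Matrix.one_apply]
    split_ifs
    · exact Commute.one_right x
    · exact Commute.zero_right x
  · exact Commute.zero_right x

lemma commute_seriesMul_apply {x : B} {t t' : ℕ → Matrix (Fin N) (Fin N) B}
    (h : ∀ r i j, Commute x (t r i j)) (h' : ∀ r i j, Commute x (t' r i j)) (r : ℕ)
    (i j : Fin N) : Commute x (seriesMul t t' r i j) := by
  rw [seriesMul, twistedProduct, Matrix.of_apply]
  exact Commute.sum_right _ _ _ fun _ _ => Commute.sum_right _ _ _ fun _ _ =>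
      (h _ _ _).mul_right (h' _ _ _)

/-- The ordered product of a list of matrix series. -/
def seriesProd (l : List (ℕ → Matrix (Fin N) (Fin N) B)) : ℕ → Matrix (Fin N) (Fin N) B :=
  l.foldr seriesMul (unitSeries N B)

lemma commute_seriesProd_apply {x : B} {l : List (ℕ → Matrix (Fin N) (Fin N) B)}
    (h : ∀ t ∈ l, ∀ r i j, Commute x (t r i j)) (r : ℕ) (i j : Fin N) :
    Commute x (seriesProd l r i j) := by
  induction l generalizing r i j with
  | nil => exact commute_unitSeries_apply x r i j
  | cons t l ih =>
    exact commute_seriesMul_apply (h t List.mem_cons_self)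
      (ih fun t' ht' => h t' (List.mem_cons_of_mem _ ht')) r i j

lemma IsAffRep.seriesProd {I : Type} {t u : I → ℕ → Matrix (Fin N) (Fin N) B}
    (h : ∀ c, IsAffRep q (t c) (u c))
    (htt : ∀ c c', c ≠ c' → ∀ r r' i j k l, Commute (t c r i j) (t c' r' k l))
    (htu : ∀ c c', c ≠ c' → ∀ r r' i j k l, Commute (t c r i j) (u c' r' k l))
    (huu : ∀ c c', c ≠ c' → ∀ r r' i j k l, Commute (u c r i j) (u c' r' k l))
    {l : List I} (hl : l.Nodup) :
    IsAffRep q (_root_.seriesProd (l.map t)) (_root_.seriesProd (l.map u)) := by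
  induction l with
  | nil => exact isAffRep_unitSeries
  | cons c l ih =>
    rw [List.nodup_cons] at hl
    have hne {c'} (hc' : c' ∈ l) : c ≠ c' := fun e => hl.1 (e ▸ hc')
    refine (h c).mul (ih hl.2) ?_ ?_ ?_ ?_
    all_goals
      intro r r' i j m n
      refine commute_seriesProd_apply ?_ r' m n
      intro s hs
      obtain ⟨c', hc', rfl⟩ := List.mem_map.1 hs
      intro r' m n
    · exact htt c c' (hne hc') _ _ _ _ _ _
    · exact htu c c' (hne hc') _ _ _ _ _ _
    · exact (htu c' c (hne hc').symm _ _ _ _ _ _).symm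
    · exact huu c c' (hne hc') _ _ _ _ _ _

lemma FirstOrder.seriesProd {A : Type} [CommRing A] [Algebra A B] {L : Subalgebra A B} {h : A}
    {I : Type} {t τ : I → ℕ → Matrix (Fin N) (Fin N) B}
    (H : ∀ c, FirstOrder (seriesSubalgebra N L) h (PowerSeries.mk (t c)) (PowerSeries.mk (τ c)))
    (l : List I) :
    FirstOrder (seriesSubalgebra N L) h (PowerSeries.mk (_root_.seriesProd (l.map t)))
      (PowerSeries.mk (l.map τ).sum) := by
  induction l with
  | nil =>
    have e : PowerSeries.mk (unitSeries N B) = 1 := by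
      ext r
      rw [PowerSeries.coeff_mk, PowerSeries.coeff_one]
      rfl
    exact e ▸ FirstOrder.one
  | cons c l ih =>
    have e : PowerSeries.mk (_root_.seriesProd ((c :: l).map t)) =
        PowerSeries.mk (t c) * PowerSeries.mk (_root_.seriesProd (l.map t)) := mk_seriesMul _ _
    rw [e]
    exact (H c).mul ih

end UnitSeries

section TensorRepresentation

variable {F : Type} [Field F] {N : ℕ} {q : F}

/-- The series `T` of the `c`-th factor of a tensor power of the evaluation representation. -/
def factorT (q : F) (N : ℕ) {k : ℕ} (c : Fin k) (r : ℕ) :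
    Matrix (Fin N) (Fin N) (⨂[F] _ : Fin k, LoopMat F N) :=
  (loopT N q r).map (factorHom F c)

/-- The series `T̄` of the `c`-th factor of a tensor power of the evaluation representation. -/
def factorU (q : F) (N : ℕ) {k : ℕ} (c : Fin k) (r : ℕ) :
    Matrix (Fin N) (Fin N) (⨂[F] _ : Fin k, LoopMat F N) :=
  (loopU N q r).map (factorHom F c)

variable (q N) in
/-- The series `T` of a tensor power of the evaluation representation. -/
def tensorT (k : ℕ) : ℕ → Matrix (Fin N) (Fin N) (⨂[F] _ : Fin k, LoopMat F N) :=
  seriesProd ((List.finRange k).map (factorT q N))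

variable (q N) in
/-- The series `T̄` of a tensor power of the evaluation representation. -/
def tensorU (k : ℕ) : ℕ → Matrix (Fin N) (Fin N) (⨂[F] _ : Fin k, LoopMat F N) :=
  seriesProd ((List.finRange k).map (factorU q N))

lemma isAffRep_tensorT_tensorU (hq : q ≠ 0) (k : ℕ) :
    IsAffRep q (tensorT N q k) (tensorU N q k) :=
  IsAffRep.seriesProd (fun c => (isAffRep_loopT_loopU hq).map (factorHom F c))
    (fun _ _ h _ _ _ _ _ _ => factorHom_commute h _ _)
    (fun _ _ h _ _ _ _ _ _ => factorHom_commute h _ _)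
    (fun _ _ h _ _ _ _ _ _ => factorHom_commute h _ _) (List.nodup_finRange k)

variable (F N) in
/-- The pure tensors of elements of `loopUnits`. -/
def tensorUnits (k : ℕ) : Submonoid (⨂[F] _ : Fin k, LoopMat F N) :=
  (Submonoid.pi Set.univ fun _ => loopUnits F N).map
    (PiTensorProduct.tprodMonoidHom F (A := fun _ : Fin k => LoopMat F N))

variable (A : Type) [CommRing A] [Algebra A F]

variable (F N) in
/-- The `A`-subalgebra spanned by `tensorUnits`. -/
def tensorLattice (k : ℕ) : Subalgebra A (⨂[F] _ : Fin k, LoopMat F N) :=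
  Algebra.adjoin A (tensorUnits F N k : Set (⨂[F] _ : Fin k, LoopMat F N))

variable {A}

lemma factorHom_mem_tensorLattice {k : ℕ} (c : Fin k) {x : LoopMat F N}
    (hx : x ∈ Algebra.adjoin A (loopUnits F N : Set (LoopMat F N))) :
    factorHom F c x ∈ tensorLattice F N A k := by
  have h : Algebra.adjoin A (loopUnits F N : Set (LoopMat F N)) ≤
      (tensorLattice F N A k).comap ((factorHom F c).restrictScalars A) := by
    refine Algebra.adjoin_le fun y hy => ?_
    refine Algebra.subset_adjoin ⟨Pi.mulSingle c y, fun c' _ => ?_, rfl⟩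
    by_cases hc : c' = c
    · subst hc
      simpa using hy
    · rw [Pi.mulSingle_eq_of_ne hc]
      exact (loopUnits F N).one_mem
  exact h hx

lemma exists_algebraMap_eq_prodFunctional {k : ℕ} {ξ : Fin k → LoopMat F N →ₗ[F] F}
    (hξ : ∀ c, ∀ x ∈ loopUnits F N, ξ c x = 0 ∨ ξ c x = 1)
    {y : ⨂[F] _ : Fin k, LoopMat F N} (hy : y ∈ tensorLattice F N A k) :
    ∃ a : A, algebraMap A F a = prodFunctional ξ y := by
  rw [← Subalgebra.mem_toSubmodule, tensorLattice, Algebra.adjoin_eq_span,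
    Submonoid.closure_eq] at hy
  induction hy using Submodule.span_induction with
  | mem y hy =>
    obtain ⟨x, hx, rfl⟩ := hy
    change ∃ a : A, algebraMap A F a = prodFunctional ξ (PiTensorProduct.tprod F x)
    rw [prodFunctional_tprod]
    have h (c : Fin k) : ∃ a : A, algebraMap A F a = ξ c (x c) := by
      rcases hξ c _ (hx c (Set.mem_univ c)) with h | h
      · exact ⟨0, by rw [h, map_zero]⟩
      · exact ⟨1, by rw [h, map_one]⟩
    choose a ha using h
    exact ⟨∏ c, a c, by rw [map_prod]; exact Finset.prod_congr rfl fun c _ => ha c⟩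
  | zero => exact ⟨0, by simp⟩
  | add x y _ _ hx hy =>
    obtain ⟨a, ha⟩ := hx
    obtain ⟨b, hb⟩ := hy
    exact ⟨a + b, by rw [map_add, map_add, ha, hb]⟩
  | smul b x _ hx =>
    obtain ⟨a, ha⟩ := hx
    exact ⟨b * a, by
      rw [map_mul, ha, ← algebraMap_smul F b x, map_smul, smul_eq_mul]⟩

lemma firstOrder_twistedProduct_tensorT_tensorU {h κ κ' : A} (hh : algebraMap A F h = q - q⁻¹)
    (hκ : algebraMap A F (h * κ) = q - 1) (hκ' : algebraMap A F (h * κ') = q⁻¹ - 1) (k : ℕ)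
    (r : ℕ) (i j : Fin N) :
    ∃ z ∈ tensorLattice F N A k,
      twistedProduct (tensorT N q k) (tensorU N q k) r i j =
        (if r = 0 then 1 else 0 : Matrix (Fin N) (Fin N) (⨂[F] _ : Fin k, LoopMat F N)) i j +
          h • (∑ c : Fin k, factorHom F c (loopTau (F := F) A κ' r i j + loopUpsilon A κ r j i) +
            h • z) := by
  have HT (c : Fin k) := (firstOrder_loopT (N := N) hh hκ').map_series
    ((factorHom (R := LoopMat F N) F c).restrictScalars A) fun _ hx =>
      factorHom_mem_tensorLattice c hx
  have HU (c : Fin k) := (firstOrder_loopU (N := N) hh hκ).map_series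
    ((factorHom (R := LoopMat F N) F c).restrictScalars A) fun _ hx =>
      factorHom_mem_tensorLattice c hx
  have H := (FirstOrder.seriesProd HT (List.finRange k)).twistedProduct
    (FirstOrder.seriesProd HU (List.finRange k))
  rw [firstOrder_mk_iff] at H
  obtain ⟨-, z, hz, e⟩ := H r i j
  refine ⟨z, hz, e.trans ?_⟩
  congr 3
  rw [← Fin.sum_univ_def, ← Fin.sum_univ_def]
  simp only [Finset.sum_apply, Matrix.add_apply, Matrix.transpose_apply, Matrix.sum_apply,
    Matrix.map_apply, map_add, Finset.sum_add_distrib]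
  rfl

end TensorRepresentation

/-- The indices of the generators `s_ij^{(r)}` which are not scalars. -/
abbrev GenIndex (N : ℕ) := {b : ℕ × Fin N × Fin N // b.1 ≠ 0 ∨ b.2.2 < b.2.1}

section Spanning

variable (F : Type) [Field F] (q : F) (N : ℕ)

/-- The generator `s_ij^{(r)}` divided by `q - q⁻¹`. -/
def scaledGen (b : GenIndex N) : AlgAO F q N :=
  (q - q⁻¹)⁻¹ • sAO F q N b.1.1 b.1.2.1 b.1.2.2

lemma adjoin_range_sAO :
    Algebra.adjoin F {x | ∃ r i j, x = sAO F q N r i j} = ⊤ := by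
  have h := congrArg (Subalgebra.map (RingQuot.mkAlgHom F (AORel F q N)))
    (FreeAlgebra.adjoin_range_ι (R := F) (X := ℕ × Fin N × Fin N))
  rw [AlgHom.map_adjoin, Algebra.map_top,
    (AlgHom.range_eq_top _).2 (RingQuot.mkAlgHom_surjective F _)] at h
  rw [← h]
  congr 1
  ext x
  constructor
  · rintro ⟨r, i, j, rfl⟩
    exact ⟨_, ⟨(r, i, j), rfl⟩, rfl⟩
  · rintro ⟨_, ⟨⟨r, i, j⟩, rfl⟩, rfl⟩
    exact ⟨r, i, j, rfl⟩

variable {F q N}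

lemma smul_scaledGen (hne : q - q⁻¹ ≠ 0) (b : GenIndex N) :
    (q - q⁻¹) • scaledGen F q N b = sAO F q N b.1.1 b.1.2.1 b.1.2.2 :=
  smul_inv_smul₀ hne _

lemma sAO_eq_of_not {r : ℕ} {i j : Fin N} (hb : ¬ (r ≠ 0 ∨ j < i)) :
    sAO F q N r i j = (if r = 0 then 1 else 0 : Matrix (Fin N) (Fin N) (AlgAO F q N)) i j := by
  push Not at hb
  obtain ⟨rfl, hij⟩ := hb
  rw [if_pos rfl]
  rcases hij.lt_or_eq with h | rfl
  · rw [sAO_zero_of_lt F q h, Matrix.one_apply_ne h.ne]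
  · rw [sAO_zero_self F q, Matrix.one_apply_eq]

lemma one_apply_eq_zero_of {R : Type} [Zero R] [One R] {r : ℕ} {i j : Fin N}
    (hb : r ≠ 0 ∨ j < i) :
    (if r = 0 then 1 else 0 : Matrix (Fin N) (Fin N) R) i j = 0 := by
  split_ifs with h
  · exact Matrix.one_apply_ne (hb.resolve_left (not_not.2 h)).ne'
  · rfl

lemma adjoin_range_scaledGen (hne : q - q⁻¹ ≠ 0) :
    Algebra.adjoin F (Set.range (scaledGen F q N)) = ⊤ := by
  rw [eq_top_iff, ← adjoin_range_sAO, Algebra.adjoin_le_iff]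
  rintro _ ⟨r, i, j, rfl⟩
  by_cases hb : r ≠ 0 ∨ j < i
  · have e := smul_scaledGen hne ⟨(r, i, j), hb⟩
    exact e ▸ Subalgebra.smul_mem _ (Algebra.subset_adjoin (Set.mem_range_self _)) _
  · rw [sAO_eq_of_not hb]
    split_ifs
    · rw [Matrix.one_apply]
      split_ifs
      · exact one_mem _
      · exact zero_mem _
    · exact zero_mem _

theorem span_sortedMonomial_scaledGen {A : Type} [CommRing A] [IsLocalRing A] [Algebra A F]
    {h κ κ' : A} (hκ : algebraMap A F (h * κ) = q - 1)
    (hκ' : algebraMap A F (h * κ') = q⁻¹ - 1) (hh : algebraMap A F h = q - q⁻¹)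
    (hne : q - q⁻¹ ≠ 0) (h𝔪 : h ∈ IsLocalRing.maximalIdeal A) :
    Submodule.span F (Set.range (sortedMonomial (scaledGen F q N))) = ⊤ := by
  classical
  let w : GenIndex N → ℕ := fun b => b.1.1
  let x : ℕ → Matrix (Fin N) (Fin N) (AlgAO F q N) := fun r => Matrix.of fun i j =>
    if hb : r ≠ 0 ∨ j < i then scaledGen F q N ⟨(r, i, j), hb⟩ else 0
  have hs (r : ℕ) : Matrix.of (sAO F q N r) = (if r = 0 then 1 else 0 : A) • 1 + h • x r := by
    ext i j
    have e : ((if r = 0 then 1 else 0 : A) • (1 : Matrix (Fin N) (Fin N) (AlgAO F q N))) i j =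
        (if r = 0 then 1 else 0 : Matrix (Fin N) (Fin N) (AlgAO F q N)) i j := by
      split_ifs <;> simp
    rw [Matrix.add_apply, e]
    change sAO F q N r i j = _ +
      h • (if hb : r ≠ 0 ∨ j < i then scaledGen F q N ⟨(r, i, j), hb⟩ else 0)
    by_cases hb : r ≠ 0 ∨ j < i
    · rw [dif_pos hb, one_apply_eq_zero_of hb, zero_add, ← algebraMap_smul F h, hh,
        smul_scaledGen hne]
    · rw [dif_neg hb, smul_zero, add_zero, sAO_eq_of_not hb]
  have hx (r : ℕ) : x r ∈ matrixIn (wordSpan A (scaledGen F q N) w 2 r) := by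
    intro i j
    change (if hb : r ≠ 0 ∨ j < i then scaledGen F q N ⟨(r, i, j), hb⟩ else 0) ∈ _
    split_ifs with hb
    · exact Submodule.subset_span ⟨[⟨(r, i, j), hb⟩], by simp, by simp [w], by simp⟩
    · exact zero_mem _
  have hcomm := comm_mem_lowerSpan_of_reflection hκ hκ' hh hne h𝔪 hs hx
    (sAO_affLHS_eq_affRHS F N q)
  refine span_sortedMonomial_eq_top (A := A) (w := w) (fun n => ?_) ?_
    (adjoin_range_scaledGen hne)
  · refine Set.Finite.subset (Set.Finite.preimage Subtype.val_injective.injOn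
      ((Set.finite_Iic n).prod (Set.finite_univ (α := Fin N × Fin N)))) ?_
    exact fun b hb => ⟨hb, Set.mem_univ _⟩
  · rintro ⟨⟨r, i, j⟩, hb⟩ ⟨⟨r', i', j'⟩, hb'⟩
    have := hcomm r r' i j i' j'
    simp only [x, Matrix.of_apply, dif_pos hb, dif_pos hb'] at this
    exact this

end Spanning

section Injectivity

variable {F : Type} [Field F] {q : F} {N : ℕ}

/-- The functional detecting the ordered monomial indexed by a list. -/
def detector (a : List (GenIndex N)) : (⨂[F] _ : Fin a.length, LoopMat F N) →ₗ[F] F :=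
  prodFunctional fun c => loopCoeff F (-(a.get c).1.1) (a.get c).1.2.1 (a.get c).1.2.2

variable (F) in
/-- The classical limit of `scaledGen` in the evaluation representation. -/
def limitGen {A : Type} [CommRing A] [Algebra A F] (κ κ' : A) (b : GenIndex N) : LoopMat F N :=
  loopTau A κ' b.1.1 b.1.2.1 b.1.2.2 + loopUpsilon A κ b.1.1 b.1.2.2 b.1.2.1

lemma loopCoeff_limitGen {A : Type} [CommRing A] [Algebra A F] (κ κ' : A) (a b : GenIndex N) :
    loopCoeff F (-a.1.1) a.1.2.1 a.1.2.2 (limitGen F κ κ' b) = if a = b then 1 else 0 := by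
  refine (loopCoeff_loopTau_add_loopUpsilon A κ' κ a.2 b.2).trans ?_
  congr 1
  exact propext Subtype.ext_iff.symm

variable {A : Type} [CommRing A] [Algebra A F] {h κ κ' : A}

lemma sum_factorHom_limitGen_mem (k : ℕ) (b : GenIndex N) :
    ∑ c : Fin k, factorHom F c (limitGen F κ κ' b) ∈ tensorLattice F N A k :=
  sum_mem fun c _ => factorHom_mem_tensorLattice c
    (add_mem (loopTau_mem A κ' _ _ _) (loopUpsilon_mem A κ _ _ _))

lemma exists_lift_sortedMonomial (hκ : algebraMap A F (h * κ) = q - 1)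
    (hκ' : algebraMap A F (h * κ') = q⁻¹ - 1) (hh : algebraMap A F h = q - q⁻¹)
    (hq : q ≠ 0) (hne : q - q⁻¹ ≠ 0) (k : ℕ) (n : Multiset (GenIndex N)) :
    ∃ z ∈ tensorLattice F N A k,
      (isAffRep_tensorT_tensorU (N := N) hq k).lift
          ((uqAff_isAffRep F N q).liftAO (sortedMonomial (scaledGen F q N) n)) =
        (n.toList.map fun b => ∑ c : Fin k, factorHom F c (limitGen F κ κ' b)).prod + h • z := by
  set ρ := (isAffRep_tensorT_tensorU (N := N) hq k).lift.comp (uqAff_isAffRep F N q).liftAO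
  have hρ (b : GenIndex N) : ∃ z ∈ tensorLattice F N A k, ρ (scaledGen F q N b) =
      ∑ c : Fin k, factorHom F c (limitGen F κ κ' b) + h • z := by
    obtain ⟨z, hz, e⟩ := firstOrder_twistedProduct_tensorT_tensorU hh hκ hκ' k b.1.1 b.1.2.1 b.1.2.2
    refine ⟨z, hz, ?_⟩
    have e' : ρ (sAO F q N b.1.1 b.1.2.1 b.1.2.2) =
        twistedProduct (tensorT N q k) (tensorU N q k) b.1.1 b.1.2.1 b.1.2.2 := by
      change IsAffRep.lift _ (IsAffRep.liftAO _ _) = _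
      rw [IsAffRep.liftAO_sAO]
      exact IsAffRep.lift_Scoef _ _ _ _
    have h₀ : (if b.1.1 = 0 then 1 else 0 : Matrix (Fin N) (Fin N) (⨂[F] _ : Fin k, LoopMat F N))
        b.1.2.1 b.1.2.2 = 0 :=
      one_apply_eq_zero_of b.2
    rw [scaledGen, map_smul, e', e, h₀, zero_add, ← algebraMap_smul F h, hh, inv_smul_smul₀ hne]
    rfl
  obtain ⟨z, hz, e⟩ := exists_list_prod_eq_add_smul (sum_factorHom_limitGen_mem k) hρ n.toList
  refine ⟨z, hz, Eq.trans ?_ e⟩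
  change ρ _ = _
  rw [sortedMonomial, map_list_prod, List.map_map]
  rfl

end Injectivity

section Valuation

variable {F Γ : Type} [Field F] [LinearOrderedCommGroupWithZero Γ] (v : Valuation F Γ) {q : F}

theorem liftAO_injective (hv : v q = 1) (hv₁ : v (q - 1) < 1) (hv₂ : v (q + 1) = 1) (h₁ : q ≠ 1)
    (hchar : ∀ n : ℕ, n ≠ 0 → v n = 1) (N : ℕ) :
    Function.Injective (uqAff_isAffRep F N q).liftAO := by
  classical
  have hq : q ≠ 0 := by
    rintro rfl
    simp at hv
  have hq₂ : q + 1 ≠ 0 := by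
    intro h
    simp [h] at hv₂
  have hfac : q - q⁻¹ = (q - 1) * ((q + 1) * q⁻¹) := by
    field_simp
    ring
  have hvh : v (q - q⁻¹) < 1 := by
    rw [hfac, map_mul, map_mul, hv₂, map_inv₀, hv, inv_one, mul_one, mul_one]
    exact hv₁
  have hne : q - q⁻¹ ≠ 0 := by
    rw [hfac]
    exact mul_ne_zero (sub_ne_zero.2 h₁) (mul_ne_zero hq₂ (inv_ne_zero hq))
  let h : v.valuationSubring := ⟨q - q⁻¹, hvh.le⟩
  let κ : v.valuationSubring := ⟨q * (q + 1)⁻¹, by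
    rw [Valuation.mem_valuationSubring_iff, map_mul, map_inv₀, hv, hv₂, inv_one, mul_one]⟩
  let κ' : v.valuationSubring := ⟨-(q + 1)⁻¹, by
    rw [Valuation.mem_valuationSubring_iff, Valuation.map_neg, map_inv₀, hv₂, inv_one]⟩
  have hh : algebraMap v.valuationSubring F h = q - q⁻¹ := rfl
  have hκ : algebraMap v.valuationSubring F (h * κ) = q - 1 := by
    change (q - q⁻¹) * (q * (q + 1)⁻¹) = q - 1
    rw [hfac]
    field_simp
  have hκ' : algebraMap v.valuationSubring F (h * κ') = q⁻¹ - 1 := by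
    change (q - q⁻¹) * (-(q + 1)⁻¹) = q⁻¹ - 1
    rw [hfac]
    field_simp
    ring
  have hbd {m : Multiset (GenIndex N)} {z}
      (hz : z ∈ tensorLattice F N v.valuationSubring m.toList.length) :
      v (detector m.toList z) ≤ 1 := by
    obtain ⟨a, ha⟩ := exists_algebraMap_eq_prodFunctional
      (fun c _ hx => loopCoeff_of_mem (-(m.toList.get c).1.1 : ℤ) _ _ hx) hz
    exact ha ▸ a.2
  have hsmall {m : Multiset (GenIndex N)} {z}
      (hz : z ∈ tensorLattice F N v.valuationSubring m.toList.length) :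
      v (detector m.toList (h • z)) < 1 := by
    rw [← algebraMap_smul F h z, map_smul, smul_eq_mul, map_mul]
    exact mul_lt_one_of_lt_of_le hvh (hbd hz)
  have hlift (k : ℕ) (n : Multiset (GenIndex N)) :=
    exists_lift_sortedMonomial hκ hκ' hh hq hne k n
  refine injective_of_triangular_functionals v (sortedMonomial (scaledGen F q N))
    (span_sortedMonomial_scaledGen hκ hκ' hh hne ((Valuation.mem_maximalIdeal_iff F v).2 hvh))
    (uqAff_isAffRep F N q).liftAO.toLinearMap
    (fun m => detector m.toList ∘ₗ
      (isAffRep_tensorT_tensorU (N := N) hq m.toList.length).lift.toLinearMap) ?_ ?_ ?_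
  · intro m n
    obtain ⟨z, hz, e⟩ := hlift m.toList.length n
    change v (detector m.toList (IsAffRep.lift _ (IsAffRep.liftAO _ _))) ≤ 1
    rw [e]
    refine hbd (add_mem (list_prod_mem fun y hy => ?_) (Subalgebra.smul_mem _ hz h))
    obtain ⟨b, -, rfl⟩ := List.mem_map.1 hy
    exact sum_factorHom_limitGen_mem _ b
  · intro m n hcard hnm
    obtain ⟨z, hz, e⟩ := hlift m.toList.length n
    change v (detector m.toList (IsAffRep.lift _ (IsAffRep.liftAO _ _))) < 1
    have h₀ : detector m.toList (n.toList.map fun b => ∑ c : Fin m.toList.length,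
        factorHom F c (limitGen F κ κ' b)).prod = 0 :=
      prodFunctional_eq_zero_of_ne
        (ξ := fun b : GenIndex N => loopCoeff F (-b.1.1 : ℤ) b.1.2.1 b.1.2.2)
        (fun b => loopCoeff_neg_one b.2) (loopCoeff_limitGen κ κ')
        (by simpa using hcard) (by simpa using hnm)
    rw [e, map_add, h₀, zero_add]
    exact hsmall hz
  · intro m
    obtain ⟨z, hz, e⟩ := hlift m.toList.length m
    change v (detector m.toList (IsAffRep.lift _ (IsAffRep.liftAO _ _))) = 1
    obtain ⟨n, hn, e'⟩ := exists_prodFunctional_self_eq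
      (ξ := fun b : GenIndex N => loopCoeff F (-b.1.1 : ℤ) b.1.2.1 b.1.2.2)
      (fun b => loopCoeff_neg_one b.2) (loopCoeff_limitGen κ κ') m.toList
    have e'' : detector m.toList (m.toList.map fun b => ∑ c : Fin m.toList.length,
        factorHom F c (limitGen F κ κ' b)).prod = n := e'
    rw [e, map_add, e'', ← hchar n hn]
    exact Valuation.map_add_eq_of_lt_left v ((hsmall hz).trans_eq (hchar n hn).symm)

end Valuation

section Main

open Polynomial IsDedekindDomain

/-- The place `q = 1` of the field `ℂ(q)`. -/
def placeOne : HeightOneSpectrum ℂ[X] where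
  asIdeal := Ideal.span {X - C 1}
  isPrime := (Ideal.span_singleton_prime (X_sub_C_ne_zero 1)).2 (prime_X_sub_C 1)
  ne_bot := mt Ideal.span_singleton_eq_bot.1 (X_sub_C_ne_zero 1)

lemma valuation_placeOne_lt_one_iff (p : ℂ[X]) :
    placeOne.valuation FF (algebraMap ℂ[X] FF p) < 1 ↔ p.eval 1 = 0 := by
  rw [HeightOneSpectrum.valuation_lt_one_iff_mem]
  exact Ideal.mem_span_singleton.trans dvd_iff_isRoot

lemma valuation_placeOne_eq_one {p : ℂ[X]} (hp : p.eval 1 ≠ 0) :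
    placeOne.valuation FF (algebraMap ℂ[X] FF p) = 1 :=
  (placeOne.valuation_le_one p).antisymm
    (not_lt.1 fun h => hp ((valuation_placeOne_lt_one_iff p).1 h))

theorem liftAO_qq_injective (N : ℕ) : Function.Injective (uqAff_isAffRep FF N qq).liftAO := by
  have hX : qq = algebraMap ℂ[X] FF X := RatFunc.algebraMap_X.symm
  refine liftAO_injective (placeOne.valuation FF) ?_ ?_ ?_ ?_ (fun n hn => ?_) N
  · rw [hX]
    exact valuation_placeOne_eq_one (by simp)
  · rw [hX, ← map_one (algebraMap ℂ[X] FF), ← map_sub]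
    exact (valuation_placeOne_lt_one_iff _).2 (by simp)
  · rw [hX, ← map_one (algebraMap ℂ[X] FF), ← map_add]
    refine valuation_placeOne_eq_one ?_
    rw [eval_add, eval_X, eval_one]
    norm_num
  · rw [hX, ← map_one (algebraMap ℂ[X] FF)]
    refine (RatFunc.algebraMap_injective ℂ).ne fun h => ?_
    simpa using congrArg (eval 0) h
  · rw [← map_natCast (algebraMap ℂ[X] FF)]
    exact valuation_placeOne_eq_one (by simpa using hn)

lemma range_liftAO (F : Type) [Field F] (q : F) (N : ℕ) :
    (uqAff_isAffRep F N q).liftAO.range = YtwO F q N := by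
  rw [← Algebra.map_top, ← adjoin_range_sAO, AlgHom.map_adjoin, YtwO]
  congr 1
  ext x
  constructor
  · rintro ⟨_, ⟨r, i, j, rfl⟩, rfl⟩
    exact ⟨r, i, j, IsAffRep.liftAO_sAO _ _ _ _⟩
  · rintro ⟨r, i, j, rfl⟩
    exact ⟨_, ⟨r, i, j, rfl⟩, IsAffRep.liftAO_sAO _ _ _ _⟩

end Main

/-- The abstract algebra `𝒮` with generators `s_ij^{(r)}`, relations
`s_ij^{(0)} = 0` for `i < j`, `s_ii^{(0)} = 1` and the affine reflection equation is
isomorphic to the twisted q-Yangian `Y^tw_q(o_N)`, via `s_ij^{(r)} ↦` the coefficient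
of `u^{-r}` in `Σ_a t_ia(u) t̄_ja(u⁻¹)`. -/
theorem stmt10 (N : ℕ) :
    ∃ φ : AlgAO FF qq N ≃ₐ[FF] YtwO FF qq N,
      ∀ (r : ℕ) (i j : Fin N),
        (φ (sAO FF qq N r i j) : UqAff FF qq N) = Scoef FF qq N r i j :=
  ⟨(AlgEquiv.ofInjective _ (liftAO_qq_injective N)).trans
    (Subalgebra.equivOfEq _ _ (range_liftAO FF qq N)),
    fun _ _ _ => IsAffRep.liftAO_sAO _ _ _ _⟩
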